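/- arXiv:2509.02574 — 4 statements merged into one kernel-verified Lean document; each statement's English description precedes it below -/
import Mathlib

section
/- Let F ∈ R^{l×m} (l ≤ m) be of full row rank with d_l(F) associated to x_1^p · x_2^q for positive integers p, q. If neither x_1 nor x_2 divides d_{l−r}(F), J_{l−r}(F) = R, and x_1 · x_2 divides d_{l−r+1}(F), then there exist a unimodular matrix U ∈ R^{l×l} with entries in K[x_1,x_3,...,x_n] (not involving x_2), a unimodular matrix V ∈ R^{l×l} with entries in K[x_2,x_3,...,x_n] (not involving x_1), and F_1 ∈ R^{l×m} such that U · F = diag(I_{l−r}, x_2 I_r) · V · diag(I_{l−r}, x_1 I_r) · F_1. -/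
open Matrix MvPolynomial

/-- The set of `k × k` minors of a matrix: determinants of submatrices obtained by
choosing `k` rows and `k` columns. -/
def minorsSet {R : Type*} [CommRing R] {l m : ℕ} (k : ℕ)
    (F : Matrix (Fin l) (Fin m) R) : Set R :=
  { d | ∃ (ri : Fin k → Fin l) (ci : Fin k → Fin m),
      Function.Injective ri ∧ Function.Injective ci ∧ d = (F.submatrix ri ci).det }

/-- `d` is a greatest common divisor of the `k × k` minors of `F`. -/
def IsGcdMinors {R : Type*} [CommRing R] {l m : ℕ} (k : ℕ)
    (F : Matrix (Fin l) (Fin m) R) (d : R) : Prop :=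
  (∀ a ∈ minorsSet k F, d ∣ a) ∧ ∀ e : R, (∀ a ∈ minorsSet k F, e ∣ a) → e ∣ d

/-- `J_k(F) = R` : the ideal generated by the reduced `k`-th order minors
(the `k × k` minors divided by their g.c.d.) is the unit ideal. -/
def JEqTop {R : Type*} [CommRing R] {l m : ℕ} (k : ℕ)
    (F : Matrix (Fin l) (Fin m) R) : Prop :=
  ∃ d : R, IsGcdMinors k F d ∧ Ideal.span { b : R | d * b ∈ minorsSet k F } = ⊤

/-- The normal rank of a polynomial matrix: its rank over the fraction field. -/
noncomputable def normalRank {K : Type*} [Field K] {n l m : ℕ}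
    (F : Matrix (Fin l) (Fin m) (MvPolynomial (Fin n) K)) : ℕ :=
  (F.map (algebraMap (MvPolynomial (Fin n) K)
      (FractionRing (MvPolynomial (Fin n) K)))).rank

/-- Equivalence of matrices: `G = M * F * N` with `M`, `N` unimodular
(i.e. with determinant a unit, a nonzero constant). -/
def MatEquiv {R : Type*} [CommRing R] {l m : ℕ}
    (F G : Matrix (Fin l) (Fin m) R) : Prop :=
  ∃ (M : Matrix (Fin l) (Fin l) R) (N : Matrix (Fin m) (Fin m) R),
    IsUnit M.det ∧ IsUnit N.det ∧ G = M * F * N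

/-- A matrix is zero left prime (ZLP) if its maximal (row-size) order minors
generate the unit ideal. -/
def ZLP {R : Type*} [CommRing R] {l m : ℕ} (F : Matrix (Fin l) (Fin m) R) : Prop :=
  Ideal.span (minorsSet l F) = ⊤

section

open Polynomial

/-- A rank one projective module over a unique factorization domain is free. -/
theorem Module.free_of_rank_one_of_ufd {B P : Type*} [CommRing B] [IsDomain B]
    [UniqueFactorizationMonoid B] [AddCommGroup P] [Module B P] [Module.Finite B P]
    [Module.Projective B P] (p : P) (φ : P →ₗ[B] B) (h : B) (h0 : h ≠ 0)
    (hp : φ p = h) (hφ : ∀ x, φ x • p = h • x) : Module.Free B P := by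
  obtain ⟨n, g, s, -, -, hgs⟩ := Module.Finite.exists_comp_eq_id_of_projective B P
  have hgs' : ∀ x, g (s x) = x := fun x => LinearMap.congr_fun hgs x
  have hbasis : ∀ v : Fin n → B, g v = ∑ j, v j • g (Pi.single j 1) := by
    intro v
    conv_lhs => rw [pi_eq_sum_univ' v, map_sum]
    simp
  have htf : ∀ (c : B) (x : P), c ≠ 0 → c • x = 0 → x = 0 := by
    intro c x hc hcx
    have : s x = 0 := by
      have : c • s x = 0 := by rw [← map_smul, hcx, map_zero]
      exact (smul_eq_zero.mp this).resolve_left hc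
    rw [← hgs' x, this, map_zero]
  have hinj : ∀ x, φ x = 0 → x = 0 := fun x hx => htf h x h0 (by rw [← hφ, hx, zero_smul])
  let : NormalizedGCDMonoid B := Classical.choice inferInstance
  set a : Fin n → B := fun j => φ (g (Pi.single j 1)) with ha
  set G := Finset.univ.gcd a with hG
  have hGa : ∀ j, G ∣ a j := fun j => Finset.gcd_dvd (Finset.mem_univ j)
  have hsum : ∀ x, φ x = ∑ j, s x j * a j := by
    intro x
    conv_lhs => rw [← hgs' x, hbasis, map_sum]
    simp [ha]
  have hdiv : ∀ j, h ∣ G * s p j := by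
    intro j
    have : h ∣ Finset.univ.gcd (fun k => a k * s p j) := by
      refine Finset.dvd_gcd fun k _ => ⟨s (g (Pi.single k 1)) j, ?_⟩
      have := congrFun (congrArg s (hφ (g (Pi.single k 1)))) j
      simpa using this
    exact this.trans (Finset.gcd_mul_right' Finset.univ a (s p j)).dvd
  choose c hc using hdiv
  set z : P := g c with hz
  have hφz : φ z = G := by
    apply mul_left_cancel₀ h0
    have : G * φ p = h * φ z := by
      rw [hsum p, hz, hbasis, map_sum, Finset.mul_sum, Finset.mul_sum]
      refine Finset.sum_congr rfl fun j _ => ?_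
      rw [map_smul, smul_eq_mul, ← mul_assoc, ← mul_assoc, hc]
    rw [← this, hp, mul_comm]
  have hG0 : G ≠ 0 := by
    intro hG0
    apply h0
    rw [← hp, hsum]
    refine Finset.sum_eq_zero fun j _ => ?_
    rw [zero_dvd_iff.mp (hG0.symm ▸ hGa j : (0 : B) ∣ a j), mul_zero]
  refine Module.Free.of_equiv (LinearEquiv.ofBijective (LinearMap.toSpanSingleton B P z) ⟨?_, ?_⟩)
  · rw [injective_iff_map_eq_zero]
    intro c hc
    have := congrArg φ hc
    simpa [hφz, hG0] using this
  · intro x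
    obtain ⟨c, hc⟩ : G ∣ φ x := by
      rw [hsum]
      exact Finset.dvd_sum fun j _ => (hGa j).mul_left _
    refine ⟨c, ?_⟩
    rw [← sub_eq_zero]
    apply hinj
    simp [hφz, hc, mul_comm]

/-- Over a local ring `L`, an ideal of `L[X]` that contains a monic polynomial and that is the
unit ideal modulo the maximal ideal of `L` is the unit ideal. -/
theorem Polynomial.ideal_eq_top_of_monic_mem {L : Type*} [CommRing L] [IsLocalRing L]
    (J : Ideal L[X]) (f : L[X]) (hf : f.Monic) (hfJ : f ∈ J) (g : L[X]) (hg : g ∈ J)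
    (hg1 : g.map (IsLocalRing.residue L) = 1) : J = ⊤ := by
  by_contra hJ
  obtain ⟨M, hM, hJM⟩ := Ideal.exists_le_maximal J hJ
  have hint : (algebraMap L (L[X] ⧸ M)).IsIntegral := by
    have : Algebra.IsIntegral L (AdjoinRoot f) :=
      have := hf.finite_adjoinRoot
      inferInstance
    have hle : Ideal.span {f} ≤ M := by
      rw [Ideal.span_le, Set.singleton_subset_iff]; exact hJM hfJ
    let e : AdjoinRoot f →ₐ[L] L[X] ⧸ M := Ideal.Quotient.factorₐ L hle
    have : Algebra.IsIntegral L (L[X] ⧸ M) :=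
      Algebra.IsIntegral.of_surjective e (Ideal.Quotient.factor_surjective hle)
    exact algebraMap_isIntegral_iff.mpr this
  let : Field (L[X] ⧸ M) := Ideal.Quotient.field M
  have hmax : ((⊥ : Ideal (L[X] ⧸ M)).comap (algebraMap L (L[X] ⧸ M))).IsMaximal := by
    have : Algebra.IsIntegral L (L[X] ⧸ M) := ⟨hint⟩
    have : (⊥ : Ideal (L[X] ⧸ M)).IsMaximal := Ideal.bot_isMaximal
    exact Ideal.isMaximal_comap_of_isIntegral_of_isMaximal (R := L) ⊥
  have hm := IsLocalRing.eq_maximalIdeal hmax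
  have hC : ∀ a ∈ IsLocalRing.maximalIdeal L, C a ∈ M := by
    intro a ha
    rw [← hm, Ideal.mem_comap, Ideal.mem_bot] at ha
    exact Ideal.Quotient.eq_zero_iff_mem.mp ha
  apply hM.ne_top
  rw [Ideal.eq_top_iff_one]
  have h1 : g - 1 ∈ M := by
    have hk : g - 1 ∈ RingHom.ker (mapRingHom (IsLocalRing.residue L)) := by
      rw [RingHom.mem_ker]; simp [hg1]
    rw [Polynomial.ker_mapRingHom, IsLocalRing.ker_residue] at hk
    exact (Ideal.map_le_iff_le_comap.mpr hC) hk
  have := M.sub_mem (hJM hg) h1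
  simpa using this

/-- A projective module over `L[X]`, with `L` local, that contains a vector of monic content has a
unimodular vector of monic content as soon as its rank is at least two. -/
theorem Polynomial.exists_unimodular {L P : Type*} [CommRing L] [IsLocalRing L]
    [AddCommGroup P] [Module L[X] P] [Module.Finite L[X] P] [Module.Projective L[X] P]
    (p₁ p₂ : P) (φ₁ φ₂ : P →ₗ[L[X]] L[X]) (h : L[X]) (hh : h.Monic) (h₁₁ : φ₁ p₁ = h)
    (h₂₁ : φ₂ p₁ = 0) (h₂₂ : φ₂ p₂ = h) :
    ∃ (w : P) (ψ : P →ₗ[L[X]] L[X]), ψ w = 1 ∧ (φ₁ w).Monic := by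
  obtain ⟨n, g, s, -, -, hgs⟩ := Module.Finite.exists_comp_eq_id_of_projective L[X] P
  have hgs' : ∀ x, g (s x) = x := fun x => LinearMap.congr_fun hgs x
  set π := mapRingHom (IsLocalRing.residue L) with hπ
  have hπs : Function.Surjective π :=
    Polynomial.map_surjective _ IsLocalRing.residue_surjective
  let I : Ideal (IsLocalRing.ResidueField L)[X] := Ideal.map π (LinearMap.range φ₂)
  obtain ⟨d, hd⟩ := IsPrincipalIdealRing.principal I
  have hdiv : ∀ x, d ∣ π (φ₂ x) := by
    intro x
    rw [← Ideal.mem_span_singleton]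
    have : π (φ₂ x) ∈ I := Ideal.mem_map_of_mem π (LinearMap.mem_range_self φ₂ x)
    rw [hd] at this
    exact this
  have hdI : d ∈ I := by rw [hd]; exact Submodule.mem_span_singleton_self d
  obtain ⟨_, ⟨q, rfl⟩, hq⟩ := (Ideal.mem_map_iff_of_surjective π hπs).mp hdI
  have hd0 : d ≠ 0 := by
    rintro rfl
    have := zero_dvd_iff.mp (hdiv p₂)
    rw [h₂₂] at this
    exact (hh.map (IsLocalRing.residue L)).ne_zero this
  choose u hu using fun j => hdiv (g (Pi.single j 1))
  choose v hv using fun j => hπs (u j)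
  let ψ : P →ₗ[L[X]] L[X] := ∑ j, v j • (LinearMap.proj j ∘ₗ s)
  have hψ : ∀ x, π (φ₂ x) = d * π (ψ x) := by
    intro x
    have : φ₂ x = ∑ j, s x j * φ₂ (g (Pi.single j 1)) := by
      conv_lhs => rw [← hgs' x, pi_eq_sum_univ' (s x), map_sum, map_sum]
      simp
    rw [this, map_sum]
    simp only [ψ, LinearMap.sum_apply, map_sum, Finset.mul_sum]
    refine Finset.sum_congr rfl fun j _ => ?_
    rw [map_mul, hu]
    simp [hv]
    ring
  have hψq : π (ψ q) = 1 := by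
    apply mul_left_cancel₀ hd0
    rw [← hψ, hq, mul_one]
  have hψp : π (ψ p₁) = 0 := by
    apply mul_left_cancel₀ hd0
    rw [← hψ, h₂₁, map_zero, mul_zero]
  set N := (φ₁ q).natDegree + 1
  set w := q + (X ^ N : L[X]) • p₁ with hw
  have hwm : (φ₁ w).Monic := by
    rw [hw, map_add, map_smul, h₁₁, smul_eq_mul]
    have hm : (X ^ N * h).Monic := (monic_X_pow N).mul hh
    refine hm.add_of_right ?_
    refine degree_lt_degree ?_
    rw [(monic_X_pow N).natDegree_mul hh, natDegree_X_pow]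
    omega
  have hJ := Polynomial.ideal_eq_top_of_monic_mem
    (LinearMap.range (LinearMap.applyₗ w : (P →ₗ[L[X]] L[X]) →ₗ[L[X]] L[X]))
    (φ₁ w) hwm ⟨φ₁, rfl⟩ (ψ w) ⟨ψ, rfl⟩ (by
      change π (ψ w) = 1
      rw [hw, map_add, map_smul, map_add, hψq, smul_eq_mul, map_mul, hψp]; simp)
  obtain ⟨ψ', hψ'⟩ := (Ideal.eq_top_iff_one _).mp hJ
  exact ⟨w, ψ', hψ', hwm⟩

/-- **Local Horrocks theorem**: let `L` be a local unique factorization domain. A finite projective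
`L[X]`-module that becomes free after inverting a monic polynomial `h` is free. -/
theorem Polynomial.free_of_monic_inversion {L : Type*} [CommRing L] [IsDomain L]
    [UniqueFactorizationMonoid L] [IsLocalRing L] (r : ℕ) :
    ∀ {P : Type*} [AddCommGroup P] [Module L[X] P] [Module.Finite L[X] P]
      [Module.Projective L[X] P] (p : Fin r → P) (φ : Fin r → P →ₗ[L[X]] L[X]) (h : L[X]),
      h.Monic → (∀ x, ∑ i, φ i x • p i = h • x) →
      (∀ i j, φ i (p j) = if i = j then h else 0) → Module.Free L[X] P := by
  induction r with
  | zero =>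
    intro P _ _ _ _ p φ h hh hpφ hφp
    obtain ⟨n, g, s, -, -, hgs⟩ := Module.Finite.exists_comp_eq_id_of_projective L[X] P
    have hx : ∀ x : P, x = 0 := by
      intro x
      have h1 : h • s x = 0 := by
        rw [← map_smul, ← hpφ x, Fin.sum_univ_zero, map_zero]
      rw [← show g (s x) = x from LinearMap.congr_fun hgs x,
        (smul_eq_zero.mp h1).resolve_left hh.ne_zero, map_zero]
    have : Subsingleton P := ⟨fun a b => by rw [hx a, hx b]⟩
    infer_instance
  | succ r ih =>
    intro P _ _ _ _ p φ h hh hpφ hφp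
    rcases r with _ | r
    · exact Module.free_of_rank_one_of_ufd (p 0) (φ 0) h hh.ne_zero (by simp [hφp])
        (fun x => by simpa using hpφ x)
    obtain ⟨w, ψ, hψw, hw⟩ := Polynomial.exists_unimodular (p 0) (p 1) (φ 0) (φ 1) h hh
      (by simp [hφp]) (by simp [hφp]) (by simp [hφp])
    set h' := φ 0 w with hh'
    let pr : P →ₗ[L[X]] P := LinearMap.id - ψ.smulRight w
    have hprker : ∀ x, pr x ∈ LinearMap.ker ψ := by
      intro x
      simp [pr, hψw]
    let prk : P →ₗ[L[X]] LinearMap.ker ψ := pr.codRestrict _ hprker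
    have hprk : ∀ x : LinearMap.ker ψ, prk x = x := by
      intro x
      ext
      simp [prk, pr]
    have hprw : prk w = 0 := by
      ext
      simp [prk, pr, hψw]
    have : Module.Finite L[X] (LinearMap.ker ψ) :=
      Module.Finite.of_surjective prk fun x => ⟨x, hprk x⟩
    have : Module.Projective L[X] (LinearMap.ker ψ) :=
      Module.Projective.of_split (LinearMap.ker ψ).subtype prk (LinearMap.ext hprk)
    let φ' : Fin (r + 1) → P →ₗ[L[X]] L[X] := fun i => h' • φ i.succ - φ i.succ w • φ 0
    have hφ'w : ∀ i, φ' i w = 0 := by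
      intro i
      simp [φ', ← hh', mul_comm]
    have hfree : Module.Free L[X] (LinearMap.ker ψ) := by
      refine ih (fun i => prk (p i.succ)) (fun i => φ' i ∘ₗ (LinearMap.ker ψ).subtype) (h' * h)
        (hw.mul hh) ?_ ?_
      · intro x
        have h1 : ∑ i, φ' i x • p i.succ = (h' * h) • (x : P) - (φ 0 x * h) • w := by
          have hx := hpφ x
          have hw := hpφ w
          rw [Fin.sum_univ_succ] at hx hw
          have hx' := eq_sub_of_add_eq' hx
          have hw' := eq_sub_of_add_eq' hw
          simp only [φ', LinearMap.sub_apply, LinearMap.smul_apply, sub_smul, smul_eq_mul,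
            Finset.sum_sub_distrib, mul_smul]
          simp only [smul_comm _ (φ 0 (x : P)), ← Finset.smul_sum, hx', hw', ← hh']
          module
        have h2 := congrArg prk h1
        rw [map_sum, map_sub, map_smul, map_smul, hprw, hprk, smul_zero, sub_zero] at h2
        rw [← h2]
        simp
      · intro i j
        have h1 : φ' i (prk (p j.succ)) = φ' i (p j.succ) := by
          simp [prk, pr, hφ'w]
        change φ' i (prk (p j.succ)) = _
        rw [h1]
        simp [φ', hφp, (Fin.succ_ne_zero j).symm]
    let e : (L[X] × LinearMap.ker ψ) ≃ₗ[L[X]] P :=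
      LinearEquiv.ofLinearMap
        ((LinearMap.toSpanSingleton L[X] P w).coprod (LinearMap.ker ψ).subtype)
        (ψ.prod prk)
        (by ext x; simp [prk, pr])
        (by
          apply LinearMap.prod_ext
          · ext
            · simp [hψw]
            · simp [hprw]
          · refine LinearMap.ext fun x => Prod.ext ?_ ?_
            · simp
            · simp [hprk])
    exact Module.Free.of_equiv e

namespace Matrix

/-- A square matrix is split idempotent if it factors as `a * b` with `b * a = 1`; equivalently,
it is idempotent and its range is free. -/
def IsSplitIdem {B : Type*} [CommRing B] {n : ℕ} (e : Matrix (Fin n) (Fin n) B) : Prop :=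
  ∃ (r : ℕ) (a : Matrix (Fin n) (Fin r) B) (b : Matrix (Fin r) (Fin n) B), a * b = e ∧ b * a = 1

/-- All idempotent matrices over `B` are split, i.e. all finite projective modules are free. -/
def AllIdemSplit (B : Type*) [CommRing B] : Prop :=
  ∀ (n : ℕ) (e : Matrix (Fin n) (Fin n) B), e * e = e → e.IsSplitIdem

theorem IsSplitIdem.map {B B' : Type*} [CommRing B] [CommRing B'] {n : ℕ}
    {e : Matrix (Fin n) (Fin n) B} (he : e.IsSplitIdem) (f : B →+* B') :
    (e.map f).IsSplitIdem := by
  obtain ⟨r, a, b, hab, hba⟩ := he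
  refine ⟨r, a.map f, b.map f, ?_, ?_⟩
  · rw [← Matrix.map_mul, hab]
  · rw [← Matrix.map_mul, hba, Matrix.map_one f f.map_zero f.map_one]

theorem AllIdemSplit.of_ringEquiv {B B' : Type*} [CommRing B] [CommRing B'] (f : B ≃+* B')
    (hB : AllIdemSplit B) : AllIdemSplit B' := by
  intro n e he
  have h1 := (hB n (e.map (f.symm : B' →+* B)) (by rw [← Matrix.map_mul, he])).map (f : B →+* B')
  convert h1
  ext i j
  simp

theorem isSplitIdem_of_free_range {B : Type*} [CommRing B] [Nontrivial B] {n : ℕ}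
    (e : Matrix (Fin n) (Fin n) B) (he : e * e = e)
    (hfree : Module.Free B (LinearMap.range (toLin' e))) : e.IsSplitIdem := by
  let P := LinearMap.range (toLin' e)
  let E : P ≃ₗ[B] (Fin (Module.finrank B P) → B) := (Module.finBasis B P).equivFun
  refine ⟨_, LinearMap.toMatrix' (P.subtype ∘ₗ E.symm.toLinearMap),
    LinearMap.toMatrix' (E.toLinearMap ∘ₗ (toLin' e).rangeRestrict), ?_, ?_⟩
  · rw [← LinearMap.toMatrix'_comp]
    have : (P.subtype ∘ₗ E.symm.toLinearMap) ∘ₗ E.toLinearMap ∘ₗ (toLin' e).rangeRestrict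
        = toLin' e := by
      refine LinearMap.ext fun x => ?_
      simp
    rw [this, LinearMap.toMatrix'_toLin']
  · rw [← LinearMap.toMatrix'_comp]
    have : (E.toLinearMap ∘ₗ (toLin' e).rangeRestrict) ∘ₗ P.subtype ∘ₗ E.symm.toLinearMap
        = LinearMap.id := by
      refine LinearMap.ext fun x => ?_
      obtain ⟨y, hy⟩ := (E.symm x).2
      have : (toLin' e).rangeRestrict (E.symm x : Fin n → B) = E.symm x := by
        ext1
        rw [← hy]
        change toLin' e (toLin' e y) = toLin' e y
        rw [← LinearMap.comp_apply, ← toLin'_mul, he]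
      simp [this]
    rw [this, LinearMap.toMatrix'_id]

theorem allIdemSplit_field (K : Type*) [Field K] : AllIdemSplit K :=
  fun _ e he => isSplitIdem_of_free_range e he inferInstance

/-- Matrix form of the local Horrocks theorem. -/
theorem isSplitIdem_of_monic_inversion {L : Type*} [CommRing L] [IsDomain L]
    [UniqueFactorizationMonoid L] [IsLocalRing L] {n r : ℕ} (e : Matrix (Fin n) (Fin n) L[X])
    (he : e * e = e) (a : Matrix (Fin n) (Fin r) L[X]) (b : Matrix (Fin r) (Fin n) L[X])
    (h : L[X]) (hh : h.Monic) (hab : a * b = h • e) (hba : b * a = h • 1) : e.IsSplitIdem := by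
  refine isSplitIdem_of_free_range e he ?_
  let P := LinearMap.range (toLin' e)
  have hP : ∀ x : P, (toLin' e).rangeRestrict (x : Fin n → L[X]) = x := by
    rintro ⟨_, y, rfl⟩
    ext1
    change toLin' e (toLin' e y) = toLin' e y
    rw [← LinearMap.comp_apply, ← toLin'_mul, he]
  have hsurj := LinearMap.surjective_rangeRestrict (toLin' e)
  have : Module.Projective L[X] P :=
    Module.Projective.of_split P.subtype (toLin' e).rangeRestrict (LinearMap.ext hP)
  refine Polynomial.free_of_monic_inversion r
    (fun j => (toLin' e).rangeRestrict (fun i => a i j))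
    (fun i => LinearMap.proj i ∘ₗ toLin' b ∘ₗ P.subtype) h hh ?_ ?_
  · intro x
    simp only [← map_smul, ← map_sum]
    have h1 : ∑ i, (LinearMap.proj i ∘ₗ toLin' b ∘ₗ P.subtype) x • (fun k => a k i)
        = a *ᵥ (b *ᵥ (x : Fin n → L[X])) := by
      ext k
      simp [Matrix.mulVec, dotProduct, mul_comm]
    rw [h1, mulVec_mulVec, hab, smul_mulVec, map_smul]
    congr 1
    have := hP x
    rw [← this]
    ext1
    change e *ᵥ (e *ᵥ (e *ᵥ (x : Fin n → L[X]))) = e *ᵥ (x : Fin n → L[X])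
    rw [mulVec_mulVec, mulVec_mulVec, he, he]
  · have h2 : b * e * a = h • 1 := by
      have : h • (b * e * a) = h • (h • (1 : Matrix (Fin r) (Fin r) L[X])) := by
        rw [← Matrix.smul_mul, ← Matrix.mul_smul, ← hab, ← Matrix.mul_assoc, hba, Matrix.mul_assoc,
          hba]
        simp
      refine Matrix.ext fun i j => ?_
      have := congrFun (congrFun this i) j
      exact mul_left_cancel₀ hh.ne_zero this
    intro i j
    have h3 := congrFun (congrFun h2 i) j
    change (b *ᵥ (e *ᵥ (fun i => a i j))) i = _
    rw [mulVec_mulVec]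
    refine Eq.trans (b := (b * e * a) i j) rfl ?_
    rw [h3, smul_apply, one_apply]
    simp

/-- If `e` and `1 - e` are split, then `e` is conjugate to its image under any endomorphism of the
base ring. -/
theorem IsSplitIdem.exists_conj {B : Type*} [CommRing B] {n : ℕ} {e : Matrix (Fin n) (Fin n) B}
    (h : e.IsSplitIdem) (h' : (1 - e).IsSplitIdem) (σ : B →+* B) :
    ∃ u v : Matrix (Fin n) (Fin n) B, u * v = 1 ∧ e * u = u * e.map σ := by
  obtain ⟨r, a, b, hab, hba⟩ := h
  obtain ⟨s, c, d, hcd, hdc⟩ := h'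
  have hbc : b * c = 0 := by
    calc b * c = (b * a) * b * (c * (d * c)) := by rw [hba, hdc, Matrix.one_mul, Matrix.mul_one]
      _ = b * ((a * b) * (c * d)) * c := by simp only [Matrix.mul_assoc]
      _ = b * ((a * b) - (a * (b * a) * b)) * c := by
        rw [hcd, ← hab, Matrix.mul_sub, mul_one]; simp only [Matrix.mul_assoc]
      _ = 0 := by rw [hba]; simp
  have hda : d * a = 0 := by
    calc d * a = (d * c) * d * (a * (b * a)) := by rw [hba, hdc, Matrix.one_mul, Matrix.mul_one]
      _ = d * ((c * d) * (a * b)) * a := by simp only [Matrix.mul_assoc]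
      _ = d * ((a * b) - (a * (b * a) * b)) * a := by
        rw [hcd, ← hab, Matrix.sub_mul, one_mul]; simp only [Matrix.mul_assoc]
      _ = 0 := by rw [hba]; simp
  have hm {p q t : ℕ} (x : Matrix (Fin p) (Fin q) B) (y : Matrix (Fin q) (Fin t) B) :
    x.map σ * y.map σ = (x * y).map σ := Matrix.map_mul.symm
  have hba' : b.map σ * a.map σ = 1 := by rw [hm, hba, Matrix.map_one _ σ.map_zero σ.map_one]
  have hdc' : d.map σ * c.map σ = 1 := by rw [hm, hdc, Matrix.map_one _ σ.map_zero σ.map_one]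
  have hbc' : b.map σ * c.map σ = 0 := by rw [hm, hbc, Matrix.map_zero _ σ.map_zero]
  have hda' : d.map σ * a.map σ = 0 := by rw [hm, hda, Matrix.map_zero _ σ.map_zero]
  refine ⟨a * b.map σ + c * d.map σ, a.map σ * b + c.map σ * d, ?_, ?_⟩
  · calc _ = a * (b.map σ * a.map σ) * b + a * (b.map σ * c.map σ) * d
          + c * (d.map σ * a.map σ) * b + c * (d.map σ * c.map σ) * d := by
          simp only [Matrix.add_mul, Matrix.mul_add, Matrix.mul_assoc]; abel
      _ = 1 := by rw [hba', hbc', hda', hdc']; simp [hab, hcd]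
  · rw [← hab, ← hm]
    calc _ = a * (b * a) * b.map σ + a * (b * c) * d.map σ := by
          simp only [Matrix.mul_add, Matrix.mul_assoc]
      _ = a * (b.map σ * a.map σ) * b.map σ + c * (d.map σ * a.map σ) * b.map σ := by
          rw [hba, hbc, hba', hda']; simp
      _ = _ := by simp only [Matrix.add_mul, Matrix.mul_assoc]

theorem IsSplitIdem.of_conj {B : Type*} [CommRing B] {n : ℕ} {e f u v : Matrix (Fin n) (Fin n) B}
    (hf : f.IsSplitIdem) (huv : u * v = 1) (h : e * u = u * f) : e.IsSplitIdem := by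
  obtain ⟨r, a, b, hab, hba⟩ := hf
  refine ⟨r, u * a, b * v, ?_, ?_⟩
  · calc _ = u * (a * b) * v := by simp only [Matrix.mul_assoc]
      _ = e * (u * v) := by rw [hab, ← h, Matrix.mul_assoc]
      _ = e := by rw [huv, mul_one]
  · calc _ = b * (v * u) * a := by simp only [Matrix.mul_assoc]
      _ = 1 := by rw [mul_eq_one_comm.mp huv, Matrix.mul_one, hba]

/-- The elements `s` such that `e(x + s y)` is conjugate to `e(x)` for all `x` and `y`. -/
def patchingIdeal {A : Type*} [CommRing A] {n : ℕ} (e : Matrix (Fin n) (Fin n) A[X]) :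
    Ideal A where
  carrier := {s | ∀ x y : A[X], ∃ u v : Matrix (Fin n) (Fin n) A[X], u * v = 1 ∧
    e.map (compRingHom (x + Polynomial.C s * y)) * u = u * e.map (compRingHom x)}
  zero_mem' := fun x y => ⟨1, 1, by simp, by simp⟩
  add_mem' := by
    intro s t hs ht x y
    obtain ⟨u, v, huv, h⟩ := hs x y
    obtain ⟨u', v', huv', h'⟩ := ht (x + Polynomial.C s * y) y
    refine ⟨u' * u, v * v', ?_, ?_⟩
    · calc _ = u' * (u * v) * v' := by simp only [Matrix.mul_assoc]
        _ = 1 := by rw [huv, mul_one, huv']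
    · rw [Polynomial.C_add, add_mul, ← add_assoc, ← Matrix.mul_assoc, h', Matrix.mul_assoc, h,
        Matrix.mul_assoc]
  smul_mem' := by
    intro c s hs x y
    obtain ⟨u, v, huv, h⟩ := hs x (Polynomial.C c * y)
    refine ⟨u, v, huv, ?_⟩
    rw [← h, smul_eq_mul, Polynomial.C_mul]
    congr 4
    ring

theorem mem_patchingIdeal {A : Type*} [CommRing A] [IsDomain A] {n : ℕ}
    (e u v : Matrix (Fin n) (Fin n) A[X]) (s : A) (hs : s ≠ 0) (huv : u * v = Polynomial.C s • 1)
    (h : e * u = u * e.map (compRingHom 0)) : s ∈ patchingIdeal e := by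
  intro x y
  have hC : (Polynomial.C s : A[X]) ≠ 0 := Polynomial.C_ne_zero.mpr hs
  have hcancel : ∀ {M N : Matrix (Fin n) (Fin n) A[X]},
      Polynomial.C s • M = Polynomial.C s • N → M = N := by
    intro M N hMN
    refine Matrix.ext fun i j => ?_
    exact mul_left_cancel₀ hC (congrFun (congrFun hMN i) j)
  have hvu : v * u = Polynomial.C s • 1 := by
    have hdet : u.det ≠ 0 := by
      intro h0
      have := congrArg det huv
      rw [det_mul, h0, zero_mul, det_smul, det_one, mul_one] at this
      exact pow_ne_zero _ hC this.symm
    have h1 : u.adjugate * u * (v * u) = u.adjugate * u * (Polynomial.C s • 1) := by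
      rw [Matrix.mul_assoc, ← Matrix.mul_assoc u, huv]
      simp
    rw [adjugate_mul] at h1
    refine Matrix.ext fun i j => ?_
    have := congrFun (congrFun h1 i) j
    rw [smul_mul_assoc, smul_mul_assoc, one_mul, one_mul] at this
    exact mul_left_cancel₀ hdet this
  have hve : v * e = e.map (compRingHom 0) * v := by
    apply hcancel
    calc Polynomial.C s • (v * e) = v * e * (u * v) := by rw [huv]; simp
      _ = v * (e * u) * v := by simp only [Matrix.mul_assoc]
      _ = (v * u) * e.map (compRingHom 0) * v := by rw [h]; simp only [Matrix.mul_assoc]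
      _ = _ := by rw [hvu]; simp
  have hmap : ∀ (z : A[X]) (M N : Matrix (Fin n) (Fin n) A[X]),
      M.map (compRingHom z) * N.map (compRingHom z) = (M * N).map (compRingHom z) :=
    fun _ _ _ => Matrix.map_mul.symm
  have hone : ∀ z : A[X], (Polynomial.C s • (1 : Matrix (Fin n) (Fin n) A[X])).map (compRingHom z)
      = Polynomial.C s • 1 := by
    intro z
    ext i j : 2
    by_cases hij : i = j <;> simp [hij]
  have hcomp0 : ∀ z : A[X], (e.map (compRingHom 0)).map (compRingHom z)
      = e.map (compRingHom 0) := by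
    intro z
    refine Matrix.ext fun i j => ?_
    simp
  have key : ∀ (M N : Matrix (Fin n) (Fin n) A[X]) (x₁ x₂ y : A[X]),
      x₁ - x₂ = Polynomial.C s * y →
      M * N = Polynomial.C s • 1 →
      ∃ θ, Polynomial.C s • θ = M.map (compRingHom x₁) * N.map (compRingHom x₂) := by
    intro M N x₁ x₂ y hxy hMN
    have hd : ∀ i j, Polynomial.C s ∣ (M i j).comp x₁ - (M i j).comp x₂ := by
      intro i j
      refine (Dvd.intro y hxy.symm).trans ?_
      simp only [Polynomial.comp, Polynomial.eval₂_eq_eval_map]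
      exact sub_dvd_eval_sub _ _ _
    choose w hw using hd
    refine ⟨1 + of w * N.map (compRingHom x₂), ?_⟩
    have : M.map (compRingHom x₁) = M.map (compRingHom x₂) + Polynomial.C s • of w := by
      refine Matrix.ext fun i j => ?_
      simp [← hw]
    rw [this, Matrix.add_mul, hmap, hMN, hone, smul_add, smul_mul_assoc]
  obtain ⟨θ, hθ⟩ := key u v (x + Polynomial.C s * y) x y (by ring) huv
  obtain ⟨θ', hθ'⟩ := key u v x (x + Polynomial.C s * y) (-y) (by ring) huv
  refine ⟨θ, θ', ?_, ?_⟩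
  · apply hcancel
    apply hcancel
    calc Polynomial.C s • Polynomial.C s • (θ * θ')
        = (Polynomial.C s • θ) * (Polynomial.C s • θ') := by simp [smul_smul]
      _ = u.map (compRingHom (x + Polynomial.C s * y)) * ((v * u).map (compRingHom x))
            * v.map (compRingHom (x + Polynomial.C s * y)) := by
          rw [hθ, hθ', ← hmap]; simp only [Matrix.mul_assoc]
      _ = Polynomial.C s • Polynomial.C s • 1 := by
          rw [hvu, hone, Matrix.mul_smul, Matrix.mul_one, Matrix.smul_mul, hmap, huv, hone]
  · apply hcancel
    calc Polynomial.C s • (e.map (compRingHom (x + Polynomial.C s * y)) * θ)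
        = e.map (compRingHom (x + Polynomial.C s * y)) * (Polynomial.C s • θ) := by simp
      _ = (e * u).map (compRingHom (x + Polynomial.C s * y)) * v.map (compRingHom x) := by
          rw [hθ, ← hmap, Matrix.mul_assoc]
      _ = u.map (compRingHom (x + Polynomial.C s * y)) * (v * e).map (compRingHom x) := by
          rw [h, hve, ← hmap, ← hmap, hcomp0, hcomp0, Matrix.mul_assoc]
      _ = Polynomial.C s • (θ * e.map (compRingHom x)) := by
          rw [← hmap, ← Matrix.mul_assoc, ← hθ]; simp

theorem exists_map_algebraMap_eq_smul {R S : Type*} [CommRing R] [CommRing S] [Algebra R S]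
    (M : Submonoid R) [IsLocalization M S] {p q : ℕ} (U : Matrix (Fin p) (Fin q) S) :
    ∃ m ∈ M, ∃ V : Matrix (Fin p) (Fin q) R, V.map (algebraMap R S) = algebraMap R S m • U := by
  obtain ⟨m, hm⟩ := IsLocalization.exist_integer_multiples_of_finite M
    (fun ij : Fin p × Fin q => U ij.1 ij.2)
  choose V hV using hm
  refine ⟨m, m.2, of fun i j => V (i, j), Matrix.ext fun i j => ?_⟩
  simpa [Algebra.smul_def] using hV (i, j)

/-- Affine Horrocks theorem in matrix form. -/
theorem isSplitIdem_polynomial {A : Type*} [CommRing A] [IsDomain A]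
    [UniqueFactorizationMonoid A] (hA : AllIdemSplit A) {n : ℕ} (e : Matrix (Fin n) (Fin n) A[X])
    (he : e * e = e)
    (hmonic : ∀ f : Matrix (Fin n) (Fin n) A[X], f * f = f → ∃ (r : ℕ)
      (a : Matrix (Fin n) (Fin r) A[X]) (b : Matrix (Fin r) (Fin n) A[X]) (h : A[X]),
      h.Monic ∧ a * b = h • f ∧ b * a = h • 1) : e.IsSplitIdem := by
  have he' : (1 - e) * (1 - e) = 1 - e := by
    simp [Matrix.sub_mul, Matrix.mul_sub, he]
  have htop : patchingIdeal e = ⊤ := by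
    by_contra hne
    obtain ⟨m, hm, hle⟩ := Ideal.exists_le_maximal _ hne
    let L := Localization.AtPrime m
    have hinjL : Function.Injective (algebraMap A L) :=
      IsLocalization.injective L m.primeCompl_le_nonZeroDivisors
    have : IsDomain L := IsLocalization.isDomain_of_le_nonZeroDivisors L
      m.primeCompl_le_nonZeroDivisors
    have : UniqueFactorizationMonoid L :=
      UniqueFactorizationMonoid.of_isLocalization m.primeCompl L
    let : Algebra A[X] L[X] := Polynomial.algebra A L
    have : IsLocalization (m.primeCompl.map Polynomial.C) L[X] := Polynomial.isLocalization _ _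
    have hι : algebraMap A[X] L[X] = mapRingHom (algebraMap A L) := rfl
    have hinj : Function.Injective (algebraMap A[X] L[X]) := Polynomial.map_injective _ hinjL
    have hinjM : Function.Injective (fun M : Matrix (Fin n) (Fin n) A[X] =>
        M.map (algebraMap A[X] L[X])) := Matrix.map_injective hinj
    have hloc : ∀ f : Matrix (Fin n) (Fin n) A[X], f * f = f →
        (f.map (algebraMap A[X] L[X])).IsSplitIdem := by
      intro f hf
      obtain ⟨r, a, b, h, hh, hab, hba⟩ := hmonic f hf
      refine isSplitIdem_of_monic_inversion _ ?_ (a.map (algebraMap A[X] L[X]))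
        (b.map (algebraMap A[X] L[X])) (algebraMap A[X] L[X] h) (hh.map _) ?_ ?_
      · rw [← Matrix.map_mul, hf]
      · rw [← Matrix.map_mul, hab]
        ext i j : 2
        simp
      · rw [← Matrix.map_mul, hba]
        refine Matrix.ext fun i j => ?_
        by_cases hij : i = j <;> simp [hij]
    have hloc' : (1 - e.map (algebraMap A[X] L[X])).IsSplitIdem := by
      convert hloc _ he'
      rw [Matrix.map_sub _ (map_sub _), Matrix.map_one _ (map_zero _) (map_one _)]
    obtain ⟨u, v, huv, hu⟩ := (hloc e he).exists_conj hloc' (compRingHom 0)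
    obtain ⟨_, ⟨s, hs, rfl⟩, u', hu'⟩ :=
      exists_map_algebraMap_eq_smul (m.primeCompl.map Polynomial.C) u
    obtain ⟨_, ⟨t, ht, rfl⟩, v', hv'⟩ :=
      exists_map_algebraMap_eq_smul (m.primeCompl.map Polynomial.C) v
    have hst : s * t ∈ m.primeCompl := mul_mem hs ht
    refine hst (hle (mem_patchingIdeal e u' v' (s * t) ?_ ?_ ?_))
    · rintro h0
      exact hst (h0 ▸ m.zero_mem)
    · apply hinjM
      change (u' * v').map _ = _
      rw [Matrix.map_mul, hu', hv', smul_mul_smul_comm, huv]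
      refine Matrix.ext fun i j => ?_
      by_cases hij : i = j <;> simp [hij]
    · apply hinjM
      change (e * u').map _ = (u' * _).map _
      rw [Matrix.map_mul, Matrix.map_mul, hu', mul_smul_comm, hu, smul_mul_assoc]
      congr 2
      refine Matrix.ext fun i j => ?_
      simp [hι, ← coeff_zero_eq_eval_zero, coeff_zero_eq_aeval_zero']
  have h1 : (1 : A) ∈ patchingIdeal e := htop ▸ Submodule.mem_top
  obtain ⟨u, v, huv, h⟩ := h1 0 Polynomial.X
  have h2 : e.map (compRingHom (0 + Polynomial.C 1 * Polynomial.X)) = e := by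
    refine Matrix.ext fun i j => ?_
    simp
  rw [h2] at h
  refine IsSplitIdem.of_conj ?_ huv h
  have h3 : (e.map (evalRingHom 0)).IsSplitIdem := hA _ _ (by rw [← Matrix.map_mul, he])
  convert h3.map Polynomial.C using 1
  refine Matrix.ext fun i j => ?_
  simp [comp_zero]

theorem optionEquiv_symm_C {K : Type*} {σ : Type*} [Field K] (h : K[X]) :
    MvPolynomial.optionEquivLeft K σ ((MvPolynomial.optionEquivRight K σ).symm
      (MvPolynomial.C h)) = h.map MvPolynomial.C := by
  have key : ((MvPolynomial.optionEquivRight K σ).symm.trans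
      (MvPolynomial.optionEquivLeft K σ)).toRingEquiv.toRingHom.comp MvPolynomial.C
      = mapRingHom MvPolynomial.C := by
    refine Polynomial.ringHom_ext (fun a => ?_) ?_
    · rw [coe_mapRingHom, Polynomial.map_C]
      exact ((MvPolynomial.optionEquivRight K σ).symm.trans
        (MvPolynomial.optionEquivLeft K σ)).commutes a
    · have : (MvPolynomial.optionEquivRight K σ).symm (MvPolynomial.C Polynomial.X)
          = MvPolynomial.X none := by
        rw [AlgEquiv.symm_apply_eq, MvPolynomial.optionEquivRight_X_none]
      simp [this]
  exact RingHom.congr_fun key h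

universe u v

/-- **Quillen–Suslin theorem**: finite projective modules over a polynomial ring in finitely many
variables over a field are free. -/
theorem allIdemSplit_mvPolynomial (σ : Type u) [Finite σ] :
    ∀ (K : Type v) [Field K], AllIdemSplit (MvPolynomial σ K) := by
  induction σ using Finite.induction_empty_option with
  | of_equiv f ih =>
    intro K _
    exact (ih K).of_ringEquiv (MvPolynomial.renameEquiv K f).toRingEquiv
  | h_empty =>
    intro K _
    exact (allIdemSplit_field K).of_ringEquiv (MvPolynomial.isEmptyRingEquiv K PEmpty).symm
  | @h_option σ _ ih =>
    intro K _
    refine AllIdemSplit.of_ringEquiv (MvPolynomial.optionEquivLeft K σ).symm.toRingEquiv ?_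
    intro n e he
    refine isSplitIdem_polynomial (ih K) e he fun f hf => ?_
    let τ : MvPolynomial σ K[X] ≃ₐ[K] (MvPolynomial σ K)[X] :=
      (MvPolynomial.optionEquivRight K σ).symm.trans (MvPolynomial.optionEquivLeft K σ)
    have hτ : ∀ h : K[X], τ (MvPolynomial.C h) = h.map MvPolynomial.C := optionEquiv_symm_C
    let F := FractionRing K[X]
    let : Algebra (MvPolynomial σ K[X]) (MvPolynomial σ F) := MvPolynomial.algebraMvPolynomial
    have : IsLocalization ((nonZeroDivisors K[X]).map (MvPolynomial.C (σ := σ)))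
      (MvPolynomial σ F) := MvPolynomial.isLocalization _ _
    let ι := algebraMap (MvPolynomial σ K[X]) (MvPolynomial σ F)
    have hι : Function.Injective ι :=
      MvPolynomial.map_injective _ (IsFractionRing.injective K[X] F)
    let g := f.map τ.symm
    have hg : g * g = g := by rw [← Matrix.map_mul, hf]
    obtain ⟨r, a, b, hab, hba⟩ := ih F n (g.map ι) (by rw [← Matrix.map_mul, hg])
    obtain ⟨_, ⟨s, hs, rfl⟩, a', ha'⟩ :=
      exists_map_algebraMap_eq_smul ((nonZeroDivisors K[X]).map (MvPolynomial.C (σ := σ))) a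
    obtain ⟨_, ⟨t, ht, rfl⟩, b', hb'⟩ :=
      exists_map_algebraMap_eq_smul ((nonZeroDivisors K[X]).map (MvPolynomial.C (σ := σ))) b
    have hst : s * t ≠ 0 := nonZeroDivisors.ne_zero (mul_mem hs ht)
    have hab' : a' * b' = (MvPolynomial.C (s * t) : MvPolynomial σ K[X]) • g := by
      apply Matrix.map_injective hι
      change (a' * b').map ι = _
      rw [Matrix.map_mul, ha', hb', Matrix.smul_mul, Matrix.mul_smul, smul_smul, hab]
      refine Matrix.ext fun i j => ?_
      simp [ι]
    have hba' : b' * a' = (MvPolynomial.C (s * t) : MvPolynomial σ K[X]) • 1 := by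
      apply Matrix.map_injective hι
      change (b' * a').map ι = _
      rw [Matrix.map_mul, ha', hb', Matrix.smul_mul, Matrix.mul_smul, smul_smul, hba]
      refine Matrix.ext fun i j => ?_
      by_cases hij : i = j <;> simp [hij, ι, mul_comm]
    let c : K := (s * t).leadingCoeff⁻¹
    refine ⟨r, ((MvPolynomial.C (Polynomial.C c) : MvPolynomial σ K[X]) • a').map τ, b'.map τ,
      (Polynomial.C c * (s * t)).map MvPolynomial.C,
      (monic_C_mul_of_mul_leadingCoeff_eq_one
        (inv_mul_cancel₀ (leadingCoeff_ne_zero.mpr hst))).map _, ?_, ?_⟩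
    · rw [← Matrix.map_mul, Matrix.smul_mul, hab', smul_smul, ← map_mul, ← hτ]
      refine Matrix.ext fun i j => ?_
      simp [g]
    · rw [← Matrix.map_mul, Matrix.mul_smul, hba', smul_smul, ← map_mul, ← hτ]
      refine Matrix.ext fun i j => ?_
      by_cases hij : i = j <;> simp [hij]
end Matrix

end

section Minors

variable {R : Type*} [CommRing R]

theorem minorsSet_transpose {l m : ℕ} (k : ℕ) (F : Matrix (Fin l) (Fin m) R) :
    minorsSet k Fᵀ = minorsSet k F := by
  ext d
  constructor <;> rintro ⟨ri, ci, hri, hci, rfl⟩ <;> refine ⟨ci, ri, hci, hri, ?_⟩ <;>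
    rw [← det_transpose] <;> rfl

theorem minorsSet_map {S : Type*} [CommRing S] {l m : ℕ} (k : ℕ) (F : Matrix (Fin l) (Fin m) R)
    (f : R →+* S) : minorsSet k (F.map f) = f '' minorsSet k F := by
  ext d
  constructor
  · rintro ⟨ri, ci, hri, hci, rfl⟩
    exact ⟨_, ⟨ri, ci, hri, hci, rfl⟩, f.map_det _⟩
  · rintro ⟨_, ⟨ri, ci, hri, hci, rfl⟩, rfl⟩
    exact ⟨ri, ci, hri, hci, f.map_det _⟩

theorem det_mul_mem_span {l k : ℕ} (A : Matrix (Fin k) (Fin l) R) (B : Matrix (Fin l) (Fin k) R)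
    {I : Ideal R} (hI : ∀ φ : Fin k → Fin l, Function.Injective φ → (B.submatrix φ id).det ∈ I) :
    (A * B).det ∈ I := by
  have h1 : A * B = fun i => ∑ j, A i j • B j := by
    ext i j
    simp [Matrix.mul_apply]
  change detRowAlternating (A * B) ∈ I
  rw [h1, ← AlternatingMap.coe_multilinearMap, MultilinearMap.map_sum]
  refine Ideal.sum_mem _ fun φ _ => ?_
  rw [MultilinearMap.map_smul_univ]
  refine Ideal.mul_mem_left _ _ ?_
  by_cases hφ : Function.Injective φ
  · exact hI φ hφ
  · obtain ⟨i, j, hij, hne⟩ : ∃ i j, φ i = φ j ∧ i ≠ j := by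
      simpa [Function.Injective] using hφ
    have : (B.submatrix φ id).det = 0 := det_zero_of_row_eq hne (by ext; simp [hij])
    exact (congrArg (· ∈ I) this).mpr I.zero_mem

theorem minorsSet_mul_subset_right {p l m : ℕ} (k : ℕ) (A : Matrix (Fin p) (Fin l) R)
    (G : Matrix (Fin l) (Fin m) R) : minorsSet k (A * G) ⊆ Ideal.span (minorsSet k G) := by
  rintro _ ⟨ri, ci, hri, hci, rfl⟩
  rw [submatrix_mul A G ri id ci Function.bijective_id]
  exact det_mul_mem_span _ _ fun φ hφ => Ideal.subset_span ⟨φ, ci, hφ, hci, rfl⟩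

theorem minorsSet_mul_subset_left {p l m : ℕ} (k : ℕ) (A : Matrix (Fin p) (Fin l) R)
    (G : Matrix (Fin l) (Fin m) R) : minorsSet k (A * G) ⊆ Ideal.span (minorsSet k A) := by
  rw [← minorsSet_transpose k (A * G), ← minorsSet_transpose k A, transpose_mul]
  exact minorsSet_mul_subset_right k _ _

theorem minorsSet_add_subset {l m : ℕ} (k t : ℕ) (F : Matrix (Fin l) (Fin m) R) :
    minorsSet (k + t) F ⊆ Ideal.span (minorsSet k F) := by
  induction t with
  | zero => exact Ideal.subset_span
  | succ t ih =>
    rintro _ ⟨ri, ci, hri, hci, rfl⟩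
    rw [← Nat.add_assoc] at *
    rw [det_succ_row_zero]
    refine Ideal.sum_mem _ fun j _ => Ideal.mul_mem_left _ _ (ih ⟨_, _, ?_, ?_, rfl⟩)
    · exact hri.comp (Fin.succ_injective _)
    · exact hci.comp (Fin.succAbove_right_injective)

/-- If all `(s + 1) × (s + 1)` minors of `M` vanish, then any nonsingular `s × s` submatrix
recovers `M` up to its determinant. -/
theorem submatrix_mul_adjugate_mul_submatrix [IsDomain R] {l m s : ℕ}
    (M : Matrix (Fin l) (Fin m) R) (hM : minorsSet (s + 1) M ⊆ {0})
    (ri : Fin s → Fin l) (ci : Fin s → Fin m) (h0 : (M.submatrix ri ci).det ≠ 0) :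
    M.submatrix id ci * (M.submatrix ri ci).adjugate * M.submatrix ri id
      = (M.submatrix ri ci).det • M := by
  refine Matrix.ext fun i j => ?_
  set A := M.submatrix ri ci with hA
  let b : Matrix (Fin s) (Fin 1) R := M.submatrix ri fun _ => j
  let c : Matrix (Fin 1) (Fin s) R := M.submatrix (fun _ => i) ci
  let d : Matrix (Fin 1) (Fin 1) R := M.submatrix (fun _ => i) fun _ => j
  have hB : (fromBlocks A b c d).det = 0 := by
    have h1 : fromBlocks A b c d =
        M.submatrix (Sum.elim ri fun _ => i) (Sum.elim ci fun _ => j) := by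
      ext (x | x) (y | y) <;> rfl
    rw [← det_submatrix_equiv_self finSumFinEquiv.symm, h1, submatrix_submatrix]
    by_contra hne
    refine hne (hM ⟨_, _, ?_, ?_, rfl⟩)
    · intro x y hxy
      by_contra hn
      exact hne (det_zero_of_row_eq hn (by ext z; simp only [submatrix_apply]; rw [hxy]))
    · intro x y hxy
      by_contra hn
      exact hne (det_zero_of_column_eq hn (by intro z; simp only [submatrix_apply]; rw [hxy]))
  have h2 : fromBlocks A b c d * fromBlocks A.adjugate (-(A.adjugate * b)) 0 (A.det • 1)
      = fromBlocks (A.det • 1) 0 (c * A.adjugate) (A.det • d - c * A.adjugate * b) := by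
    rw [fromBlocks_multiply]
    congr 1
    · simp [mul_adjugate]
    · rw [Matrix.mul_neg, ← Matrix.mul_assoc, mul_adjugate]
      simp
    · simp
    · rw [Matrix.mul_neg, ← Matrix.mul_assoc]
      simp [sub_eq_neg_add]
  have h3 := congrArg det h2
  rw [det_mul, hB, zero_mul, det_fromBlocks_zero₁₂, det_smul, det_one, mul_one, eq_comm,
    mul_eq_zero, or_iff_right (pow_ne_zero _ h0), det_fin_one, Matrix.sub_apply, sub_eq_zero] at h3
  exact h3.symm

theorem exists_generalized_inverse [IsDomain R] {l m s : ℕ} (M : Matrix (Fin l) (Fin m) R)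
    (hspan : Ideal.span (minorsSet s M) = ⊤) (hM : minorsSet (s + 1) M ⊆ {0}) :
    ∃ N : Matrix (Fin m) (Fin l) R, M * N * M = M := by
  suffices ∀ x ∈ Ideal.span (minorsSet s M), ∃ N : Matrix (Fin m) (Fin l) R, M * N * M = x • M by
    simpa using this 1 (hspan ▸ Submodule.mem_top)
  intro x hx
  induction hx using Submodule.span_induction with
  | mem x hx =>
    obtain ⟨ri, ci, -, -, rfl⟩ := hx
    by_cases h0 : (M.submatrix ri ci).det = 0
    · exact ⟨0, by simp [h0]⟩
    · refine ⟨(1 : Matrix (Fin m) (Fin m) R).submatrix id ci * (M.submatrix ri ci).adjugate *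
        (1 : Matrix (Fin l) (Fin l) R).submatrix ri id, ?_⟩
      rw [← submatrix_mul_adjugate_mul_submatrix M hM ri ci h0]
      have h1 : M * (1 : Matrix (Fin m) (Fin m) R).submatrix id ci = M.submatrix id ci := by
        rw [← submatrix_id_id M, ← submatrix_mul _ _ _ _ _ Function.bijective_id]
        simp
      have h2 : (1 : Matrix (Fin l) (Fin l) R).submatrix ri id * M = M.submatrix ri id := by
        rw [← submatrix_id_id M, ← submatrix_mul _ _ _ _ _ Function.bijective_id]
        simp
      conv_rhs => rw [← h1, ← h2]
      simp only [Matrix.mul_assoc]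
  | zero => exact ⟨0, by simp⟩
  | add x y _ _ hx hy =>
    obtain ⟨N, hN⟩ := hx
    obtain ⟨N', hN'⟩ := hy
    exact ⟨N + N', by rw [Matrix.mul_add, Matrix.add_mul, hN, hN', add_smul]⟩
  | smul c x _ hx =>
    obtain ⟨N, hN⟩ := hx
    exact ⟨c • N, by rw [Matrix.mul_smul, Matrix.smul_mul, hN, smul_smul, smul_eq_mul]⟩

/-- A matrix of constant rank `s` over a ring whose finite projective modules are free becomes,
after unimodular row operations, zero outside its first `s` rows. -/
theorem exists_unimodular_rows_eq_zero [IsDomain R] (hR : AllIdemSplit R) {l m s : ℕ}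
    (M : Matrix (Fin l) (Fin m) R) (hspan : Ideal.span (minorsSet s M) = ⊤)
    (hM : minorsSet (s + 1) M ⊆ {0}) :
    ∃ U V : Matrix (Fin l) (Fin l) R, U * V = 1 ∧ ∀ i : Fin l, s ≤ i → ∀ j, (U * M) i j = 0 := by
  obtain ⟨N, hN⟩ := exists_generalized_inverse M hspan hM
  have he : M * N * (M * N) = M * N := by rw [← Matrix.mul_assoc, hN]
  obtain ⟨r, a, b, hab, hba⟩ := hR l (M * N) he
  obtain ⟨r', c, d, hcd, hdc⟩ := hR l (1 - M * N) (by simp [Matrix.sub_mul, Matrix.mul_sub, he])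
  have hbc : b * c = 0 := by
    calc b * c = b * (a * b) * (c * d) * c := by
          rw [← Matrix.mul_assoc b, hba, Matrix.one_mul, Matrix.mul_assoc b, Matrix.mul_assoc c,
            hdc, Matrix.mul_one]
      _ = 0 := by rw [hab, hcd, Matrix.mul_assoc b, Matrix.mul_sub, Matrix.mul_one, he]; simp
  have hda : d * a = 0 := by
    calc d * a = d * (c * d) * (a * b) * a := by
          rw [← Matrix.mul_assoc d, hdc, Matrix.one_mul, Matrix.mul_assoc d, Matrix.mul_assoc a,
            hba, Matrix.mul_one]
      _ = 0 := by rw [hab, hcd, Matrix.mul_assoc d, Matrix.sub_mul, Matrix.one_mul, he]; simp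
  have hdM : d * M = 0 := by
    rw [← hN, ← hab, ← Matrix.mul_assoc, ← Matrix.mul_assoc, hda]; simp
  have hPQ : fromRows b d * fromCols a c = 1 := by
    rw [fromRows_mul_fromCols, hba, hbc, hda, hdc, fromBlocks_one]
  have hQP : fromCols a c * fromRows b d = 1 := by
    rw [fromCols_mul_fromRows, hab, hcd]; simp
  have hcard := square_of_invertible _ _ hPQ hQP
  have hl : r + r' = l := by simpa using hcard
  have hrs : r ≤ s := by
    by_contra! hlt
    have h1 : b * M * (N * a) = 1 := by
      rw [← Matrix.mul_assoc, Matrix.mul_assoc b, ← hab, ← Matrix.mul_assoc b, hba, Matrix.one_mul,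
        hba]
    have h2 : (1 : R) ∈ minorsSet (s + 1) (b * M * (N * a)) := by
      refine ⟨Fin.castLE hlt, Fin.castLE hlt, Fin.castLE_injective hlt,
        Fin.castLE_injective hlt, ?_⟩
      rw [h1, submatrix_one _ (Fin.castLE_injective hlt), det_one]
    have h3 : Ideal.span (minorsSet (s + 1) (b * M)) ≤ ⊥ :=
      Ideal.span_le.mpr ((minorsSet_mul_subset_right _ _ _).trans
        (Ideal.span_le (I := ⊥).mpr (by simpa using hM)))
    exact one_ne_zero (h3 (minorsSet_mul_subset_left _ _ _ h2))
  let E : Fin l ≃ Fin r ⊕ Fin r' := (finCongr hl.symm).trans finSumFinEquiv.symm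
  refine ⟨(fromRows b d).submatrix E id, (fromCols a c).submatrix id E, ?_, ?_⟩
  · rw [← submatrix_mul _ _ _ _ _ Function.bijective_id, hPQ, submatrix_one_equiv]
  · intro i hi j
    obtain ⟨k, hk⟩ : ∃ k, E i = Sum.inr k := by
      refine ⟨⟨i - r, by omega⟩, ?_⟩
      rw [Equiv.trans_apply, Equiv.symm_apply_eq]
      ext
      simp
      omega
    have := congrFun (congrFun hdM k) j
    simpa [Matrix.mul_apply, hk] using this

end Minors

section Elimination

variable {K σ : Type*} [Field K] (i : σ)

/-- Substitution of zero for the variable `i`. -/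
noncomputable def killVar : MvPolynomial σ K →ₐ[K] MvPolynomial ↥({i}ᶜ : Set σ) K :=
  open Classical in aeval fun j => if h : j ∈ ({i}ᶜ : Set σ) then X ⟨j, h⟩ else 0

theorem killVar_X_self : killVar (K := K) i (X i) = 0 := by
  simp [killVar]

theorem killVar_rename (f : MvPolynomial ↥({i}ᶜ : Set σ) K) :
    killVar i (rename Subtype.val f) = f := by
  suffices ((killVar i).comp (rename Subtype.val)) = AlgHom.id K _ from AlgHom.congr_fun this f
  refine MvPolynomial.algHom_ext fun j => ?_
  simp [killVar]

theorem X_dvd_iff_killVar_eq_zero (f : MvPolynomial σ K) : X i ∣ f ↔ killVar i f = 0 := by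
  constructor
  · rintro ⟨g, rfl⟩
    rw [map_mul, killVar_X_self, zero_mul]
  · intro h
    have key : ((Ideal.Quotient.mkₐ K (Ideal.span {X i})).comp
        (rename Subtype.val)).comp (killVar i) = Ideal.Quotient.mkₐ K (Ideal.span {X i}) := by
      refine MvPolynomial.algHom_ext fun j => ?_
      by_cases hj : j = i
      · subst hj
        simp only [AlgHom.comp_apply, killVar_X_self, map_zero]
        exact (Ideal.Quotient.eq_zero_iff_mem.mpr (Ideal.mem_span_singleton_self _)).symm
      · simp [killVar, hj]
    have h1 := AlgHom.congr_fun key f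
    rw [AlgHom.comp_apply, h, map_zero, eq_comm] at h1
    exact Ideal.mem_span_singleton.mp (Ideal.Quotient.eq_zero_iff_mem.mp h1)

/-- If the `s × s` minors of `F` generate the unit ideal and the variable `i` divides all
`(s + 1) × (s + 1)` minors, then `F` becomes divisible by `diag(I_s, x_i I)` after multiplication by
a unimodular matrix not involving `x_i`. -/
theorem exists_mul_eq_diagonal_mul [Finite σ] {l m s : ℕ}
    (F : Matrix (Fin l) (Fin m) (MvPolynomial σ K))
    (hspan : Ideal.span (minorsSet s F) = ⊤) (hdvd : ∀ a ∈ minorsSet (s + 1) F, X i ∣ a) :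
    ∃ U V : Matrix (Fin l) (Fin l) (MvPolynomial σ K), U * V = 1 ∧
      (∀ a b, U a b ∈ supported K ({i}ᶜ : Set σ)) ∧
      (∀ a b, V a b ∈ supported K ({i}ᶜ : Set σ)) ∧
      ∃ G : Matrix (Fin l) (Fin m) (MvPolynomial σ K),
        U * F = (diagonal (fun j => if (j : ℕ) < s then 1 else X i) :
          Matrix (Fin l) (Fin l) (MvPolynomial σ K)) * G := by
  obtain ⟨U, V, hUV, hU⟩ := exists_unimodular_rows_eq_zero (s := s)
    (allIdemSplit_mvPolynomial ↥({i}ᶜ : Set σ) K) (F.map (killVar i).toRingHom)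
    (by rw [minorsSet_map, ← Ideal.map_span, hspan, Ideal.map_top])
    (by
      rw [minorsSet_map]
      rintro _ ⟨a, ha, rfl⟩
      exact (X_dvd_iff_killVar_eq_zero i a).mp (hdvd a ha))
  let ι : MvPolynomial ↥({i}ᶜ : Set σ) K →+* MvPolynomial σ K := (rename Subtype.val).toRingHom
  have hι : ∀ f, ι f ∈ supported K ({i}ᶜ : Set σ) := by
    intro f
    rw [supported_eq_range_rename]
    exact ⟨f, rfl⟩
  have hdiv : ∀ (a : Fin l) (b : Fin m), s ≤ a → X i ∣ (U.map ι * F) a b := by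
    intro a b ha
    rw [X_dvd_iff_killVar_eq_zero, ← hU a ha b]
    simp only [Matrix.mul_apply, map_sum, map_mul, map_apply]
    exact Finset.sum_congr rfl fun k _ => congrArg (· * _) (killVar_rename i _)
  choose w hw using hdiv
  refine ⟨U.map ι, V.map ι, ?_, fun _ _ => hι _, fun _ _ => hι _,
    of fun a b => if h : s ≤ a then w a b h else (U.map ι * F) a b, ?_⟩
  · rw [← Matrix.map_mul, hUV, Matrix.map_one ι ι.map_zero ι.map_one]
  · refine Matrix.ext fun a b => ?_
    rw [diagonal_mul]
    by_cases ha : s ≤ a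
    · simp [ha, not_lt.mpr ha, ← hw]
    · simp [ha, not_le.mp ha]

theorem not_X_dvd_X {i j : σ} (hij : i ≠ j) : ¬ (X i : MvPolynomial σ K) ∣ X j := by
  rw [X_dvd_X]
  simpa using hij

theorem isUnit_of_dvd_X_pow_mul_X_pow {i j : σ} {d : MvPolynomial σ K} {p q : ℕ}
    (hd : d ∣ X i ^ p * X j ^ q) (hi : ¬ X i ∣ d) (hj : ¬ X j ∣ d) : IsUnit d := by
  have h1 : IsRelPrime d (X i ^ p) :=
    ((X_prime (i := i)).irreducible.isRelPrime_iff_not_dvd.mpr hi).symm.pow_right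
  have h2 : IsRelPrime d (X j ^ q) :=
    ((X_prime (i := j)).irreducible.isRelPrime_iff_not_dvd.mpr hj).symm.pow_right
  exact (h1.mul_right h2) dvd_rfl hd

end Elimination

theorem JEqTop.span_minorsSet_eq_top {R : Type*} [CommRing R] {l m k : ℕ}
    {F : Matrix (Fin l) (Fin m) R} (hJ : JEqTop k F) (h : ∀ d, IsGcdMinors k F d → IsUnit d) :
    Ideal.span (minorsSet k F) = ⊤ := by
  obtain ⟨d, hd, hspan⟩ := hJ
  rw [eq_top_iff, ← hspan, Ideal.span_le]
  intro b hb
  exact (Ideal.unit_mul_mem_iff_mem _ (h d hd)).mp (Ideal.subset_span hb)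

theorem dvd_minors_of_diagonal_mul {R : Type*} [CommRing R] {l m k : ℕ} {x : R} (hx : Prime x)
    (D : Fin l → R) (hD : ∀ j, ¬ x ∣ D j) (G : Matrix (Fin l) (Fin m) R)
    (h : ∀ a ∈ minorsSet k (diagonal D * G), x ∣ a) : ∀ a ∈ minorsSet k G, x ∣ a := by
  rintro _ ⟨ri, ci, hri, hci, rfl⟩
  have h1 := h _ ⟨ri, ci, hri, hci, rfl⟩
  have h2 : (diagonal D * G).submatrix ri ci
      = diagonal (fun j => D (ri j)) * G.submatrix ri ci := by
    refine Matrix.ext fun i j => ?_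
    simp [diagonal_mul]
  rw [h2, det_mul, det_diagonal] at h1
  refine (hx.dvd_or_dvd h1).resolve_left fun h3 => ?_
  obtain ⟨j, -, hj⟩ := (hx.dvd_finsetProd_iff _).mp h3
  exact hD _ hj

/-- For `F` of full row rank with `d_l(F)` associated to `x₁^p x₂^q`: if
neither `x₁` nor `x₂` divides `d_{l-r}(F)`, `J_{l-r}(F) = R` and `x₁x₂ ∣ d_{l-r+1}(F)`,
then `U * F = diag(I_{l-r}, x₂ I_r) * V * diag(I_{l-r}, x₁ I_r) * F₁` with `U` unimodular
not involving `x₂` and `V` unimodular not involving `x₁`. -/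
theorem statement5 {K : Type*} [Field K] {n l m : ℕ} (hlm : l ≤ m)
    (v1 v2 : Fin n) (hv1 : (v1 : ℕ) = 0) (hv2 : (v2 : ℕ) = 1)
    (r : ℕ) (hr : r ≤ l)
    (F : Matrix (Fin l) (Fin m) (MvPolynomial (Fin n) K))
    (hfull : normalRank F = l)
    (p q : ℕ) (hp : 0 < p) (hq : 0 < q)
    (dl : MvPolynomial (Fin n) K) (hdl : IsGcdMinors l F dl)
    (hdlv : Associated dl (X v1 ^ p * X v2 ^ q))
    (dlr : MvPolynomial (Fin n) K) (hdlr : IsGcdMinors (l - r) F dlr)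
    (hnd1 : ¬ X v1 ∣ dlr) (hnd2 : ¬ X v2 ∣ dlr)
    (hJ : JEqTop (l - r) F)
    (dlr1 : MvPolynomial (Fin n) K) (hdlr1 : IsGcdMinors (l - r + 1) F dlr1)
    (hdvd : X v1 * X v2 ∣ dlr1) :
    ∃ (U V : Matrix (Fin l) (Fin l) (MvPolynomial (Fin n) K))
      (F1 : Matrix (Fin l) (Fin m) (MvPolynomial (Fin n) K)),
      IsUnit U.det ∧ IsUnit V.det ∧
      (∀ a b, U a b ∈ MvPolynomial.supported K (({v2} : Set (Fin n))ᶜ)) ∧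
      (∀ a b, V a b ∈ MvPolynomial.supported K (({v1} : Set (Fin n))ᶜ)) ∧
      U * F =
        Matrix.diagonal (fun j : Fin l => if (j : ℕ) < l - r then 1 else X v2) * V *
          Matrix.diagonal (fun j : Fin l => if (j : ℕ) < l - r then 1 else X v1) * F1 := by
  have h12 : v1 ≠ v2 := fun h => by rw [h, hv2] at hv1; exact one_ne_zero hv1
  have hspan : Ideal.span (minorsSet (l - r) F) = ⊤ := by
    refine JEqTop.span_minorsSet_eq_top hJ fun d hd => ?_
    have hdvd : d ∣ dlr := hdlr.2 d hd.1
    refine isUnit_of_dvd_X_pow_mul_X_pow (i := v1) (j := v2) (p := p) (q := q) ?_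
      (fun h => hnd1 (h.trans hdvd)) (fun h => hnd2 (h.trans hdvd))
    refine (hdl.2 d fun a ha => ?_).trans hdlv.dvd
    have hle : Ideal.span (minorsSet (l - r) F) ≤ Ideal.span {d} :=
      Ideal.span_le.mpr fun b hb => Ideal.mem_span_singleton.mpr (hd.1 b hb)
    refine Ideal.mem_span_singleton.mp (hle (minorsSet_add_subset (l - r) r F ?_))
    rwa [Nat.sub_add_cancel hr]
  have hminors : ∀ a ∈ minorsSet (l - r + 1) F, X v1 * X v2 ∣ a := fun a ha =>
    hdvd.trans (hdlr1.1 a ha)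
  obtain ⟨U, U', hU, hUs, -, G, hG⟩ := exists_mul_eq_diagonal_mul v2 F hspan
    fun a ha => (dvd_mul_left _ _).trans (hminors a ha)
  set D : Fin l → MvPolynomial (Fin n) K := fun j => if (j : ℕ) < l - r then 1 else X v2 with hD
  have hF : F = U' * diagonal D * G := by
    rw [Matrix.mul_assoc, ← hG, ← Matrix.mul_assoc, mul_eq_one_comm.mp hU, Matrix.one_mul]
  have hGspan : Ideal.span (minorsSet (l - r) G) = ⊤ := by
    rw [eq_top_iff, ← hspan, Ideal.span_le, hF]
    exact minorsSet_mul_subset_right _ _ _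
  have hGdvd : ∀ a ∈ minorsSet (l - r + 1) G, X v1 ∣ a := by
    refine dvd_minors_of_diagonal_mul X_prime D (fun j => ?_) G fun a ha => ?_
    · rw [hD]
      dsimp only
      split_ifs
      · exact fun h => X_prime.not_isUnit (isUnit_of_dvd_one h)
      · exact not_X_dvd_X h12
    · rw [← hG] at ha
      have hle : Ideal.span (minorsSet (l - r + 1) F) ≤ Ideal.span {X v1} :=
        Ideal.span_le.mpr fun b hb =>
          Ideal.mem_span_singleton.mpr ((dvd_mul_right _ _).trans (hminors b hb))
      exact Ideal.mem_span_singleton.mp (hle (minorsSet_mul_subset_right _ _ _ ha))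
  obtain ⟨V', V, hV, -, hVs, F1, hF1⟩ := exists_mul_eq_diagonal_mul v1 G hGspan hGdvd
  refine ⟨U, V, F1, isUnit_det_of_right_inverse hU, isUnit_det_of_left_inverse hV, hUs, hVs, ?_⟩
  rw [hG, Matrix.mul_assoc, ← hF1, Matrix.mul_assoc, ← Matrix.mul_assoc V,
    mul_eq_one_comm.mp hV, Matrix.one_mul]
end

section
/- Let F ∈ R^{l×l} be of full rank with det F associated to x_1^p x_2^q (p, q positive integers). Suppose there exist row indices i_1,...,i_m and column indices j_1,...,j_m such that x_1 does not divide the m×m minor of F with rows i_1,...,i_m and columns j_1,...,j_m, while for every additional row index k_{m+1} ∉ {i_1,...,i_m} and every choice of m+1 column indices p_1,...,p_{m+1} from {1,...,l}, x_1 divides the (m+1)×(m+1) minor of F with rows i_1,...,i_m,k_{m+1} and columns p_1,...,p_{m+1}. Then x_1 divides every (m+1)×(m+1) minor of F, i.e., x_1 divides d_{m+1}(F). -/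
open Matrix MvPolynomial

/-- A product factoring through a smaller index type is singular. -/
theorem det_mul_eq_zero_of_inner_lt {S : Type*} [CommRing S] {m : ℕ}
    (W : Matrix (Fin (m + 1)) (Fin m) S) (C : Matrix (Fin m) (Fin (m + 1)) S) :
    (W * C).det = 0 := by
  have h : W * C = Matrix.of (fun i => (Fin.snoc (W i) 0 : Fin (m + 1) → S)) *
      Matrix.of (fun i j => (Fin.snoc (fun i => C i j) 0 : Fin (m + 1) → S) i) := by
    ext i j
    simp [Matrix.mul_apply, Fin.sum_univ_castSucc]
  rw [h, Matrix.det_mul, Matrix.det_eq_zero_of_column_eq_zero (Fin.last m) (by simp), zero_mul]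

/-- Over a domain, a nonzero `m × m` minor all of whose one-row-one-column borderings vanish
forces all `(m + 1) × (m + 1)` minors to vanish. -/
theorem det_submatrix_eq_zero_of_bordered_minors_eq_zero {S ι κ : Type*} [CommRing S] [IsDomain S]
    {m : ℕ} (A : Matrix ι κ S) (ri : Fin m → ι) (ci : Fin m → κ)
    (hD : (A.submatrix ri ci).det ≠ 0)
    (hb : ∀ k c, (A.submatrix (Fin.snoc ri k : Fin (m + 1) → ι)
      (Fin.snoc ci c : Fin (m + 1) → κ)).det = 0)
    (r : Fin (m + 1) → ι) (s : Fin (m + 1) → κ) : (A.submatrix r s).det = 0 := by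
  set D := (A.submatrix ri ci).det with hDdef
  let w : ι → Fin (m + 1) → S := fun k i =>
    (-1) ^ ((i : ℕ) + m) * (A.submatrix ((Fin.snoc ri k : Fin (m + 1) → ι) ∘ i.succAbove) ci).det
  have hw : ∀ k c, D * A k c = ∑ i : Fin m, -w k i.castSucc * A (ri i) c := by
    intro k c
    have h := hb k c
    rw [Matrix.det_succ_column _ (Fin.last m), Fin.sum_univ_castSucc] at h
    have hlast : (Fin.snoc ri k : Fin (m + 1) → ι) ∘ Fin.castSucc = ri := by
      ext i; simp
    have hcol : (Fin.snoc ci c : Fin (m + 1) → κ) ∘ Fin.castSucc = ci := by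
      ext i; simp
    simp only [Matrix.submatrix_submatrix, Fin.succAbove_last, hlast, hcol, Matrix.submatrix_apply,
      Fin.snoc_last, Fin.snoc_castSucc, Fin.val_last, Even.neg_one_pow ⟨m, rfl⟩, one_mul] at h
    rw [← hDdef, add_comm, mul_comm (A k c)] at h
    rw [eq_neg_of_add_eq_zero_left h, ← Finset.sum_neg_distrib]
    refine Finset.sum_congr rfl fun i _ => ?_
    simp only [w]
    ring
  have hfac : D • A.submatrix r s =
      Matrix.of (fun i (j : Fin m) => -w (r i) j.castSucc) * A.submatrix ri s := by
    ext i j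
    simpa [Matrix.mul_apply] using hw (r i) (s j)
  have h0 := congrArg Matrix.det hfac
  rw [det_mul_eq_zero_of_inner_lt, Matrix.det_smul] at h0
  exact (mul_eq_zero.mp h0).resolve_left (pow_ne_zero _ hD)

/-- If some `m × m` minor of `F` with rows `i₁,…,iₘ` is not divisible by
`x₁` while every `(m+1) × (m+1)` minor whose rows are `i₁,…,iₘ, k` (any extra row `k`)
and arbitrary `m+1` columns is divisible by `x₁`, then `x₁` divides every
`(m+1) × (m+1)` minor of `F`, i.e. `x₁ ∣ d_{m+1}(F)`. -/
theorem statement6 {K : Type*} [Field K] {n l : ℕ}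
    (v1 v2 : Fin n) (hv1 : (v1 : ℕ) = 0) (hv2 : (v2 : ℕ) = 1)
    (F : Matrix (Fin l) (Fin l) (MvPolynomial (Fin n) K))
    (p q : ℕ) (hp : 0 < p) (hq : 0 < q)
    (hdet : Associated F.det (X v1 ^ p * X v2 ^ q))
    (m : ℕ) (ri ci : Fin m → Fin l)
    (hri : Function.Injective ri) (hci : Function.Injective ci)
    (hnd : ¬ X v1 ∣ (F.submatrix ri ci).det)
    (hdiv : ∀ k : Fin l, k ∉ Set.range ri →
      ∀ cc : Fin (m + 1) → Fin l, Function.Injective cc →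
        X v1 ∣ (F.submatrix (Fin.snoc ri k) cc).det) :
    ∀ a ∈ minorsSet (m + 1) F, X v1 ∣ a := by
  have hprime : (Ideal.span {(X v1 : MvPolynomial (Fin n) K)}).IsPrime :=
    (Ideal.span_singleton_prime (X_ne_zero v1)).mpr (X_prime (R := K))
  let φ := Ideal.Quotient.mk (Ideal.span {(X v1 : MvPolynomial (Fin n) K)})
  have hφ : ∀ {t : ℕ} (r c : Fin t → Fin l),
      ((F.map φ).submatrix r c).det = 0 ↔ X v1 ∣ (F.submatrix r c).det := by
    intro t r c
    rw [← Ideal.mem_span_singleton, ← Ideal.Quotient.eq_zero_iff_mem, RingHom.map_det]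
    rfl
  have hrep : ∀ {t : ℕ} {f : Fin t → Fin l} {x : Fin l}, x ∈ Set.range f →
      ∃ i, (Fin.snoc f x : Fin (t + 1) → Fin l) (Fin.castSucc i) =
        (Fin.snoc f x : Fin (t + 1) → Fin l) (Fin.last t) := by
    rintro t f x ⟨i, rfl⟩
    exact ⟨i, by simp⟩
  rintro _ ⟨r, s, -, -, rfl⟩
  refine (hφ r s).mp (det_submatrix_eq_zero_of_bordered_minors_eq_zero (F.map φ) ri ci
    (mt (hφ ri ci).mp hnd) (fun k c => ?_) r s)
  by_cases hk : k ∈ Set.range ri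
  · obtain ⟨i, hi⟩ := hrep hk
    refine Matrix.det_zero_of_row_eq (Fin.castSucc_lt_last i).ne (funext fun j => ?_)
    simp only [Matrix.submatrix_apply, hi]
  by_cases hc : c ∈ Set.range ci
  · obtain ⟨i, hi⟩ := hrep hc
    refine Matrix.det_zero_of_column_eq (Fin.castSucc_lt_last i).ne (fun j => ?_)
    simp only [Matrix.submatrix_apply, hi]
  exact (hφ _ _).mpr (hdiv k hk _ (Fin.snoc_injective_iff.mpr ⟨hci, hc⟩))
end

section
/- Let F ∈ R^{l×m} (l ≤ m) be of full row rank with d_l(F) associated to d_1^p, where d_1 = x_1 − f_1(x_2,...,x_n) for some f_1 ∈ K[x_2,...,x_n] and p is a positive integer. If J_k(F) = R for all k = 1,2,...,l, then F is equivalent to its Smith normal form [D 0_{l×(m−l)}], where D = diag(d_1^{r_1}, d_1^{r_2},..., d_1^{r_l}) with d_k(F) associated to d_1^{p_k}, p_0 = 0, and r_k = p_k − p_{k−1} for k = 1,...,l. -/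
open Matrix MvPolynomial

section VecEquiv

variable {R S ι : Type*} [CommRing R] [CommRing S] [Fintype ι] [DecidableEq ι]

/-- Two column vectors lie in the same orbit of the general linear group. -/
def VecEquiv (v w : ι → R) : Prop :=
  ∃ M : (Matrix ι ι R)ˣ, (M : Matrix ι ι R) *ᵥ v = w

/-- A vector is unimodular if its entries generate the unit ideal. -/
def IsUnimodularVec (v : ι → R) : Prop :=
  ∃ c : ι → R, c ⬝ᵥ v = 1

namespace VecEquiv

theorem refl (v : ι → R) : VecEquiv v v := ⟨1, by simp⟩

theorem symm {v w : ι → R} (h : VecEquiv v w) : VecEquiv w v := by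
  obtain ⟨M, rfl⟩ := h
  exact ⟨M⁻¹, by rw [mulVec_mulVec, Units.inv_mul, one_mulVec]⟩

theorem trans {u v w : ι → R} (h : VecEquiv u v) (h' : VecEquiv v w) : VecEquiv u w := by
  obtain ⟨M, rfl⟩ := h
  obtain ⟨N, rfl⟩ := h'
  exact ⟨N * M, by rw [Units.val_mul, mulVec_mulVec]⟩

theorem map (f : R →+* S) {v w : ι → R} (h : VecEquiv v w) : VecEquiv (f ∘ v) (f ∘ w) := by
  obtain ⟨M, rfl⟩ := h
  refine ⟨Units.map (f.mapMatrix : Matrix ι ι R →+* Matrix ι ι S).toMonoidHom M, ?_⟩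
  ext i
  simp [RingHom.map_mulVec]

theorem isUnimodularVec {v w : ι → R} (h : VecEquiv v w) (hv : IsUnimodularVec v) :
    IsUnimodularVec w := by
  obtain ⟨M, rfl⟩ := h
  obtain ⟨c, hc⟩ := hv
  refine ⟨c ᵥ* ((M⁻¹ : (Matrix ι ι R)ˣ) : Matrix ι ι R), ?_⟩
  rw [dotProduct_mulVec, vecMul_vecMul, Units.inv_mul, vecMul_one, hc]

theorem add_smul (v a b : ι → R) (hab : b ⬝ᵥ a = 0) : VecEquiv v (v + (b ⬝ᵥ v) • a) := by
  have key : vecMulVec a b * vecMulVec a b = 0 := by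
    rw [vecMulVec_mul_vecMulVec, hab]; simp
  refine ⟨⟨1 + vecMulVec a b, 1 - vecMulVec a b, ?_, ?_⟩, ?_⟩
  · noncomm_ring; simp [key]
  · noncomm_ring; simp [key]
  · ext i
    simp [add_mulVec, vecMulVec_mulVec, mul_comm]

theorem unit_smul (u : Rˣ) (v : ι → R) : VecEquiv v ((u : R) • v) :=
  ⟨Units.map (algebraMap R (Matrix ι ι R) : R →* Matrix ι ι R) u, by
    ext i
    simp [Matrix.algebraMap_eq_diagonal, mulVec_diagonal]⟩

theorem single_of_isUnit {v : ι → R} (i k : ι) (h : IsUnit (v i)) :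
    VecEquiv v (Pi.single k 1) := by
  obtain ⟨u, hu⟩ := h
  have h1 : VecEquiv v (Pi.single i 1) := by
    refine (unit_smul u⁻¹ v).trans ?_
    have hi : (u⁻¹ : Rˣ).val * v i = 1 := by rw [← hu, Units.inv_mul]
    have := add_smul ((u⁻¹ : Rˣ).val • v) (Pi.single i 1 - (u⁻¹ : Rˣ).val • v) (Pi.single i 1)
      (by simp [hi])
    convert this using 1
    simp [hi]
  refine h1.trans ?_
  by_cases hik : i = k
  · subst hik; exact refl _
  have h2 := add_smul (Pi.single i (1 : R)) (Pi.single k 1) (Pi.single i 1) (by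
    simp [hik])
  have h3 := add_smul (Pi.single i (1 : R) + Pi.single k (1 : R)) (-Pi.single i (1 : R))
    (Pi.single k (1 : R)) (by
    simp [hik])
  refine (by simpa using h2 : VecEquiv _ _).trans ?_
  convert h3 using 1
  simp [hik]

end VecEquiv

theorem IsUnimodularVec.map {κ : Type*} [Fintype κ] {v : κ → R} (f : R →+* S)
    (h : IsUnimodularVec v) : IsUnimodularVec (f ∘ v) := by
  obtain ⟨c, hc⟩ := h
  exact ⟨f ∘ c, by rw [← RingHom.map_dotProduct, hc, map_one]⟩

theorem IsUnimodularVec.of_linearMap {v : ι → R} (ℓ : (ι → R) →ₗ[R] R) (h : ℓ v = 1) :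
    IsUnimodularVec v := by
  refine ⟨fun i => ℓ (Pi.single i 1), Eq.trans ?_ h⟩
  rw [LinearMap.pi_apply_eq_sum_univ ℓ v]
  simp only [dotProduct, smul_eq_mul]
  refine Finset.sum_congr rfl fun i _ => ?_
  have hs : (Pi.single i 1 : ι → R) = fun j => if i = j then 1 else 0 := by
    ext1 j
    simp [Pi.single_apply, eq_comm]
  rw [hs, mul_comm]

end VecEquiv

theorem vecEquiv_single_of_fin_two {R : Type*} [CommRing R] {v : Fin 2 → R}
    (hv : IsUnimodularVec v) (k : Fin 2) : VecEquiv v (Pi.single k 1) := by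
  obtain ⟨c, hc⟩ := hv
  simp only [dotProduct, Fin.sum_univ_two] at hc
  have hdet : IsUnit (!![c 0, c 1; -v 1, v 0] : Matrix (Fin 2) (Fin 2) R) := by
    rw [Matrix.isUnit_iff_isUnit_det, Matrix.det_fin_two_of]
    convert isUnit_one using 1
    linear_combination hc
  refine VecEquiv.trans (v := Pi.single 0 1) ⟨hdet.unit, ?_⟩
    (VecEquiv.single_of_isUnit 0 k (by simp))
  ext i
  fin_cases i
  · simpa [mulVec, dotProduct, Fin.sum_univ_two] using hc
  · simp [mulVec, dotProduct, Fin.sum_univ_two]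
    ring

section LocalHorrocks

variable {A : Type*} [CommRing A]

/-- If `f` is monic of degree `e + 1` and `g` has smaller degree and a unit coefficient, then some
combination of `f` and `g` is monic of degree `e`. -/
theorem exists_monic_combination {f g : Polynomial A} {e m : ℕ} (hf : f.Monic)
    (hfe : f.natDegree = e + 1) (hg : g.degree < (e + 1 : ℕ)) (hm : IsUnit (g.coeff m)) :
    ∃ a b : Polynomial A, (a * f + b * g).degree < (e + 1 : ℕ) ∧ (a * f + b * g).coeff e = 1 := by
  let L : Ideal A := Submodule.map (Polynomial.lcoeff A e)
    ((Ideal.span {f, g}).restrictScalars A ⊓ Polynomial.degreeLT A (e + 1))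
  have key : ∀ k ≤ e, ∀ h ∈ Ideal.span {f, g}, h.degree < (e + 1 : ℕ) → h.coeff (e - k) ∈ L := by
    intro k
    induction k with
    | zero =>
      intro _ h hh hd
      exact ⟨h, ⟨hh, Polynomial.mem_degreeLT.2 hd⟩, by simp⟩
    | succ k ih =>
      intro hk h hh hd
      have hc : h.coeff e ∈ L := ⟨h, ⟨hh, Polynomial.mem_degreeLT.2 hd⟩, by simp⟩
      have h1 := ih (by omega) (Polynomial.X * h - Polynomial.C (h.coeff e) * f)
        (sub_mem (Ideal.mul_mem_left _ _ hh)
          (Ideal.mul_mem_left _ _ (Ideal.subset_span (by simp)))) (by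
          rw [Polynomial.degree_lt_iff_coeff_zero] at hd ⊢
          intro j hj
          obtain ⟨j, rfl⟩ : ∃ i, j = i + 1 := ⟨j - 1, by omega⟩
          rw [Polynomial.coeff_sub, Polynomial.coeff_X_mul, Polynomial.coeff_C_mul]
          rcases (show e ≤ j by omega).eq_or_lt with rfl | hlt
          · have : f.coeff (e + 1) = 1 := by rw [← hfe]; exact hf
            rw [this]; ring
          · rw [hd j (by omega), Polynomial.coeff_eq_zero_of_natDegree_lt (p := f) (by omega)]
            ring)
      have e1 : e - k = (e - (k + 1)) + 1 := by omega
      rw [e1, Polynomial.coeff_sub, Polynomial.coeff_X_mul, Polynomial.coeff_C_mul] at h1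
      have := add_mem h1 (L.mul_mem_right (f.coeff (e - (k + 1) + 1)) hc)
      simpa using this
  have hme : m ≤ e := by
    by_contra hlt
    rw [Polynomial.degree_lt_iff_coeff_zero] at hg
    rw [hg m (by omega)] at hm
    have : Subsingleton A := isUnit_zero_iff.1 hm |> subsingleton_of_zero_eq_one
    have := congrArg Polynomial.natDegree (Subsingleton.elim f 0)
    simp at this
    omega
  have hmL := key (e - m) (by omega) g (Ideal.subset_span (by simp)) hg
  rw [show e - (e - m) = m by omega] at hmL
  have h1 : (1 : A) ∈ L := (Ideal.eq_top_iff_one L).1 (Ideal.eq_top_of_isUnit_mem L hmL hm)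
  obtain ⟨h, ⟨hh, hd⟩, h1⟩ := h1
  obtain ⟨a, b, rfl⟩ := Ideal.mem_span_pair.1 hh
  exact ⟨a, b, Polynomial.mem_degreeLT.1 hd, h1⟩

/-- Over a local ring, some entry other than the monic one has a unit coefficient. -/
theorem exists_isUnit_coeff_of_isUnimodularVec [IsLocalRing A] {ι : Type*} [Fintype ι]
    {v : ι → Polynomial A} (hv : IsUnimodularVec v) {i : ι} (hi : (v i).Monic)
    (hd : 0 < (v i).natDegree) : ∃ j ≠ i, ∃ m, IsUnit ((v j).coeff m) := by
  by_contra! hcon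
  have hz : ∀ j ≠ i, (v j).map (IsLocalRing.residue A) = 0 := by
    intro j hj
    ext m
    rw [Polynomial.coeff_map, Polynomial.coeff_zero, IsLocalRing.residue_eq_zero_iff]
    exact hcon j hj m
  obtain ⟨c, hc⟩ := hv.map (Polynomial.mapRingHom (IsLocalRing.residue A))
  rw [dotProduct, Finset.sum_eq_single i (fun j _ hj => by simp [hz j hj]) (by simp)] at hc
  have hu : IsUnit ((v i).map (IsLocalRing.residue A)) := IsUnit.of_mul_eq_one_right _ hc
  have := Polynomial.natDegree_eq_zero_of_isUnit hu
  rw [hi.natDegree_map] at this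
  omega

/-- Horrocks' theorem for unimodular vectors over a local ring. -/
theorem vecEquiv_single_of_monic [IsLocalRing A] {n : ℕ} {v : Fin n → Polynomial A}
    (hv : IsUnimodularVec v) {i : Fin n} (hi : (v i).Monic) (k : Fin n) :
    VecEquiv v (Pi.single k 1) := by
  obtain ⟨d, hd⟩ : ∃ d, (v i).natDegree = d := ⟨_, rfl⟩
  induction d generalizing v i with
  | zero =>
    apply VecEquiv.single_of_isUnit i k
    rw [hi.natDegree_eq_zero.1 hd]
    exact isUnit_one
  | succ e ih =>
    let a : Fin n → Polynomial A := fun j => if j = i then 0 else -(v j /ₘ v i)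
    have ha : Pi.single i (1 : Polynomial A) ⬝ᵥ a = 0 := by simp [a]
    have hvw := VecEquiv.add_smul v a (Pi.single i 1) ha
    set w := v + (Pi.single i (1 : Polynomial A) ⬝ᵥ v) • a with hw
    have hwi : w i = v i := by simp [hw, a]
    have hwj : ∀ j ≠ i, (w j).degree < (e + 1 : ℕ) := by
      intro j hj
      have : w j = v j %ₘ v i := by
        rw [Polynomial.modByMonic_eq_sub_mul_div (v j) (v i)]
        simp [hw, a, hj, sub_eq_add_neg]
      rw [this, ← hd, ← Polynomial.degree_eq_natDegree hi.ne_zero]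
      exact Polynomial.degree_modByMonic_lt _ hi
    have hwu := hvw.isUnimodularVec hv
    refine hvw.trans ?_
    rw [← hwi] at hi hd
    clear_value w
    obtain ⟨j, hji, m, hm⟩ := exists_isUnit_coeff_of_isUnimodularVec hwu hi (by omega)
    by_cases hl : ∃ l, l ≠ i ∧ l ≠ j
    · obtain ⟨l, hli, hlj⟩ := hl
      obtain ⟨α, β, hdeg, hcoe⟩ := exists_monic_combination hi hd (hwj j hji) hm
      let b : Fin n → Polynomial A :=
        Polynomial.C (1 - (w l).coeff e) • (Pi.single i α + Pi.single j β)
      have hb : b ⬝ᵥ Pi.single l 1 = 0 := by simp [b, hli, hlj]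
      have hwx := VecEquiv.add_smul w (Pi.single l 1) b hb
      set x : Fin n → Polynomial A := w + (b ⬝ᵥ w) • Pi.single l 1 with hx
      refine hwx.trans ?_
      have hbw : b ⬝ᵥ w = Polynomial.C (1 - (w l).coeff e) * (α * w i + β * w j) := by
        simp only [b, smul_dotProduct, add_dotProduct, single_dotProduct, smul_eq_mul]
      have hxl : x l =
          w l + Polynomial.C (1 - (w l).coeff e) * (α * w i + β * w j) := by
        rw [hx, hbw]
        simp only [Pi.add_apply, Pi.smul_apply, Pi.single_eq_same, smul_eq_mul, mul_one]
      have hxdeg : (x l).natDegree ≤ e := by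
        rw [hxl, Polynomial.natDegree_le_iff_coeff_eq_zero]
        intro N hN
        have h1 := (Polynomial.degree_lt_iff_coeff_zero _ _).1 (hwj l hli) N (by omega)
        have h2 := (Polynomial.degree_lt_iff_coeff_zero _ _).1 hdeg N (by omega)
        rw [Polynomial.coeff_add, Polynomial.coeff_C_mul, h1, h2]
        simp
      have hxcoeff : (x l).coeff e = 1 := by
        rw [hxl, Polynomial.coeff_add, Polynomial.coeff_C_mul, hcoe]
        ring
      refine ih (i := l) (hwx.isUnimodularVec hwu)
        (Polynomial.monic_of_natDegree_le_of_coeff_eq_one e hxdeg hxcoeff) ?_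
      exact le_antisymm hxdeg (Polynomial.le_natDegree_of_ne_zero (by rw [hxcoeff]; simp))
    · push Not at hl
      have hn : ({i, j} : Finset (Fin n)) = Finset.univ := by
        ext l
        have := hl l
        simp only [Finset.mem_insert, Finset.mem_singleton, Finset.mem_univ, iff_true]
        tauto
      obtain rfl : n = 2 := by
        have := congrArg Finset.card hn
        rwa [Finset.card_pair hji.symm, Finset.card_univ, Fintype.card_fin, eq_comm] at this
      exact vecEquiv_single_of_fin_two hwu k

end LocalHorrocks

namespace Polynomial

section Patching

/-- Clearing denominators in a finite family of bivariate polynomials by rescaling the outer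
variable, provided that the constant coefficients have no denominators. -/
theorem exists_lift_rescale {A Am : Type*} [CommRing A] [CommRing Am] [Algebra A Am]
    (M : Submonoid A) [IsLocalization M Am] {κ : Type*} [Finite κ] (q : κ → Am[X][X])
    (hq : ∀ k, (q k).coeff 0 ∈ (mapRingHom (algebraMap A Am)).range) :
    ∃ s ∈ M, ∃ g : κ → A[X][X], ∀ k, mapRingHom (mapRingHom (algebraMap A Am)) (g k) =
      eval₂RingHom C (C (C (algebraMap A Am s)) * X) (q k) := by
  let := Polynomial.algebra A Am
  let := Polynomial.algebra A[X] Am[X]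
  have := Polynomial.isLocalization M Am
  have := Polynomial.isLocalization (M.map C) Am[X]
  obtain ⟨⟨b, hb⟩, hbq⟩ := IsLocalization.exist_integer_multiples_of_finite
    ((M.map C).map (C : A[X] →+* A[X][X])) (fun k => (q k).divX)
  obtain ⟨_, ⟨s, hs, rfl⟩, rfl⟩ := hb
  choose g hg using hbq
  choose r hr using hq
  refine ⟨s, hs, fun k => X * eval₂RingHom C (C (C s) * X) (g k) + C (r k), fun k => ?_⟩
  have hg' : mapRingHom (mapRingHom (algebraMap A Am)) (g k) =
      C (C (algebraMap A Am s)) * (q k).divX := by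
    have := hg k
    rw [Algebra.smul_def] at this
    simpa [Polynomial.algebraMap_def] using this
  have hcomm : (mapRingHom (mapRingHom (algebraMap A Am))).comp
      (eval₂RingHom C (C (C s) * X)) = (eval₂RingHom C (C (C (algebraMap A Am s)) * X)).comp
      (mapRingHom (mapRingHom (algebraMap A Am))) := by
    refine Polynomial.ringHom_ext (fun a => ?_) ?_ <;> simp
  have hcomm' := RingHom.congr_fun hcomm (g k)
  simp only [RingHom.comp_apply] at hcomm'
  rw [map_add, map_mul, hcomm', hg']
  conv_rhs => rw [← divX_mul_X_add (q k)]
  rw [← hr k]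
  simp
  ring

variable {A : Type*} [CommRing A] {ι : Type*} [Fintype ι] [DecidableEq ι]

/-- If a vector of polynomials is equivalent to a constant vector after localization, then its
translates by a suitable multiple of a new variable are equivalent to it. -/
theorem exists_vecEquiv_translate [IsDomain A] {Am : Type*} [CommRing Am] [Algebra A Am]
    (M : Submonoid A) (hM : M ≤ nonZeroDivisors A) [IsLocalization M Am] (v : ι → A[X])
    (h : ∃ v₀ : ι → Am, VecEquiv (mapRingHom (algebraMap A Am) ∘ v) (C ∘ v₀)) :
    ∃ s ∈ M, VecEquiv (fun i => (v i).eval₂ (C.comp C) (C X + C (C s) * X : A[X][X]))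
      (fun i => (v i).eval₂ (C.comp C) (C X : A[X][X])) := by
  obtain ⟨v₀, α, hα⟩ := h
  have hinj : Function.Injective (algebraMap A Am) := IsLocalization.injective Am hM
  let φ := mapRingHom (mapRingHom (algebraMap A Am))
  have hφ : Function.Injective φ := map_injective _ (map_injective _ hinj)
  let σ₁ : Am[X] →+* Am[X][X] := C
  let σ₂ : Am[X] →+* Am[X][X] := eval₂RingHom (C.comp C) (C X + X)
  let ε : Am[X][X] →+* Am[X] := evalRingHom 0
  let gm : ∀ {R S : Type _} [CommRing R] [CommRing S], (R →+* S) →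
      (Matrix ι ι R)ˣ →* (Matrix ι ι S)ˣ := fun f => Units.map f.mapMatrix.toMonoidHom
  let β : (Matrix ι ι Am[X][X])ˣ := (gm σ₂ α)⁻¹ * gm σ₁ α
  have hσ₁ : ε.comp σ₁ = RingHom.id _ := by
    refine Polynomial.ringHom_ext (fun a => ?_) ?_ <;> simp [ε, σ₁]
  have hσ₂ : ε.comp σ₂ = RingHom.id _ := by
    refine Polynomial.ringHom_ext (fun a => ?_) ?_ <;> simp [ε, σ₂]
  have hgm : ∀ {σ : Am[X] →+* Am[X][X]}, ε.comp σ = RingHom.id _ → gm ε (gm σ α) = α := by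
    intro σ hσ
    ext i j : 2
    exact RingHom.congr_fun hσ (α.val i j)
  have hεβ : gm ε β = 1 := by
    simp only [β, map_mul, map_inv, hgm hσ₁, hgm hσ₂, inv_mul_cancel]
  have hβv : (β : Matrix ι ι Am[X][X]) *ᵥ (σ₁ ∘ mapRingHom (algebraMap A Am) ∘ v) =
      σ₂ ∘ mapRingHom (algebraMap A Am) ∘ v := by
    have h1 : ((gm σ₁ α : (Matrix ι ι Am[X][X])ˣ) : Matrix ι ι Am[X][X]) *ᵥ
        (σ₁ ∘ mapRingHom (algebraMap A Am) ∘ v) = σ₁ ∘ C ∘ v₀ := by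
      rw [← hα]; ext1 i; exact (RingHom.map_mulVec σ₁ _ _ i).symm
    have h2 : ((gm σ₂ α : (Matrix ι ι Am[X][X])ˣ) : Matrix ι ι Am[X][X]) *ᵥ
        (σ₂ ∘ mapRingHom (algebraMap A Am) ∘ v) = σ₂ ∘ C ∘ v₀ := by
      rw [← hα]; ext1 i; exact (RingHom.map_mulVec σ₂ _ _ i).symm
    have h3 : σ₁ ∘ C ∘ v₀ = σ₂ ∘ C ∘ v₀ := by
      ext1 i; simp [σ₁, σ₂]
    rw [Units.val_mul, ← mulVec_mulVec, h1, h3, ← h2, mulVec_mulVec, Units.inv_mul, one_mulVec]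
  have hcoeff : ∀ B : (Matrix ι ι Am[X][X])ˣ, gm ε B = 1 → ∀ i j,
      (B.val i j).coeff 0 ∈ (mapRingHom (algebraMap A Am)).range := by
    intro B hB i j
    have : ε (B.val i j) = (1 : Matrix ι ι Am[X]) i j := by
      have := congrArg (fun B : (Matrix ι ι Am[X])ˣ => B.val i j) hB
      exact this
    rw [coeff_zero_eq_eval_zero, show eval 0 (B.val i j) = ε (B.val i j) from rfl, this,
      Matrix.one_apply]
    split_ifs
    exacts [one_mem _, zero_mem _]
  obtain ⟨s, hs, g, hg⟩ := exists_lift_rescale M (κ := (ι × ι) ⊕ (ι × ι))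
    (Sum.elim (fun p => β.val p.1 p.2) (fun p => β⁻¹.val p.1 p.2)) (by
      rintro (p | p)
      · exact hcoeff β hεβ p.1 p.2
      · exact hcoeff β⁻¹ (by rw [map_inv, hεβ, inv_one]) p.1 p.2)
  let θ : Am[X][X] →+* Am[X][X] := eval₂RingHom C (C (C (algebraMap A Am s)) * X)
  let P : Matrix ι ι A[X][X] := of fun i j => g (Sum.inl (i, j))
  let Q : Matrix ι ι A[X][X] := of fun i j => g (Sum.inr (i, j))
  have hP : φ.mapMatrix P = θ.mapMatrix β.val := by
    ext1 i j; exact hg (Sum.inl (i, j))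
  have hQ : φ.mapMatrix Q = θ.mapMatrix β⁻¹.val := by
    ext1 i j; exact hg (Sum.inr (i, j))
  have hφM : Function.Injective (φ.mapMatrix : Matrix ι ι A[X][X] →+* _) :=
    Matrix.map_injective hφ
  have hPQ : P * Q = 1 := hφM (by
    rw [map_mul, hP, hQ, ← map_mul, Units.mul_inv, map_one, map_one])
  have hQP : Q * P = 1 := hφM (by
    rw [map_mul, hP, hQ, ← map_mul, Units.inv_mul, map_one, map_one])
  refine ⟨s, hs, VecEquiv.symm ⟨⟨P, Q, hPQ, hQP⟩, ?_⟩⟩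
  ext1 i
  apply hφ
  have e1 : φ.comp (eval₂RingHom (C.comp C) (C X)) =
      (θ.comp σ₁).comp (mapRingHom (algebraMap A Am)) := by
    refine Polynomial.ringHom_ext (fun a => ?_) ?_ <;> simp [φ, θ, σ₁]
  have e2 : φ.comp (eval₂RingHom (C.comp C) (C X + C (C s) * X)) =
      (θ.comp σ₂).comp (mapRingHom (algebraMap A Am)) := by
    refine Polynomial.ringHom_ext (fun a => ?_) ?_ <;> simp [φ, θ, σ₂]
  have h1 := RingHom.map_mulVec φ P (fun i => (v i).eval₂ (C.comp C) (C X : A[X][X])) i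
  refine h1.trans ?_
  have e3 : φ ∘ (fun i => (v i).eval₂ (C.comp C) (C X : A[X][X])) =
      θ ∘ σ₁ ∘ mapRingHom (algebraMap A Am) ∘ v := by
    ext1 i; exact RingHom.congr_fun e1 (v i)
  rw [e3, show P.map φ = φ.mapMatrix P from rfl, hP]
  refine (RingHom.map_mulVec θ β.val _ i).symm.trans ?_
  rw [hβv]
  exact (RingHom.congr_fun e2 (v i)).symm

end Patching

/-- A unimodular vector over `A[X]` with a monic entry is equivalent to its value at `0`. -/
theorem vecEquiv_eval_zero_of_monic {A : Type*} [CommRing A] [IsDomain A] {n : ℕ}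
    {v : Fin n → A[X]} (hv : IsUnimodularVec v) {i : Fin n} (hi : (v i).Monic) :
    VecEquiv v (fun j => C ((v j).eval 0)) := by
  let J : Ideal A :=
    { carrier := {c | ∀ (f : A →+* A[X]) (x y : A[X]),
        VecEquiv (fun j => (v j).eval₂ f (x + f c * y)) (fun j => (v j).eval₂ f x)}
      add_mem' := by
        intro a b ha hb f x y
        have := (hb f (x + f a * y) y).trans (ha f x y)
        rwa [add_assoc, ← add_mul, ← map_add] at this
      zero_mem' := by
        intro f x y
        simpa using VecEquiv.refl _
      smul_mem' := by
        intro a b hb f x y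
        have := hb f x (f a * y)
        rwa [← mul_assoc, ← map_mul, mul_comm b a] at this }
  have hJ : J = ⊤ := by
    by_contra hne
    obtain ⟨m, hm, hJm⟩ := Ideal.exists_le_maximal J hne
    have hloc : VecEquiv (mapRingHom (algebraMap A (Localization.AtPrime m)) ∘ v)
        (C ∘ Pi.single i 1) := by
      have := vecEquiv_single_of_monic
        (hv.map (mapRingHom (algebraMap A (Localization.AtPrime m)))) (i := i)
        (hi.map _) i
      convert this using 1
      ext1 j
      simp only [Function.comp_apply, Pi.single_apply]
      split_ifs <;> simp
    obtain ⟨s, hs, h⟩ := exists_vecEquiv_translate m.primeCompl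
      m.primeCompl_le_nonZeroDivisors v ⟨_, hloc⟩
    refine hs (hJm fun f x y => ?_)
    have := h.map (eval₂RingHom (eval₂RingHom f x) y)
    have e (q : A[X][X]) (j : Fin n) : eval₂RingHom (eval₂RingHom f x) y
        ((v j).eval₂ (C.comp C) q) = (v j).eval₂ f (eval₂RingHom (eval₂RingHom f x) y q) := by
      rw [Polynomial.hom_eval₂]
      congr 1
      ext a
      simp
    simp only [Function.comp_def, e] at this
    simpa using this
  have h1 : (1 : A) ∈ J := by rw [hJ]; trivial
  have := h1 C 0 X
  simpa [coeff_zero_eq_eval_zero] using this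

end Polynomial

namespace NoetherNormalization

variable {k : Type*} [Field k] {n : ℕ} (f : MvPolynomial (Fin (n + 1)) k)

theorem t1_comp_t1_neg' (c : k) : (T1 f c).comp (T1 f (-c)) = AlgHom.id _ _ := by
  rw [comp_aeval, ← MvPolynomial.aeval_X_left]
  ext i v
  cases i using Fin.cases <;> simp

/-- The automorphism `X i ↦ X i + X 0 ^ (2 + totalDegree f) ^ i` for `i ≠ 0`. -/
noncomputable abbrev twist :
    MvPolynomial (Fin (n + 1)) k ≃ₐ[k] MvPolynomial (Fin (n + 1)) k :=
  AlgEquiv.ofAlgHom (T1 f 1) (T1 f (-1)) (t1_comp_t1_neg' f 1)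
    (by simpa using t1_comp_t1_neg' f (-1))

variable {v w : Fin (n + 1) →₀ ℕ}

theorem sum_pow_mul_ne (vlt : ∀ i, v i < 2 + f.totalDegree) (wlt : ∀ i, w i < 2 + f.totalDegree)
    (ne : v ≠ w) :
    ∑ i : Fin (n + 1), (2 + f.totalDegree) ^ i.1 * v i ≠
      ∑ i : Fin (n + 1), (2 + f.totalDegree) ^ i.1 * w i := by
  have lt_up : ∀ {v : Fin (n + 1) →₀ ℕ}, (∀ i, v i < 2 + f.totalDegree) →
      ∀ l ∈ List.ofFn v, l < 2 + f.totalDegree := by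
    intro v hv
    grind
  intro h
  refine ne <| Finsupp.ext <| congrFun <| List.ofFn_inj.mp ?_
  apply Nat.ofDigits_inj_of_len_eq (Nat.lt_add_right f.totalDegree one_lt_two)
    (by simp) (lt_up vlt) (lt_up wlt)
  simpa only [Nat.ofDigits_eq_sum_mapIdx, List.mapIdx_eq_ofFn, List.get_ofFn, List.length_ofFn,
    Fin.val_cast, mul_comm, List.sum_ofFn] using! h

theorem degreeOf_zero_twist {a : k} (ha : a ≠ 0) :
    ((twist f) (monomial v a)).degreeOf 0 =
      ∑ i : Fin (n + 1), (2 + f.totalDegree) ^ i.1 * v i := by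
  rw [← natDegree_finSuccEquiv, monomial_eq, Finsupp.prod_pow v fun a ↦ X a]
  simp only [Fin.prod_univ_succ, Fin.sum_univ_succ, map_mul, map_prod, map_pow,
    AlgEquiv.ofAlgHom_apply, MvPolynomial.aeval_C, MvPolynomial.aeval_X, if_pos, Fin.succ_ne_zero,
    ite_false, one_smul, map_add, finSuccEquiv_X_zero, finSuccEquiv_X_succ, algebraMap_eq]
  have h (i : Fin n) :
      (Polynomial.C (X (R := k) i) +
        Polynomial.X ^ (2 + f.totalDegree) ^ (i.succ : Fin (n + 1)).1) ^ v i.succ ≠ 0 :=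
    pow_ne_zero (v i.succ) (Polynomial.leadingCoeff_ne_zero.mp <| by
      simp [add_comm, Polynomial.leadingCoeff_X_pow_add_C])
  rw [Polynomial.natDegree_mul (by simp [ha])
    (mul_ne_zero (by simp) (Finset.prod_ne_zero_iff.mpr (fun i _ ↦ h i))),
    Polynomial.natDegree_mul (by simp) (Finset.prod_ne_zero_iff.mpr (fun i _ ↦ h i)),
    Polynomial.natDegree_prod _ _ (fun i _ ↦ h i), natDegree_finSuccEquiv, degreeOf_C]
  simpa only [Polynomial.natDegree_pow, zero_add, Polynomial.natDegree_X, mul_one, Fin.val_zero,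
    pow_zero, one_mul, add_right_inj] using Finset.sum_congr rfl (fun i _ ↦ by
    rw [add_comm (Polynomial.C _), Polynomial.natDegree_X_pow_add_C, mul_comm])

theorem degreeOf_twist_ne_of_ne (hv : v ∈ f.support) (hw : w ∈ f.support) (ne : v ≠ w) :
    (twist f <| monomial v <| coeff v f).degreeOf 0 ≠
    (twist f <| monomial w <| coeff w f).degreeOf 0 := by
  rw [degreeOf_zero_twist _ <| mem_support_iff.mp hv,
    degreeOf_zero_twist _ <| mem_support_iff.mp hw]
  refine sum_pow_mul_ne f (fun i ↦ ?_) (fun i ↦ ?_) ne <;>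
  exact lt_of_le_of_lt ((monomial_le_degreeOf i ‹_›).trans (degreeOf_le_totalDegree f i))
    (by lia)

theorem leadingCoeff_finSuccEquiv_twist :
    (finSuccEquiv k n ((twist f) ((monomial v) (coeff v f)))).leadingCoeff =
    algebraMap k _ (coeff v f) := by
  rw [monomial_eq, Finsupp.prod_fintype]
  · simp only [map_mul, map_prod, Polynomial.leadingCoeff_mul, Polynomial.leadingCoeff_prod]
    rw [AlgEquiv.ofAlgHom_apply, algHom_C, algebraMap_eq, finSuccEquiv_apply,
      eval₂Hom_C, RingHom.coe_comp]
    simp only [AlgEquiv.ofAlgHom_apply, Function.comp_apply, Polynomial.leadingCoeff_C, map_pow,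
      Polynomial.leadingCoeff_pow, algebraMap_eq]
    have : ∀ j, ((finSuccEquiv k n) ((T1 f) 1 (X j))).leadingCoeff = 1 := fun j ↦ by
      by_cases h : j = 0
      · simp [h, finSuccEquiv_apply]
      · simp only [aeval_eq_bind₁, bind₁_X_right, if_neg h, one_smul, map_add, map_pow]
        obtain ⟨i, rfl⟩ := Fin.exists_succ_eq.mpr h
        simp [finSuccEquiv_X_succ, finSuccEquiv_X_zero, add_comm]
    simp only [this, one_pow, Finset.prod_const_one, mul_one]
  exact fun i ↦ pow_zero _

variable {f} in
/-- After a change of variables, a nonzero polynomial becomes monic up to a unit. -/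
theorem isUnit_leadingCoeff_finSuccEquiv_twist (fne : f ≠ 0) :
    IsUnit (finSuccEquiv k n (twist f f)).leadingCoeff := by
  obtain ⟨v, vin, vs⟩ := Finset.exists_max_image f.support
    (fun v ↦ (twist f ((monomial v) (coeff v f))).degreeOf 0) (support_nonempty.mpr fne)
  set h := fun w ↦ (MvPolynomial.monomial w) (coeff w f)
  simp only [← natDegree_finSuccEquiv] at vs
  replace vs : ∀ x ∈ f.support \ {v}, (finSuccEquiv k n ((twist f) (h x))).degree <
      (finSuccEquiv k n ((twist f) (h v))).degree := by
    intro x hx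
    obtain ⟨h1, h2⟩ := Finset.mem_sdiff.mp hx
    apply Polynomial.degree_lt_degree <| lt_of_le_of_ne (vs x h1) ?_
    simpa only [natDegree_finSuccEquiv]
      using degreeOf_twist_ne_of_ne f h1 vin <| by simpa using h2
  have coeff : (finSuccEquiv k n ((twist f) (h v + ∑ x ∈ f.support \ {v}, h x))).leadingCoeff =
      (finSuccEquiv k n ((twist f) (h v))).leadingCoeff := by
    simp only [map_add, map_sum]
    rw [add_comm]
    apply Polynomial.leadingCoeff_add_of_degree_lt <|
      (lt_of_le_of_lt <| Polynomial.degree_sum_le _ _) ?_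
    have h2 : h v ≠ 0 := by simpa [h] using mem_support_iff.mp vin
    replace h2 : (finSuccEquiv k n ((twist f) (h v))) ≠ 0 := fun eq ↦ h2 <|
      by simpa only [map_eq_zero_iff _ (AlgEquiv.injective _)] using eq
    exact (Finset.sup_lt_iff <| Ne.bot_lt (fun x ↦ h2 <| Polynomial.degree_eq_bot.mp x)).mpr vs
  nth_rw 2 [← f.support_sum_monomial_coeff]
  rw [Finset.sum_eq_add_sum_sdiff_singleton_of_mem vin h]
  rw [leadingCoeff_finSuccEquiv_twist] at coeff
  simpa only [coeff, algebraMap_eq] using (mem_support_iff.mp vin).isUnit.map MvPolynomial.C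

end NoetherNormalization

/-- A nonzero polynomial in `n + 1` variables is, up to a unit, monic in one variable in suitable
coordinates. -/
theorem MvPolynomial.exists_ringEquiv_monic {K : Type*} [Field K] {n : ℕ}
    {f : MvPolynomial (Fin (n + 1)) K} (hf : f ≠ 0) :
    ∃ (e : MvPolynomial (Fin (n + 1)) K ≃+* Polynomial (MvPolynomial (Fin n) K))
      (u : (MvPolynomial (Fin (n + 1)) K)ˣ), (e (u * f)).Monic := by
  let e := ((NoetherNormalization.twist f).trans (finSuccEquiv K n)).toRingEquiv
  obtain ⟨u, hu⟩ := NoetherNormalization.isUnit_leadingCoeff_finSuccEquiv_twist hf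
  refine ⟨e, Units.map (e.symm.toRingHom.comp Polynomial.C).toMonoidHom u⁻¹, ?_⟩
  have h : e (Units.map (e.symm.toRingHom.comp Polynomial.C).toMonoidHom u⁻¹ * f) =
      Polynomial.C u⁻¹.val * finSuccEquiv K n (NoetherNormalization.twist f f) := by
    rw [map_mul]
    congr 1
    exact e.apply_symm_apply _
  rw [h, Polynomial.Monic.def, Polynomial.leadingCoeff_mul, ← hu]
  simp

/-- A commutative ring is Hermite in the strong sense if the general linear group acts transitively
on unimodular vectors. -/
def UnimodularVecsTransitive (R : Type*) [CommRing R] : Prop :=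
  ∀ (n : ℕ) (v : Fin n → R), IsUnimodularVec v → ∀ k, VecEquiv v (Pi.single k 1)

theorem UnimodularVecsTransitive.of_ringEquiv {R S : Type*} [CommRing R] [CommRing S] (e : R ≃+* S)
    (h : UnimodularVecsTransitive R) : UnimodularVecsTransitive S := by
  intro n v hv k
  have := (h n _ (hv.map e.symm.toRingHom) k).map e.toRingHom
  convert this using 1
  · ext1 i; simp
  · ext1 i; simp only [Function.comp_apply, Pi.single_apply]; split_ifs <;> simp

/-- The Quillen–Suslin theorem for unimodular vectors. -/
theorem MvPolynomial.unimodularVecsTransitive (K : Type*) [Field K] (n : ℕ) :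
    UnimodularVecsTransitive (MvPolynomial (Fin n) K) := by
  have hex : ∀ {R : Type _} [CommRing R] [Nontrivial R] {m : ℕ} {v : Fin m → R},
      IsUnimodularVec v → ∃ i, v i ≠ 0 := by
    intro R _ _ m v ⟨c, hc⟩
    by_contra! h
    rw [_root_.funext h] at hc
    simp [dotProduct] at hc
  induction n with
  | zero =>
    refine .of_ringEquiv (isEmptyAlgEquiv K (Fin 0)).symm.toRingEquiv fun m v hv k => ?_
    obtain ⟨i, hi⟩ := hex hv
    exact .single_of_isUnit i k hi.isUnit
  | succ n ih =>
    intro m v hv k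
    obtain ⟨i, hi⟩ := hex hv
    obtain ⟨e, u, hu⟩ := exists_ringEquiv_monic hi
    have h1 := VecEquiv.unit_smul u v
    have h2 := (h1.isUnimodularVec hv).map e.toRingHom
    have h3 := Polynomial.vecEquiv_eval_zero_of_monic (i := i) h2 hu
    have h4 := (ih m _ (h2.map (Polynomial.evalRingHom 0)) k).map Polynomial.C
    have h5 := (h3.trans h4).map e.symm.toRingHom
    refine h1.trans ?_
    convert h5 using 1
    · ext1 i; simp
    · ext1 i; simp only [Function.comp_apply, Pi.single_apply]; split_ifs <;> simp

section Schanuel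

variable {R P P' Q : Type*} [CommRing R] [AddCommGroup P] [AddCommGroup P'] [AddCommGroup Q]
  [Module R P] [Module R P'] [Module R Q]

/-- Schanuel's lemma. -/
theorem LinearMap.nonempty_ker_prod_equiv [Module.Projective R P] [Module.Projective R P']
    (g : P →ₗ[R] Q) (g' : P' →ₗ[R] Q) (hg : Function.Surjective g)
    (hg' : Function.Surjective g') :
    Nonempty ((LinearMap.ker g × P') ≃ₗ[R] (LinearMap.ker g' × P)) := by
  obtain ⟨h, hh⟩ := Module.projective_lifting_property g g' hg
  obtain ⟨k, hk⟩ := Module.projective_lifting_property g' g hg'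
  replace hh : ∀ x, g (h x) = g' x := fun x => LinearMap.congr_fun hh x
  replace hk : ∀ x, g' (k x) = g x := fun x => LinearMap.congr_fun hk x
  have h1 : ∀ x : LinearMap.ker g, g x = 0 := fun x => x.2
  have h2 : ∀ x : LinearMap.ker g', g' x = 0 := fun x => x.2
  let a : (LinearMap.ker g × P') →ₗ[R] P :=
    (LinearMap.ker g).subtype.coprod h
  let b : (LinearMap.ker g' × P) →ₗ[R] P' :=
    (LinearMap.ker g').subtype.coprod k
  have ha : ∀ c, (LinearMap.snd R (LinearMap.ker g) P' - k ∘ₗ a) c ∈ LinearMap.ker g' := by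
    rintro ⟨x, y⟩
    simp [a, hh, hk, h1]
  have hb : ∀ c, (LinearMap.snd R (LinearMap.ker g') P - h ∘ₗ b) c ∈ LinearMap.ker g := by
    rintro ⟨x, y⟩
    simp [b, hh, hk, h2]
  exact ⟨LinearEquiv.ofLinearMap
    (((LinearMap.snd R _ _ - k ∘ₗ a).codRestrict (LinearMap.ker g') ha).prod a)
    (((LinearMap.snd R _ _ - h ∘ₗ b).codRestrict (LinearMap.ker g) hb).prod b)
    (LinearMap.ext fun x => Prod.ext (Subtype.ext (by simp [a, b])) (by simp [a, b]))
    (LinearMap.ext fun x => Prod.ext (Subtype.ext (by simp [a, b])) (by simp [a, b]))⟩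

end Schanuel

namespace Polynomial

variable {A : Type*} [CommRing A]

/-- The characteristic sequence of a module over `A[X]` that is free over `A`. -/
theorem exists_exact_of_basis {Q : Type*} [AddCommGroup Q] [Module A Q]
    [Module (Polynomial A) Q] [IsScalarTower A (Polynomial A) Q] {q : ℕ}
    (b : Module.Basis (Fin q) A Q) :
    ∃ (χ : (Fin q → Polynomial A) →ₗ[Polynomial A] (Fin q → Polynomial A))
      (π : (Fin q → Polynomial A) →ₗ[Polynomial A] Q),
      Function.Injective χ ∧ Function.Surjective π ∧ LinearMap.range χ = LinearMap.ker π := by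
  let T : Matrix (Fin q) (Fin q) A := Matrix.of fun i j => b.repr ((X : Polynomial A) • b j) i
  have hC : ∀ (a : A) (x : Q), (C a : Polynomial A) • x = a • x := fun a x => by
    rw [← algebraMap_eq, algebraMap_smul]
  have hT : ∀ j, (X : Polynomial A) • b j = ∑ i, T i j • b i := fun j => (b.sum_repr _).symm
  let χ := (charmatrix T).mulVecLin
  let π := Fintype.linearCombination (Polynomial A) b
  have hπ : ∀ v, π v = ∑ i, v i • b i := fun v => Fintype.linearCombination_apply _ _ _
  have hπC : ∀ c : Fin q → A, π (fun i => C (c i)) = ∑ i, c i • b i := fun c => by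
    simp [hπ, hC]
  have hχ : ∀ v, χ v = (X : Polynomial A) • v - (T.map C) *ᵥ v := fun v => by
    simp [χ, charmatrix]
  have hπχ : ∀ v, π (χ v) = 0 := fun v => by
    have : π ∘ₗ χ = 0 := by
      ext j
      simp only [LinearMap.comp_apply, LinearMap.single_apply, hχ, map_sub, LinearMap.zero_apply,
        map_smul]
      rw [sub_eq_zero]
      simp [hπ, hC, hT, Pi.single_apply]
    exact LinearMap.congr_fun this v
  have key : ∀ v, ∃ c : Fin q → A, v - (fun i => C (c i)) ∈ LinearMap.range χ := by
    let S : AddSubmonoid (Fin q → Polynomial A) :=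
      { carrier := {v | ∃ c : Fin q → A, v - (fun i => C (c i)) ∈ LinearMap.range χ}
        add_mem' := by
          rintro v w ⟨c, hc⟩ ⟨c', hc'⟩
          refine ⟨c + c', ?_⟩
          convert add_mem hc hc' using 1
          ext1 i
          simp
          ring
        zero_mem' := ⟨0, by convert zero_mem (LinearMap.range χ); simp; rfl⟩ }
    have hS : ∀ v, v ∈ S ↔ ∃ c : Fin q → A, v - (fun i => C (c i)) ∈ LinearMap.range χ :=
      fun _ => Iff.rfl
    have hX : ∀ v ∈ S, (X : Polynomial A) • v ∈ S := by
      rintro v ⟨c, hc⟩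
      refine ⟨T *ᵥ c, ?_⟩
      have e : (fun i => C ((T *ᵥ c) i)) = T.map C *ᵥ (fun i => C (c i)) := by
        ext1 i; exact (RingHom.map_mulVec C T c i)
      have := add_mem ((LinearMap.range χ).smul_mem X hc) (LinearMap.mem_range_self χ
        (fun i => C (c i)))
      rw [hχ] at this
      rw [e]
      convert this using 1
      rw [smul_sub]; abel
    have hmon : ∀ (n : ℕ) (a : A) (j : Fin q),
        (Pi.single j (monomial n a) : Fin q → Polynomial A) ∈ S := by
      intro n a j
      induction n with
      | zero =>
        refine ⟨Pi.single j a, ?_⟩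
        convert zero_mem (LinearMap.range χ)
        rw [sub_eq_zero]
        ext1 i
        by_cases h : i = j
        · subst h; simp
        · simp [h]
      | succ n ih =>
        have := hX _ ih
        rwa [← Pi.single_smul, smul_eq_mul, X_mul_monomial] at this
    have hsing : ∀ (p : Polynomial A) (j : Fin q),
        (Pi.single j p : Fin q → Polynomial A) ∈ S := by
      intro p j
      induction p using Polynomial.induction_on' with
      | add p r hp hr => rw [Pi.single_add]; exact add_mem hp hr
      | monomial n a => exact hmon n a j
    intro v
    rw [← hS, ← Finset.univ_sum_single v]
    exact sum_mem fun j _ => hsing _ j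
  refine ⟨χ, π, ?_, ?_, ?_⟩
  · rw [← LinearMap.ker_eq_bot, LinearMap.ker_eq_bot']
    intro v hv
    have h0 : T.charpoly • v = 0 := by
      have : (charmatrix T).adjugate *ᵥ (charmatrix T *ᵥ v) = 0 := by
        rw [show charmatrix T *ᵥ v = 0 from hv, mulVec_zero]
      rwa [mulVec_mulVec, adjugate_mul, smul_mulVec, one_mulVec] at this
    ext1 i
    have hm : IsRegular T.charpoly := ⟨(T.charpoly_monic).isRegular.left,
      (T.charpoly_monic).isRegular.right⟩
    exact hm.left (by simpa using congrFun h0 i)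
  · intro x
    exact ⟨fun i => C (b.repr x i), by rw [hπC]; exact b.sum_repr x⟩
  · apply le_antisymm
    · rintro _ ⟨v, rfl⟩
      exact hπχ v
    · intro v hv
      obtain ⟨c, w, hw⟩ := key v
      have h1 : π (fun i => C (c i)) = 0 := by
        have : (fun i => C (c i)) = v - χ w := by rw [hw]; abel
        rw [this, map_sub, hπχ, LinearMap.mem_ker.1 hv, sub_zero]
      rw [hπC] at h1
      have h2 : c = 0 := _root_.funext fun i => (Fintype.linearIndependent_iff.1 b.linearIndependent c h1 i)
      rw [h2] at hw
      refine ⟨w, hw.trans ?_⟩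
      ext1 i
      simp

end Polynomial

namespace Polynomial

universe u

variable {A : Type*} [CommRing A]

/-- The quotient on division by a monic polynomial, as a linear map. -/
noncomputable def divByMonicHom {f : Polynomial A} (hf : f.Monic) :
    Polynomial A →ₗ[A] Polynomial A where
  toFun p := p /ₘ f
  map_add' p q := hf.isRegular.left <| by
    have h := modByMonic_eq_sub_mul_div (p + q) f
    rw [add_modByMonic, modByMonic_eq_sub_mul_div p, modByMonic_eq_sub_mul_div q] at h
    change f * ((p + q) /ₘ f) = f * (p /ₘ f + q /ₘ f)
    linear_combination h
  map_smul' a p := hf.isRegular.left <| by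
    have h := modByMonic_eq_sub_mul_div (a • p) f
    rw [smul_modByMonic, modByMonic_eq_sub_mul_div p] at h
    change f * ((a • p) /ₘ f) = f * (a • (p /ₘ f))
    rw [smul_sub] at h
    rw [mul_smul_comm]
    linear_combination h

theorem finite_projective_quotient_range_of_monic [Nontrivial A] {P : Type*} [AddCommGroup P]
    [Module A P] [Module (Polynomial A) P] [IsScalarTower A (Polynomial A) P]
    [Module.Finite (Polynomial A) P] [Module.Projective (Polynomial A) P]
    {f : Polynomial A} (hf : f.Monic) {r : ℕ}
    (ι : (Fin r → Polynomial A) →ₗ[Polynomial A] P) (hι : Function.Injective ι)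
    (hfP : ∀ p : P, f • p ∈ LinearMap.range ι) :
    Module.Finite A (P ⧸ LinearMap.range ι) ∧ Module.Projective A (P ⧸ LinearMap.range ι) := by
  obtain ⟨n, π, j, -, -, hπj⟩ :=
    Module.Finite.exists_comp_eq_id_of_projective (Polynomial A) P
  let σ : P →ₗ[A] P := (π.restrictScalars A) ∘ₗ
    (LinearMap.pi fun i => divByMonicHom hf ∘ₗ LinearMap.proj i) ∘ₗ (j.restrictScalars A)
  have hσ : ∀ p, σ (f • p) = p := fun p => by
    have h : (fun i => divByMonicHom hf ((j (f • p)) i)) = j p := by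
      ext1 i
      simp [divByMonicHom, mul_divByMonic_cancel_left _ hf]
    change π (fun i => divByMonicHom hf ((j (f • p)) i)) = p
    rw [h]
    exact LinearMap.congr_fun hπj p
  let μ : P →ₗ[Polynomial A] (Fin r → Polynomial A) :=
    (LinearEquiv.ofInjective ι hι).symm.toLinearMap ∘ₗ
      (LinearMap.lsmul (Polynomial A) P f).codRestrict (LinearMap.range ι) hfP
  have hμ : ∀ p, ι (μ p) = f • p := fun p => by
    have := (LinearEquiv.ofInjective ι hι).apply_symm_apply
      ((LinearMap.lsmul (Polynomial A) P f).codRestrict (LinearMap.range ι) hfP p)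
    exact congrArg Subtype.val this
  let N := f.natDegree
  have hmod : ∀ p, modByMonicHom f p ∈ degreeLT A N := fun p => by
    rw [mem_degreeLT, ← degree_eq_natDegree hf.ne_zero]
    exact degree_modByMonic_lt p hf
  let τ : Polynomial A →ₗ[A] degreeLT A N := (modByMonicHom f).codRestrict _ hmod
  let e : (Fin r → degreeLT A N) ≃ₗ[A] (Fin r → Fin N → A) :=
    LinearEquiv.piCongrRight fun _ => degreeLTEquiv A N
  let α₀ : P →ₗ[A] (Fin r → degreeLT A N) :=
    (LinearMap.pi fun i => τ ∘ₗ LinearMap.proj i) ∘ₗ (μ.restrictScalars A)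
  have hα₀ : (LinearMap.range ι).restrictScalars A ≤ LinearMap.ker α₀ := by
    rintro _ ⟨v, rfl⟩
    rw [LinearMap.mem_ker]
    have h : μ (ι v) = f • v := hι (by rw [hμ, map_smul])
    ext1 i
    apply Subtype.ext
    change modByMonicHom f ((μ (ι v)) i) = 0
    rw [h]
    simpa using (modByMonic_eq_zero_iff_dvd hf).2 (dvd_mul_right f (v i))
  let E := Submodule.Quotient.restrictScalarsEquiv A (LinearMap.range ι)
  let α : (P ⧸ LinearMap.range ι) →ₗ[A] (Fin r → Fin N → A) :=
    e.toLinearMap ∘ₗ Submodule.liftQ _ α₀ hα₀ ∘ₗ E.symm.toLinearMap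
  let β₀ : (Fin r → degreeLT A N) →ₗ[A] P :=
    σ ∘ₗ (ι.restrictScalars A) ∘ₗ
      (LinearMap.pi fun i => (degreeLT A N).subtype ∘ₗ LinearMap.proj i)
  let β : (Fin r → Fin N → A) →ₗ[A] (P ⧸ LinearMap.range ι) :=
    ((LinearMap.range ι).mkQ.restrictScalars A) ∘ₗ β₀ ∘ₗ e.symm.toLinearMap
  have hβα : β ∘ₗ α = LinearMap.id := by
    refine LinearMap.ext fun x => ?_
    obtain ⟨p, rfl⟩ := (LinearMap.range ι).mkQ_surjective x
    have h1 : α ((LinearMap.range ι).mkQ p) = e (α₀ p) := rfl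
    have h2 : β (e (α₀ p)) = (LinearMap.range ι).mkQ (β₀ (α₀ p)) := by
      simp [β]
    have h3 : β₀ (α₀ p) = σ (ι (fun i => μ p i %ₘ f)) := rfl
    have h4 : (fun i => μ p i %ₘ f) = μ p - f • (fun i => μ p i /ₘ f) := by
      ext1 i
      simp [modByMonic_eq_sub_mul_div]
    rw [LinearMap.comp_apply, h1, h2, h3, h4, map_sub, map_smul, hμ, map_sub, hσ, hσ, map_sub]
    have h5 : (LinearMap.range ι).mkQ (ι fun i => μ p i /ₘ f) = 0 := by
      rw [← LinearMap.mem_ker, Submodule.ker_mkQ]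
      exact LinearMap.mem_range_self _ _
    rw [h5, sub_zero]
    rfl
  exact ⟨Module.Finite.of_surjective β fun x => ⟨α x, LinearMap.congr_fun hβα x⟩,
    Module.Projective.of_split α β hβα⟩

/-- A finite projective module over `A[X]` which becomes free after inverting a monic polynomial
is stably free, when finite projective modules over `A` are free. -/
theorem exists_prod_equiv_of_monic {A : Type u} [CommRing A] [Nontrivial A]
    (hA : ∀ (Q : Type u) [AddCommGroup Q] [Module A Q] [Module.Finite A Q]
      [Module.Projective A Q], Module.Free A Q)
    {P : Type u} [AddCommGroup P] [Module (Polynomial A) P] [Module.Finite (Polynomial A) P]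
    [Module.Projective (Polynomial A) P] {f : Polynomial A} (hf : f.Monic) {r : ℕ}
    (ι : (Fin r → Polynomial A) →ₗ[Polynomial A] P) (hι : Function.Injective ι)
    (hfP : ∀ p : P, f • p ∈ LinearMap.range ι) :
    ∃ q : ℕ, Nonempty ((P × (Fin q → Polynomial A)) ≃ₗ[Polynomial A]
      ((Fin r → Polynomial A) × (Fin q → Polynomial A))) := by
  let : Module A P := Module.compHom P (C : A →+* Polynomial A)
  have : IsScalarTower A (Polynomial A) P := IsScalarTower.of_algebraMap_smul fun _ _ => rfl
  obtain ⟨h1, h2⟩ := finite_projective_quotient_range_of_monic hf ι hι hfP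
  have := hA (P ⧸ LinearMap.range ι)
  let b := Module.finBasis A (P ⧸ LinearMap.range ι)
  obtain ⟨χ, π, hχ, hπ, hχπ⟩ := exists_exact_of_basis b
  obtain ⟨e⟩ := LinearMap.nonempty_ker_prod_equiv (LinearMap.range ι).mkQ π
    (LinearMap.range ι).mkQ_surjective hπ
  refine ⟨Module.finrank A (P ⧸ LinearMap.range ι), ⟨?_⟩⟩
  refine (LinearEquiv.prodComm _ _ _) ≪≫ₗ
    LinearEquiv.prodCongr (?_ : _ ≃ₗ[Polynomial A] LinearMap.ker π) (LinearEquiv.refl _ P) ≪≫ₗ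
    e.symm ≪≫ₗ LinearEquiv.prodCongr (?_ : _ ≃ₗ[Polynomial A] (Fin r → Polynomial A))
      (LinearEquiv.refl _ _)
  · exact (LinearEquiv.ofInjective χ hχ) ≪≫ₗ LinearEquiv.ofEq _ _ hχπ
  · exact (LinearEquiv.ofEq _ _ (Submodule.ker_mkQ _)) ≪≫ₗ (LinearEquiv.ofInjective ι hι).symm

end Polynomial

section Cancellation

variable {B M : Type*} [CommRing B] [AddCommGroup M] [Module B M]

theorem UnimodularVecsTransitive.exists_equiv_of_prod [Nontrivial B]
    (hB : UnimodularVecsTransitive B) {m : ℕ} (φ : (M × B) ≃ₗ[B] (Fin m → B)) :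
    ∃ k : ℕ, Nonempty (M ≃ₗ[B] (Fin k → B)) := by
  cases m with
  | zero =>
    have : ((0 : M), (1 : B)) = 0 := φ.injective (Subsingleton.elim _ _)
    exact absurd (congrArg Prod.snd this) one_ne_zero
  | succ k =>
    have hv : IsUnimodularVec (φ (0, 1)) := by
      let ℓ : (Fin (k + 1) → B) →ₗ[B] B := LinearMap.snd B M B ∘ₗ φ.symm.toLinearMap
      exact IsUnimodularVec.of_linearMap ℓ (by simp [ℓ])
    obtain ⟨G, hG⟩ := hB _ _ hv 0
    let N : Matrix (Fin (k + 1)) (Fin (k + 1)) B := (G : Matrix _ _ B)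
    let N' : Matrix (Fin (k + 1)) (Fin (k + 1)) B := ((G⁻¹ : (Matrix _ _ B)ˣ) : Matrix _ _ B)
    have hN : ∀ v, N *ᵥ N' *ᵥ v = v := fun v => by rw [mulVec_mulVec, Units.mul_inv, one_mulVec]
    have hN' : ∀ v, N' *ᵥ N *ᵥ v = v := fun v => by rw [mulVec_mulVec, Units.inv_mul, one_mulVec]
    let ψ : (M × B) ≃ₗ[B] (Fin (k + 1) → B) := φ ≪≫ₗ LinearEquiv.ofLinearMap
      N.mulVecLin N'.mulVecLin (LinearMap.ext hN) (LinearMap.ext hN')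
    have hψ : ∀ a, ψ (0, a) = Pi.single 0 a := fun a => by
      have h1 : ψ (0, 1) = Pi.single 0 1 := hG
      have h2 : ((0 : M), a) = a • ((0 : M), (1 : B)) := by simp
      rw [h2, map_smul, h1, ← Pi.single_smul, smul_eq_mul, mul_one]
    let T : M →ₗ[B] (Fin k → B) :=
      LinearMap.pi (fun i : Fin k => LinearMap.proj i.succ) ∘ₗ ψ.toLinearMap ∘ₗ
        LinearMap.inl B M B
    have hT : ∀ x i, T x i = ψ (x, 0) i.succ := fun _ _ => rfl
    refine ⟨k, ⟨LinearEquiv.ofBijective T ⟨?_, ?_⟩⟩⟩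
    · rw [← LinearMap.ker_eq_bot, LinearMap.ker_eq_bot']
      intro x hx
      have : ψ (x, 0) = ψ (0, ψ (x, 0) 0) := by
        rw [hψ]
        ext1 i
        refine Fin.cases ?_ (fun i => ?_) i
        · simp
        · rw [← hT, hx]
          simp
      exact congrArg Prod.fst (ψ.injective this)
    · intro y
      refine ⟨(ψ.symm (Fin.cons 0 y)).1, ?_⟩
      ext1 i
      have : ((ψ.symm (Fin.cons 0 y)).1, (0 : B)) =
          ψ.symm (Fin.cons 0 y) - (0, (ψ.symm (Fin.cons 0 y)).2) := by
        ext <;> simp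
      rw [hT, this, map_sub, hψ, LinearEquiv.apply_symm_apply]
      simp

theorem UnimodularVecsTransitive.exists_equiv_of_prod_pi [Nontrivial B]
    (hB : UnimodularVecsTransitive B) (q : ℕ) {m : ℕ}
    (φ : (M × (Fin q → B)) ≃ₗ[B] (Fin m → B)) :
    ∃ k : ℕ, Nonempty (M ≃ₗ[B] (Fin k → B)) := by
  induction q generalizing m with
  | zero => exact ⟨m, ⟨(LinearEquiv.prodUnique (R := B)).symm ≪≫ₗ φ⟩⟩
  | succ q ih =>
    obtain ⟨k, ⟨e⟩⟩ := hB.exists_equiv_of_prod (M := M × (Fin q → B)) (m := m)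
      (LinearEquiv.prodAssoc B M (Fin q → B) B ≪≫ₗ
        LinearEquiv.prodCongr (LinearEquiv.refl B M)
          (LinearEquiv.prodComm B (Fin q → B) B ≪≫ₗ Fin.consLinearEquiv B fun _ => B) ≪≫ₗ φ)
    exact ih e

end Cancellation

theorem Module.Finite.exists_linearIndependent_smul_mem_span (R P : Type*) [CommRing R]
    [IsDomain R] [AddCommGroup P] [Module R P] [Module.Finite R P] :
    ∃ (r : ℕ) (b : Fin r → P) (g : R), g ≠ 0 ∧ LinearIndependent R b ∧
      ∀ p, g • p ∈ Submodule.span R (Set.range b) := by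
  obtain ⟨n, s, hs⟩ := Module.Finite.exists_fin (R := R) (M := P)
  obtain ⟨I, hI, hI'⟩ := exists_maximal_linearIndepOn R s
  have H : ∀ i, ∃ a : R, a ≠ 0 ∧ a • s i ∈ Submodule.span R (s '' I) := fun i => by
    by_cases hi : i ∈ I
    · exact ⟨1, one_ne_zero, by
        rw [one_smul]; exact Submodule.subset_span (Set.mem_image_of_mem s hi)⟩
    · exact hI' i hi
  choose a ha ha' using H
  classical
  let e := Fintype.equivFin I
  have hr : Set.range (fun i => s (e.symm i)) = s '' I := by
    rw [Set.image_eq_range]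
    exact e.symm.surjective.range_comp (fun i : I => s i)
  refine ⟨Fintype.card I, fun i => s (e.symm i), ∏ i, a i, Finset.prod_ne_zero_iff.2 fun i _ => ha i,
    hI.linearIndependent.comp e.symm e.symm.injective, fun p => ?_⟩
  rw [hr]
  have hp : p ∈ Submodule.span R (Set.range s) := hs ▸ Submodule.mem_top
  induction hp using Submodule.span_induction with
  | mem x hx =>
    obtain ⟨i, rfl⟩ := hx
    rw [Fintype.prod_eq_prod_compl_mul i, mul_smul]
    exact Submodule.smul_mem _ _ (ha' i)
  | zero => simp
  | add x y _ _ hx hy => rw [smul_add]; exact add_mem hx hy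
  | smul c x _ hx => rw [smul_comm]; exact Submodule.smul_mem _ _ hx

universe u in
/-- The Quillen–Suslin theorem. -/
theorem MvPolynomial.free_of_projective (K : Type u) [Field K] (n : ℕ) (P : Type u)
    [AddCommGroup P] [Module (MvPolynomial (Fin n) K) P] [Module.Finite (MvPolynomial (Fin n) K) P]
    [Module.Projective (MvPolynomial (Fin n) K) P] : Module.Free (MvPolynomial (Fin n) K) P := by
  induction n generalizing P with
  | zero =>
    have e := (isEmptyRingEquiv K (Fin 0)).symm
    have : IsLocalRing (MvPolynomial (Fin 0) K) := e.isLocalRing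
    exact Module.free_of_flat_of_isLocalRing
  | succ n ih =>
    obtain ⟨r, b, g, hg, hb, hgb⟩ :=
      Module.Finite.exists_linearIndependent_smul_mem_span (MvPolynomial (Fin (n + 1)) K) P
    obtain ⟨e, u, heu⟩ := MvPolynomial.exists_ringEquiv_monic hg
    let B := Polynomial (MvPolynomial (Fin n) K)
    have hB : UnimodularVecsTransitive B :=
      (MvPolynomial.unimodularVecsTransitive K (n + 1)).of_ringEquiv e
    let : Module B P := Module.compHom P (e.symm : B →+* MvPolynomial (Fin (n + 1)) K)
    have hsm : ∀ (c : B) (p : P), c • p = e.symm c • p := fun _ _ => rfl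
    have := RingHomInvPair.of_ringEquiv e
    have := RingHomInvPair.of_ringEquiv e.symm
    let e₂ : P ≃ₛₗ[(e : MvPolynomial (Fin (n + 1)) K →+* B)] P :=
      { AddEquiv.refl P with
        map_smul' := fun c p => by
          change c • p = (e c) • p
          rw [hsm, e.symm_apply_apply] }
    have : Module.Finite B P := Module.Finite.of_surjective e₂.toLinearMap e₂.surjective
    have : Module.Projective B P := Module.Projective.of_equiv e₂
    let ι : (Fin r → B) →ₗ[B] P := Fintype.linearCombination B b
    have hι : ∀ c, ι c = ∑ i, e.symm (c i) • b i := fun c =>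
      Fintype.linearCombination_apply _ _ _
    have hinj : Function.Injective ι := by
      rw [← LinearMap.ker_eq_bot, LinearMap.ker_eq_bot']
      intro c hc
      rw [hι] at hc
      ext1 i
      exact (map_eq_zero_iff e.symm e.symm.injective).1 (Fintype.linearIndependent_iff.1 hb _ hc i)
    obtain ⟨q, ⟨E⟩⟩ := Polynomial.exists_prod_equiv_of_monic ih heu ι hinj fun p => by
      obtain ⟨c, hc⟩ := (Submodule.mem_span_range_iff_exists_fun _).1 (hgb p)
      refine ⟨fun i => e (u * c i), ?_⟩
      rw [hι, hsm]
      simp only [e.symm_apply_apply, mul_smul, ← hc, Finset.smul_sum]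
    obtain ⟨k, ⟨E'⟩⟩ := hB.exists_equiv_of_prod_pi q
      (E ≪≫ₗ (LinearEquiv.sumArrowLequivProdArrow (Fin r) (Fin q) B B).symm ≪≫ₗ
        LinearEquiv.funCongrLeft B B finSumFinEquiv.symm)
    have : Module.Free B P := Module.Free.of_equiv E'.symm
    exact Module.Free.of_equiv e₂.symm

section MinorIdeal

variable {R S ι κ : Type*} [CommRing R] [CommRing S]

/-- The ideal generated by the `k × k` minors of a matrix. -/
def minorIdeal (k : ℕ) (F : Matrix ι κ R) : Ideal R :=
  Ideal.span (Set.range fun rc : (Fin k → ι) × (Fin k → κ) => (F.submatrix rc.1 rc.2).det)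

theorem det_submatrix_mem_minorIdeal {k : ℕ} (F : Matrix ι κ R) (r : Fin k → ι) (c : Fin k → κ) :
    (F.submatrix r c).det ∈ minorIdeal k F :=
  Ideal.subset_span ⟨(r, c), rfl⟩

theorem minorIdeal_le {k : ℕ} {F : Matrix ι κ R} {I : Ideal R}
    (h : ∀ (r : Fin k → ι) (c : Fin k → κ), (F.submatrix r c).det ∈ I) : minorIdeal k F ≤ I :=
  Ideal.span_le.2 (by rintro _ ⟨rc, rfl⟩; exact h rc.1 rc.2)

theorem minorIdeal_zero (F : Matrix ι κ R) : minorIdeal 0 F = ⊤ := by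
  rw [Ideal.eq_top_iff_one]
  simpa using det_submatrix_mem_minorIdeal F (Fin.elim0 : Fin 0 → ι) (Fin.elim0 : Fin 0 → κ)

theorem minorIdeal_succ_le (k : ℕ) (F : Matrix ι κ R) :
    minorIdeal (k + 1) F ≤ minorIdeal k F := by
  refine minorIdeal_le fun r c => ?_
  rw [det_succ_row_zero]
  exact sum_mem fun j _ => Ideal.mul_mem_left _ _ (det_submatrix_mem_minorIdeal F _ _)

theorem minorIdeal_antitone (F : Matrix ι κ R) : Antitone fun k => minorIdeal k F :=
  antitone_nat_of_succ_le fun k => minorIdeal_succ_le k F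

theorem minorIdeal_transpose (k : ℕ) (F : Matrix ι κ R) :
    minorIdeal k Fᵀ = minorIdeal k F := by
  apply le_antisymm <;> refine minorIdeal_le fun r c => ?_
  · rw [← det_transpose]
    exact det_submatrix_mem_minorIdeal F c r
  · rw [← det_transpose]
    exact det_submatrix_mem_minorIdeal Fᵀ c r

theorem minorIdeal_mul_left_le [Fintype ι] {ι' : Type*} (k : ℕ) (M : Matrix ι' ι R)
    (F : Matrix ι κ R) : minorIdeal k (M * F) ≤ minorIdeal k F := by
  classical
  refine minorIdeal_le fun r c => ?_
  have h : (M * F).submatrix r c =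
      fun a => ∑ i, M (r a) i • (fun b => F i (c b) : Fin k → R) := by
    ext a b
    simp [mul_apply]
  change detRowAlternating.toMultilinearMap ((M * F).submatrix r c) ∈ _
  rw [h, MultilinearMap.map_sum]
  refine sum_mem fun f _ => ?_
  rw [MultilinearMap.map_smul_univ]
  exact Ideal.mul_mem_left _ _ (det_submatrix_mem_minorIdeal F f c)

theorem minorIdeal_mul_right_le [Fintype κ] {κ' : Type*} (k : ℕ) (F : Matrix ι κ R)
    (N : Matrix κ κ' R) : minorIdeal k (F * N) ≤ minorIdeal k F := by
  rw [← minorIdeal_transpose, transpose_mul, ← minorIdeal_transpose k F]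
  exact minorIdeal_mul_left_le _ _ _

theorem minorIdeal_units_mul [Fintype ι] [DecidableEq ι] (k : ℕ) (M : (Matrix ι ι R)ˣ)
    (F : Matrix ι κ R) : minorIdeal k ((M : Matrix ι ι R) * F) = minorIdeal k F := by
  refine le_antisymm (minorIdeal_mul_left_le _ _ _) ?_
  have h := minorIdeal_mul_left_le k ((M⁻¹ : (Matrix ι ι R)ˣ) : Matrix ι ι R) ((M : Matrix ι ι R) * F)
  rwa [← Matrix.mul_assoc, Units.inv_mul, Matrix.one_mul] at h

theorem minorIdeal_mul_units [Fintype κ] [DecidableEq κ] (k : ℕ) (F : Matrix ι κ R)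
    (N : (Matrix κ κ R)ˣ) : minorIdeal k (F * (N : Matrix κ κ R)) = minorIdeal k F := by
  refine le_antisymm (minorIdeal_mul_right_le _ _ _) ?_
  have h := minorIdeal_mul_right_le k (F * (N : Matrix κ κ R)) ((N⁻¹ : (Matrix κ κ R)ˣ) : Matrix κ κ R)
  rwa [Matrix.mul_assoc, Units.mul_inv, Matrix.mul_one] at h

theorem minorIdeal_smul (k : ℕ) (x : R) (F : Matrix ι κ R) :
    minorIdeal k (x • F) = Ideal.span {x ^ k} * minorIdeal k F := by
  have h : ∀ (r : Fin k → ι) (c : Fin k → κ),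
      ((x • F).submatrix r c).det = x ^ k * (F.submatrix r c).det := fun r c => by
    rw [submatrix_smul, Pi.smul_apply, Pi.smul_apply, det_smul, Fintype.card_fin]
  rw [minorIdeal, minorIdeal, Ideal.span_mul_span', Set.singleton_mul, ← Set.range_comp]
  simp only [h, Function.comp_def]

theorem minorIdeal_map (k : ℕ) (f : R →+* S) (F : Matrix ι κ R) :
    minorIdeal k (F.map f) = (minorIdeal k F).map f := by
  rw [minorIdeal, minorIdeal, Ideal.map_span, ← Set.range_comp]
  congr 2
  ext rc
  simp [RingHom.map_det, submatrix_map]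

theorem det_submatrix_mem_minorIdeal_of_card {τ : Type*} [Fintype τ] [DecidableEq τ] {k : ℕ}
    (hk : Fintype.card τ = k) (F : Matrix ι κ R) (r : τ → ι) (c : τ → κ) :
    (F.submatrix r c).det ∈ minorIdeal k F := by
  rw [← det_submatrix_equiv_self (Fintype.equivFinOfCardEq hk).symm, submatrix_submatrix]
  exact det_submatrix_mem_minorIdeal F _ _

/-- The block diagonal matrix with diagonal blocks `1` and `G`. -/
def oneBlock {l m : ℕ} (G : Matrix (Fin l) (Fin m) R) : Matrix (Fin (l + 1)) (Fin (m + 1)) R :=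
  of (Fin.cons (Pi.single 0 1) fun i => Fin.cons 0 (G i))

section OneBlock

variable {l m : ℕ} (G : Matrix (Fin l) (Fin m) R)

@[simp] theorem oneBlock_zero_zero : oneBlock G 0 0 = 1 := by simp [oneBlock]

@[simp] theorem oneBlock_zero_succ (j : Fin m) : oneBlock G 0 j.succ = 0 := by simp [oneBlock]

@[simp] theorem oneBlock_succ_zero (i : Fin l) : oneBlock G i.succ 0 = 0 := by simp [oneBlock]

@[simp] theorem oneBlock_succ_succ (i : Fin l) (j : Fin m) :
    oneBlock G i.succ j.succ = G i j := by simp [oneBlock]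

theorem oneBlock_mul {p : ℕ} (G' : Matrix (Fin m) (Fin p) R) :
    oneBlock G * oneBlock G' = oneBlock (G * G') := by
  ext i j
  refine Fin.cases ?_ (fun i => ?_) i <;> refine Fin.cases ?_ (fun j => ?_) j <;>
    simp [mul_apply, Fin.sum_univ_succ]

theorem det_oneBlock (G : Matrix (Fin l) (Fin l) R) : (oneBlock G).det = G.det := by
  rw [det_succ_row_zero, Fin.sum_univ_succ]
  simp
  congr 1

theorem minorIdeal_oneBlock (k : ℕ) : minorIdeal (k + 1) (oneBlock G) = minorIdeal k G := by
  apply le_antisymm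
  · have key : ∀ {k : ℕ} (r : Fin k → Fin (l + 1)) (c : Fin k → Fin (m + 1)),
        (∀ a, r a ≠ 0) → (∀ a, c a ≠ 0) →
        ((oneBlock G).submatrix r c).det ∈ minorIdeal k G := fun r c hr hc => by
      choose r' hr' using fun a => Fin.exists_succ_eq.2 (hr a)
      choose c' hc' using fun a => Fin.exists_succ_eq.2 (hc a)
      have : (oneBlock G).submatrix r c = G.submatrix r' c' := by
        ext a b
        simp [← hr', ← hc']
      rw [this]
      exact det_submatrix_mem_minorIdeal _ _ _
    refine minorIdeal_le fun r c => ?_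
    by_cases hri : Function.Injective r
    swap
    · obtain ⟨a, b, hab, hne⟩ := Function.not_injective_iff.1 hri
      rw [det_zero_of_row_eq hne (by ext; simp [hab])]
      exact zero_mem _
    by_cases hci : Function.Injective c
    swap
    · obtain ⟨a, b, hab, hne⟩ := Function.not_injective_iff.1 hci
      rw [det_zero_of_column_eq hne (by simp [hab])]
      exact zero_mem _
    by_cases hr : ∃ a, r a = 0
    · obtain ⟨a, ha⟩ := hr
      rw [det_succ_row _ a]
      refine sum_mem fun b _ => ?_
      by_cases hb : c b = 0
      · refine Ideal.mul_mem_left _ _ ?_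
        rw [submatrix_submatrix]
        refine key _ _ (fun i h => ?_) fun i h => ?_
        · exact Fin.succAbove_ne a i (hri (h.trans ha.symm))
        · exact Fin.succAbove_ne b i (hci (h.trans hb.symm))
      · obtain ⟨j, hj⟩ := Fin.exists_succ_eq.2 hb
        rw [submatrix_apply, ha, ← hj, oneBlock_zero_succ, mul_zero, zero_mul]
        exact zero_mem _
    · push Not at hr
      by_cases hc : ∃ b, c b = 0
      · obtain ⟨b, hb⟩ := hc
        rw [det_eq_zero_of_column_eq_zero b]
        · exact zero_mem _
        · intro a
          obtain ⟨i, hi⟩ := Fin.exists_succ_eq.2 (hr a)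
          rw [submatrix_apply, hb, ← hi, oneBlock_succ_zero]
      · push Not at hc
        exact minorIdeal_succ_le _ _ (key r c hr hc)
  · refine minorIdeal_le fun r c => ?_
    rw [← det_oneBlock]
    convert det_submatrix_mem_minorIdeal (oneBlock G) (Fin.cons 0 (Fin.succ ∘ r))
      (Fin.cons 0 (Fin.succ ∘ c)) using 2
    ext i j
    refine Fin.cases ?_ (fun i => ?_) i <;> refine Fin.cases ?_ (fun j => ?_) j <;> simp

end OneBlock

end MinorIdeal

theorem det_smul_eq_of_det_fromBlocks_eq_zero {R ι κ κ' : Type*} [CommRing R] [IsDomain R]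
    [Fintype ι] [DecidableEq ι] {A : Matrix ι ι R} (hA : A.det ≠ 0) (B : Matrix ι κ R)
    (C : Matrix κ' ι R) (D : Matrix κ' κ R)
    (h : ∀ i j, (fromBlocks A (B.submatrix id fun _ : Unit => j) (C.submatrix (fun _ : Unit => i) id)
      (D.submatrix (fun _ => i) fun _ => j)).det = 0) :
    A.det • D = C * A.adjugate * B := by
  ext i j
  have h1 : fromBlocks A (B.submatrix id fun _ : Unit => j) (C.submatrix (fun _ : Unit => i) id)
      (D.submatrix (fun _ => i) fun _ => j) *
      fromBlocks 1 (-(A.adjugate * B.submatrix id fun _ : Unit => j)) 0 (A.det • 1) =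
      fromBlocks A 0 (C.submatrix (fun _ : Unit => i) id)
        ((A.det • D - C * A.adjugate * B).submatrix (fun _ => i) fun _ => j) := by
    rw [fromBlocks_multiply]
    congr 1
    · simp
    · simp [← Matrix.mul_assoc, mul_adjugate]
    · simp
    · rw [sub_eq_neg_add, Matrix.mul_assoc]
      ext
      simp [mul_apply]
  have h2 := congrArg det h1
  rw [det_mul, h, zero_mul, det_fromBlocks_zero₁₂] at h2
  have h3 := (mul_eq_zero.1 h2.symm).resolve_left hA
  simpa [sub_eq_zero] using h3

/-- A matrix of constant rank over a domain is von Neumann regular. -/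
theorem exists_mul_mul_eq_self_of_minorIdeal {R : Type*} [CommRing R] [IsDomain R] {l m s : ℕ}
    (F : Matrix (Fin l) (Fin m) R) (hs : minorIdeal s F = ⊤) (hs' : minorIdeal (s + 1) F = ⊥) :
    ∃ Y : Matrix (Fin m) (Fin l) R, F * Y * F = F := by
  have h1 : (1 : R) ∈ minorIdeal s F := hs ▸ Submodule.mem_top
  obtain ⟨a, ha⟩ := Ideal.mem_span_range_iff_exists_fun.1 h1
  have key : ∀ (r : Fin s → Fin l) (c : Fin s → Fin m),
      ∃ Y : Matrix (Fin m) (Fin l) R, F * Y * F = (F.submatrix r c).det • F := fun r c => by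
    by_cases hd : (F.submatrix r c).det = 0
    · exact ⟨0, by simp [hd]⟩
    · refine ⟨(1 : Matrix (Fin m) (Fin m) R).submatrix id c * (F.submatrix r c).adjugate *
        (1 : Matrix (Fin l) (Fin l) R).submatrix r id, ?_⟩
      rw [det_smul_eq_of_det_fromBlocks_eq_zero hd (F.submatrix r id) (F.submatrix id c) F]
      · have e1 : F * (1 : Matrix (Fin m) (Fin m) R).submatrix id c = F.submatrix id c := by
          ext i j; simp [mul_apply, one_apply]
        have e2 : (1 : Matrix (Fin l) (Fin l) R).submatrix r id * F = F.submatrix r id := by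
          ext i j; simp [mul_apply, one_apply]
        rw [← e1, ← e2]
        simp only [Matrix.mul_assoc]
      · intro i j
        have := det_submatrix_mem_minorIdeal_of_card (k := s + 1) (τ := Fin s ⊕ Unit) (by simp) F
          (Sum.elim r fun _ => i) (Sum.elim c fun _ => j)
        rw [hs', Submodule.mem_bot] at this
        rw [← this]
        congr 1
        ext (a | a) (b | b) <;> rfl
  choose Y hY using key
  refine ⟨∑ rc : (Fin s → Fin l) × (Fin s → Fin m), a rc • Y rc.1 rc.2, ?_⟩
  simp only [Matrix.mul_sum, Matrix.sum_mul, Matrix.mul_smul, Matrix.smul_mul, hY, smul_smul]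
  rw [← Finset.sum_smul, ha, one_smul]

universe u in
theorem MvPolynomial.exists_isUnimodularVec_row {K : Type u} [Field K] {n l m s : ℕ}
    (F : Matrix (Fin l) (Fin m) (MvPolynomial (Fin n) K)) (hF : F ≠ 0)
    (hs : minorIdeal s F = ⊤) (hs' : minorIdeal (s + 1) F = ⊥) (i₀ : Fin l) :
    ∃ U : (Matrix (Fin l) (Fin l) (MvPolynomial (Fin n) K))ˣ,
      IsUnimodularVec (((U : Matrix (Fin l) (Fin l) (MvPolynomial (Fin n) K)) * F) i₀) := by
  obtain ⟨Y, hY⟩ := exists_mul_mul_eq_self_of_minorIdeal F hs hs'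
  let A := MvPolynomial (Fin n) K
  let W : Submodule A (Fin l → A) := LinearMap.range (F * Y).mulVecLin
  have hW : ∀ w : W, (F * Y) *ᵥ (w : Fin l → A) = w := by
    rintro ⟨_, v, rfl⟩
    change (F * Y) *ᵥ (F * Y) *ᵥ v = (F * Y) *ᵥ v
    rw [mulVec_mulVec, ← Matrix.mul_assoc, hY]
  let ρ : (Fin l → A) →ₗ[A] W := (F * Y).mulVecLin.rangeRestrict
  have hρ : ρ ∘ₗ W.subtype = LinearMap.id := LinearMap.ext fun w => Subtype.ext (hW w)
  have : Module.Finite A W := Module.Finite.of_surjective ρ (LinearMap.surjective_rangeRestrict _)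
  have : Module.Projective A W := Module.Projective.of_split W.subtype ρ hρ
  have : Module.Free A W := MvPolynomial.free_of_projective K n W
  have : Nontrivial W := by
    by_contra hW0
    rw [not_nontrivial_iff_subsingleton] at hW0
    apply hF
    rw [← hY]
    have : F * Y = 0 := by
      apply Matrix.toLin'.injective
      rw [map_zero]
      refine LinearMap.ext fun v => ?_
      exact congrArg Subtype.val (Subsingleton.elim (ρ v) 0)
    rw [this, Matrix.zero_mul]
  let b := Module.Free.chooseBasis A W
  obtain ⟨i⟩ := b.index_nonempty
  have hb : IsUnimodularVec (b i : Fin l → A) := by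
    refine IsUnimodularVec.of_linearMap (b.coord i ∘ₗ ρ) ?_
    have : ρ (b i : Fin l → A) = b i := LinearMap.congr_fun hρ (b i)
    simp [this]
  obtain ⟨U, hU⟩ := MvPolynomial.unimodularVecsTransitive K n l _ hb i₀
  refine ⟨U, Y *ᵥ (b i : Fin l → A), ?_⟩
  have h1 : ((U : Matrix (Fin l) (Fin l) A) * F) *ᵥ (Y *ᵥ (b i : Fin l → A)) = Pi.single i₀ 1 := by
    rw [mulVec_mulVec, Matrix.mul_assoc, ← mulVec_mulVec, hW, hU]
  have h2 := congrFun h1 i₀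
  rw [Pi.single_eq_same] at h2
  rw [dotProduct_comm]
  exact h2

namespace MatEquiv

variable {R S : Type*} [CommRing R] [CommRing S] {l m : ℕ}

theorem trans {F G H : Matrix (Fin l) (Fin m) R} (h : MatEquiv F G) (h' : MatEquiv G H) :
    MatEquiv F H := by
  obtain ⟨M, N, hM, hN, rfl⟩ := h
  obtain ⟨M', N', hM', hN', rfl⟩ := h'
  refine ⟨M' * M, N * N', ?_, ?_, ?_⟩
  · rw [det_mul]; exact hM'.mul hM
  · rw [det_mul]; exact hN.mul hN'
  · simp only [Matrix.mul_assoc]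

theorem smul {F G : Matrix (Fin l) (Fin m) R} (x : R) (h : MatEquiv F G) :
    MatEquiv (x • F) (x • G) := by
  obtain ⟨M, N, hM, hN, rfl⟩ := h
  exact ⟨M, N, hM, hN, by rw [Matrix.mul_smul, Matrix.smul_mul]⟩

theorem oneBlock {F G : Matrix (Fin l) (Fin m) R} (h : MatEquiv F G) :
    MatEquiv (oneBlock F) (oneBlock G) := by
  obtain ⟨M, N, hM, hN, rfl⟩ := h
  exact ⟨_root_.oneBlock M, _root_.oneBlock N, by rwa [det_oneBlock], by rwa [det_oneBlock],
    by rw [oneBlock_mul, oneBlock_mul]⟩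

theorem map (f : R →+* S) {F G : Matrix (Fin l) (Fin m) R} (h : MatEquiv F G) :
    MatEquiv (F.map f) (G.map f) := by
  obtain ⟨M, N, hM, hN, rfl⟩ := h
  refine ⟨M.map f, N.map f, ?_, ?_, by rw [Matrix.map_mul, Matrix.map_mul]⟩
  · have := hM.map f
    rwa [RingHom.map_det] at this
  · have := hN.map f
    rwa [RingHom.map_det] at this

theorem minorIdeal_eq {F G : Matrix (Fin l) (Fin m) R} (h : MatEquiv F G) (k : ℕ) :
    minorIdeal k G = minorIdeal k F := by
  obtain ⟨M, N, hM, hN, rfl⟩ := h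
  obtain ⟨M, rfl⟩ := (isUnit_iff_isUnit_det M).2 hM
  obtain ⟨N, rfl⟩ := (isUnit_iff_isUnit_det N).2 hN
  rw [minorIdeal_mul_units, minorIdeal_units_mul]

/-- If the first row of a matrix is unimodular and unimodular vectors are completable, then the
matrix splits off a `1 × 1` block. -/
theorem exists_oneBlock (hR : UnimodularVecsTransitive R)
    (F : Matrix (Fin (l + 1)) (Fin (m + 1)) R) (hF : IsUnimodularVec (F 0)) :
    ∃ G, MatEquiv F (_root_.oneBlock G) := by
  obtain ⟨V, hV⟩ := hR _ _ hF 0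
  let H : Matrix (Fin (l + 1)) (Fin (m + 1)) R := F * (V : Matrix _ _ R)ᵀ
  have hH : ∀ j, H 0 j = (Pi.single 0 1 : Fin (m + 1) → R) j := fun j => by
    rw [← hV]
    exact congrFun (vecMul_transpose (V : Matrix _ _ R) (F 0)) j
  let L : Matrix (Fin (l + 1)) (Fin (l + 1)) R :=
    of (Fin.cons (Pi.single 0 1) fun i => Fin.cons (-H i.succ 0) (Pi.single i 1))
  have hL : L.det = 1 := by
    have h1 : L.submatrix Fin.succ Fin.succ = 1 := by
      ext i j
      simp [L, one_apply, Pi.single_apply, eq_comm]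
    rw [det_succ_row_zero, Fin.sum_univ_succ]
    simp only [Fin.succAbove_zero, h1]
    simp [L]
  refine ⟨H.submatrix Fin.succ Fin.succ, L, (V : Matrix _ _ R)ᵀ, ?_, ?_, ?_⟩
  · rw [hL]; exact isUnit_one
  · rw [det_transpose]
    exact (isUnit_iff_isUnit_det _).1 V.isUnit
  · rw [Matrix.mul_assoc]
    change _ = L * H
    ext i j
    rw [mul_apply, Fin.sum_univ_succ, hH]
    refine Fin.cases ?_ (fun i => ?_) i
    · refine Fin.cases ?_ (fun j => ?_) j <;> simp [L]
    · refine Fin.cases ?_ (fun j => ?_) j <;> simp [L, Pi.single_apply]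

end MatEquiv

section

variable {R ι κ : Type*} [CommRing R]

theorem minorIdeal_eq_bot_of_card_lt [Fintype ι] {k : ℕ} (hk : Fintype.card ι < k)
    (F : Matrix ι κ R) : minorIdeal k F = ⊥ := by
  refine le_bot_iff.1 (minorIdeal_le fun r c => ?_)
  obtain ⟨a, b, hne, hab⟩ := Fintype.exists_ne_map_eq_of_card_lt r (by simpa using hk)
  rw [Submodule.mem_bot]
  exact det_zero_of_row_eq hne (by ext; simp [hab])

theorem apply_mem_minorIdeal_one (F : Matrix ι κ R) (i : ι) (j : κ) : F i j ∈ minorIdeal 1 F := by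
  have := det_submatrix_mem_minorIdeal F (fun _ : Fin 1 => i) fun _ => j
  simpa using this

theorem ne_zero_of_minorIdeal_eq_top [Nontrivial R] {k : ℕ} (hk : k ≠ 0) {F : Matrix ι κ R}
    (h : minorIdeal k F = ⊤) : F ≠ 0 := by
  rintro rfl
  have : minorIdeal k (0 : Matrix ι κ R) ≤ ⊥ := minorIdeal_le fun r c => by
    have : Nonempty (Fin k) := ⟨⟨0, Nat.pos_of_ne_zero hk⟩⟩
    rw [submatrix_zero, Submodule.mem_bot]
    exact Matrix.det_zero
  rw [h] at this
  exact top_ne_bot (le_bot_iff.1 this)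

theorem minorIdeal_le_span_range_row {l : ℕ} (F : Matrix (Fin (l + 1)) κ R) (i : Fin (l + 1)) :
    minorIdeal (l + 1) F ≤ Ideal.span (Set.range (F i)) := by
  refine minorIdeal_le fun r c => ?_
  by_cases hr : Function.Injective r
  · obtain ⟨a, rfl⟩ := Finite.surjective_of_injective hr i
    rw [det_succ_row _ a]
    refine sum_mem fun b _ => Ideal.mul_mem_right _ _ (Ideal.mul_mem_left _ _ ?_)
    exact Ideal.subset_span (Set.mem_range_self _)
  · obtain ⟨a, b, hab, hne⟩ := Function.not_injective_iff.1 hr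
    rw [det_zero_of_row_eq hne (by ext; simp [hab])]
    exact zero_mem _

end

theorem Polynomial.isUnimodularVec_of_X_pow_mem {A ι : Type*} [CommRing A] [Fintype ι]
    [DecidableEq ι]
    {v : ι → Polynomial A} {N : ℕ}
    (hN : (Polynomial.X : Polynomial A) ^ N ∈ Ideal.span (Set.range v))
    (h0 : IsUnimodularVec fun i => Polynomial.constantCoeff (v i)) : IsUnimodularVec v := by
  obtain ⟨c, hc⟩ := h0
  let w := (fun i => Polynomial.C (c i)) ⬝ᵥ v
  have hw : w ∈ Ideal.span (Set.range v) :=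
    sum_mem fun i _ => Ideal.mul_mem_left _ _ (Ideal.subset_span (Set.mem_range_self i))
  have hw1 : Polynomial.X ∣ w - 1 := by
    rw [Polynomial.X_dvd_iff, ← Polynomial.constantCoeff_apply, map_sub, map_one, sub_eq_zero,
      ← hc]
    simp [w, dotProduct]
  obtain ⟨h, hh⟩ := hw1
  have hco : IsCoprime (Polynomial.X ^ N) w :=
    IsCoprime.pow_left ⟨-h, 1, by linear_combination hh⟩
  obtain ⟨a, b, hab⟩ := hco
  have h1 : (1 : Polynomial A) ∈ Ideal.span (Set.range v) := by
    rw [← hab]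
    exact add_mem (Ideal.mul_mem_left _ _ hN) (Ideal.mul_mem_left _ _ hw)
  obtain ⟨d, hd⟩ := Ideal.mem_span_range_iff_exists_fun.1 h1
  exact ⟨d, hd⟩

theorem le_of_minorIdeal_eq_span_pow {R ι κ : Type*} [CommRing R] [IsDomain R] {x : R} (hx : Prime x)
    {F : Matrix ι κ R} {p : ℕ → ℕ} {l : ℕ}
    (h : ∀ k ≤ l, minorIdeal k F = Ideal.span {x ^ p k}) {j k : ℕ} (hjk : j ≤ k) (hk : k ≤ l) :
    p j ≤ p k := by
  have := minorIdeal_antitone F hjk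
  simp only [h k hk, h j (hjk.trans hk), Ideal.span_singleton_le_span_singleton] at this
  exact (pow_dvd_pow_iff hx.ne_zero hx.not_isUnit).1 this

universe u in
theorem Polynomial.matEquiv_of_minorIdeal_eq_span_pow {K : Type u} [Field K] (n : ℕ) {l m : ℕ}
    (hlm : l ≤ m) (F : Matrix (Fin l) (Fin m) (Polynomial (MvPolynomial (Fin n) K)))
    (p : ℕ → ℕ) (hp : p 0 = 0)
    (h : ∀ k ≤ l, minorIdeal k F = Ideal.span {Polynomial.X ^ p k}) :
    MatEquiv F (of fun i j =>
      if (i : ℕ) = (j : ℕ) then Polynomial.X ^ (p ((i : ℕ) + 1) - p (i : ℕ)) else 0) := by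
  induction l generalizing m p with
  | zero => exact ⟨1, 1, by simp, by simp, Matrix.ext fun i => i.elim0⟩
  | succ l ih =>
    obtain ⟨m, rfl⟩ : ∃ m', m = m' + 1 := ⟨m - 1, by omega⟩
    let A := MvPolynomial (Fin n) K
    have hX : Prime (Polynomial.X : Polynomial A) := Polynomial.prime_X
    have hA : UnimodularVecsTransitive (Polynomial A) :=
      (MvPolynomial.unimodularVecsTransitive K (n + 1)).of_ringEquiv
        (MvPolynomial.finSuccEquiv K n).toRingEquiv
    have hdvd : ∀ i j, (Polynomial.X : Polynomial A) ^ p 1 ∣ F i j := fun i j => by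
      rw [← Ideal.mem_span_singleton, ← h 1 (by omega)]
      exact apply_mem_minorIdeal_one F i j
    choose F' hF' using hdvd
    have hFF' : F = (Polynomial.X : Polynomial A) ^ p 1 • of F' := by
      ext1 i j
      exact hF' i j
    have hsm : ∀ k ≤ l + 1, Ideal.span {(Polynomial.X : Polynomial A) ^ p k} =
        Ideal.span {Polynomial.X ^ (k * p 1)} * minorIdeal k (of F') := fun k hk => by
      rw [← h k hk, hFF', minorIdeal_smul, ← pow_mul, mul_comm k]
    have hkp : ∀ k ≤ l + 1, k * p 1 ≤ p k := fun k hk => by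
      refine (pow_dvd_pow_iff hX.ne_zero hX.not_isUnit).1 ?_
      rw [← Ideal.span_singleton_le_span_singleton, hsm k hk]
      exact Ideal.mul_le_left (I := Ideal.span {(Polynomial.X : Polynomial A) ^ (k * p 1)})
    let q : ℕ → ℕ := fun k => p k - k * p 1
    have hq : ∀ k ≤ l + 1, minorIdeal k (of F') = Ideal.span {Polynomial.X ^ q k} := fun k hk => by
      have h1 := hsm k hk
      rw [← Nat.add_sub_cancel' (hkp k hk), pow_add, ← Ideal.span_singleton_mul_span_singleton,
        Ideal.span_singleton_mul_right_inj (pow_ne_zero _ hX.ne_zero)] at h1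
      exact h1.symm
    have hq1 : q 1 = 0 := by simp [q]
    let s := Nat.findGreatest (fun k => q k = 0) (l + 1)
    have hs1 : 1 ≤ s := Nat.le_findGreatest (by omega) hq1
    have hsl : s ≤ l + 1 := Nat.findGreatest_le _
    have hqs : q s = 0 := Nat.findGreatest_spec (P := fun k => q k = 0) (by omega) hq1
    let ε : Polynomial A →+* A := Polynomial.constantCoeff
    have hbar : minorIdeal s ((of F').map ε) = ⊤ := by
      rw [minorIdeal_map, hq s hsl, hqs, pow_zero, Ideal.span_singleton_one, Ideal.map_top]
    have hbar' : minorIdeal (s + 1) ((of F').map ε) = ⊥ := by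
      by_cases hs : s = l + 1
      · exact minorIdeal_eq_bot_of_card_lt (by simp [hs]) _
      · have hne : q (s + 1) ≠ 0 :=
          Nat.findGreatest_is_greatest (P := fun k => q k = 0) (Nat.lt_succ_self s) (by omega)
        rw [minorIdeal_map, hq (s + 1) (by omega), Ideal.map_span, Set.image_singleton, map_pow]
        simp [ε, hne]
    obtain ⟨U, hU⟩ := MvPolynomial.exists_isUnimodularVec_row _
      (ne_zero_of_minorIdeal_eq_top (by omega) hbar) hbar hbar' 0
    let UC : (Matrix (Fin (l + 1)) (Fin (l + 1)) (Polynomial A))ˣ :=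
      Units.map ((Polynomial.C : A →+* Polynomial A).mapMatrix).toMonoidHom U
    have hUC : (UC : Matrix (Fin (l + 1)) (Fin (l + 1)) (Polynomial A)) =
        (U : Matrix (Fin (l + 1)) (Fin (l + 1)) A).map Polynomial.C := rfl
    have hrow : IsUnimodularVec
        (((UC : Matrix (Fin (l + 1)) (Fin (l + 1)) (Polynomial A)) * of F') 0) := by
      refine Polynomial.isUnimodularVec_of_X_pow_mem (N := q (l + 1)) ?_ ?_
      · refine minorIdeal_le_span_range_row _ 0 ?_
        rw [minorIdeal_units_mul, hq _ le_rfl]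
        exact Ideal.mem_span_singleton_self _
      · convert hU using 1
        ext1 j
        simp [mul_apply, hUC, ε]
    have hE : MatEquiv (of F') ((UC : Matrix (Fin (l + 1)) (Fin (l + 1)) (Polynomial A)) * of F') :=
      ⟨UC, 1, (isUnit_iff_isUnit_det _).1 UC.isUnit, by simp, by simp⟩
    obtain ⟨G, hG⟩ := MatEquiv.exists_oneBlock hA _ hrow
    replace hG := hE.trans hG
    have hGk : ∀ k ≤ l, minorIdeal k G = Ideal.span {Polynomial.X ^ q (k + 1)} := fun k hk => by
      rw [← minorIdeal_oneBlock, hG.minorIdeal_eq, hq _ (by omega)]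
    have hGD := ih (by omega) G (fun k => q (k + 1)) hq1 hGk
    rw [hFF']
    convert (hG.trans hGD.oneBlock).smul _ using 1
    ext1 i j
    refine Fin.cases ?_ (fun i => ?_) i <;> refine Fin.cases ?_ (fun j => ?_) j
    · simp [hp]
    · simp
    · simp
    · by_cases hij : (i : ℕ) = j
      · have h1 := hkp (i + 1) (by omega)
        have h2 := hkp (i + 2) (by omega)
        have h3 := le_of_minorIdeal_eq_span_pow hX hq (j := i + 1) (k := i + 2) (by omega)
          (by omega)
        have h4 : ((i : ℕ) + 2) * p 1 = (i + 1) * p 1 + p 1 := by ring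
        simp only [of_apply, Fin.val_succ, hij, if_true, Matrix.smul_apply, oneBlock_succ_succ, smul_eq_mul,
          ← pow_add]
        congr 1
        have h5 : (j : ℕ) + 1 + 1 = j + 2 := rfl
        simp only [hij, q, h5] at h1 h2 h3 h4 ⊢
        generalize ((j : ℕ) + 2) * p 1 = a at *
        generalize ((j : ℕ) + 1) * p 1 = b at *
        omega
      · simp [hij]

theorem minorIdeal_eq_span_singleton {R : Type*} [CommRing R] {l m k : ℕ}
    {F : Matrix (Fin l) (Fin m) R} {d : R} (hd : IsGcdMinors k F d)
    (h : Ideal.span {b : R | d * b ∈ minorsSet k F} = ⊤) :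
    minorIdeal k F = Ideal.span {d} := by
  refine le_antisymm (minorIdeal_le fun r c => ?_) ?_
  · rw [Ideal.mem_span_singleton]
    by_cases hr : Function.Injective r
    · by_cases hc : Function.Injective c
      · exact hd.1 _ ⟨r, c, hr, hc, rfl⟩
      · obtain ⟨a, b, hab, hne⟩ := Function.not_injective_iff.1 hc
        rw [det_zero_of_column_eq hne fun i => by simp [hab]]
        exact dvd_zero d
    · obtain ⟨a, b, hab, hne⟩ := Function.not_injective_iff.1 hr
      rw [det_zero_of_row_eq hne (by ext; simp [hab])]
      exact dvd_zero d
  · rw [← mul_one (Ideal.span {d}), Ideal.one_eq_top, ← h, Ideal.span_mul_span', Ideal.span_le]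
    rintro _ ⟨_, rfl, b, ⟨r, c, -, -, hb⟩, rfl⟩
    rw [SetLike.mem_coe]
    dsimp only
    rw [hb]
    exact det_submatrix_mem_minorIdeal F r c

theorem MvPolynomial.exists_finSuccEquiv_eq_C_of_mem_supported {K : Type*} [CommRing K] {n : ℕ}
    {f : MvPolynomial (Fin (n + 1)) K}
    (hf : f ∈ MvPolynomial.supported K (({0} : Set (Fin (n + 1)))ᶜ)) :
    ∃ g, MvPolynomial.finSuccEquiv K n f = Polynomial.C g := by
  have hle : MvPolynomial.supported K (({0} : Set (Fin (n + 1)))ᶜ) ≤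
      (Polynomial.CAlgHom (R := K) (A := MvPolynomial (Fin n) K)).range.comap
        (MvPolynomial.finSuccEquiv K n : _ →ₐ[K] Polynomial (MvPolynomial (Fin n) K)) := by
    refine Algebra.adjoin_le ?_
    rintro _ ⟨i, hi, rfl⟩
    obtain ⟨j, rfl⟩ := Fin.exists_succ_eq.2 hi
    exact ⟨X j, MvPolynomial.finSuccEquiv_X_succ.symm⟩
  obtain ⟨g, hg⟩ := hle hf
  exact ⟨g, hg.symm⟩

/-- Any `X 0 - f` with `f` independent of the variable `X 0` is a coordinate. -/
theorem MvPolynomial.exists_ringEquiv_X_sub_eq_X {K : Type*} [CommRing K] {n : ℕ}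
    {f : MvPolynomial (Fin (n + 1)) K}
    (hf : f ∈ MvPolynomial.supported K (({0} : Set (Fin (n + 1)))ᶜ)) :
    ∃ e : MvPolynomial (Fin (n + 1)) K ≃+* Polynomial (MvPolynomial (Fin n) K),
      e (X 0 - f) = Polynomial.X := by
  obtain ⟨g, hg⟩ := exists_finSuccEquiv_eq_C_of_mem_supported hf
  refine ⟨(MvPolynomial.finSuccEquiv K n).toRingEquiv.trans
    (Polynomial.algEquivAevalXAddC g).toRingEquiv, ?_⟩
  change Polynomial.algEquivAevalXAddC g (MvPolynomial.finSuccEquiv K n (X 0 - f)) = _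
  rw [map_sub, hg, MvPolynomial.finSuccEquiv_X_zero, map_sub]
  simp

/-- Let `F` be of full row rank with `d_l(F)` associated to `d₁^p`,
`d₁ = x₁ - f₁(x₂,…,xₙ)`.  If `J_k(F) = R` for `k = 1,…,l`, then `F` is equivalent to its
Smith normal form `[diag(d₁^{r_1},…,d₁^{r_l})  0]` with `r_k = p_k - p_{k-1}` where
`d_k(F)` is associated to `d₁^{p_k}` and `p_0 = 0`. -/
theorem statement7 {K : Type*} [Field K] {n l m : ℕ} (hlm : l ≤ m)
    (v1 : Fin n) (hv1 : (v1 : ℕ) = 0)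
    (F : Matrix (Fin l) (Fin m) (MvPolynomial (Fin n) K))
    (hfull : normalRank F = l)
    (f1 : MvPolynomial (Fin n) K)
    (hf1 : f1 ∈ MvPolynomial.supported K (({v1} : Set (Fin n))ᶜ))
    (p : ℕ) (hp : 0 < p)
    (pk : ℕ → ℕ) (hpk0 : pk 0 = 0) (hpl : pk l = p)
    (hpk : ∀ k, 1 ≤ k → k ≤ l → ∀ d, IsGcdMinors k F d →
      Associated d ((X v1 - f1) ^ pk k))
    (hJ : ∀ k, 1 ≤ k → k ≤ l → JEqTop k F) :
    MatEquiv F (Matrix.of fun (i : Fin l) (j : Fin m) =>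
      if (i : ℕ) = (j : ℕ) then (X v1 - f1) ^ (pk ((i : ℕ) + 1) - pk (i : ℕ)) else 0) := by
  obtain ⟨n, rfl⟩ : ∃ n', n = n' + 1 := ⟨n - 1, by have := v1.pos; omega⟩
  obtain rfl : v1 = 0 := Fin.ext hv1
  obtain ⟨e, he⟩ := MvPolynomial.exists_ringEquiv_X_sub_eq_X hf1
  have hF : ∀ k ≤ l, minorIdeal k F = Ideal.span {(X 0 - f1) ^ pk k} := fun k hk => by
    rcases Nat.eq_zero_or_pos k with rfl | hk0
    · rw [minorIdeal_zero, hpk0, pow_zero, Ideal.span_singleton_one]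
    · obtain ⟨d, hd, hdJ⟩ := hJ k hk0 hk
      rw [minorIdeal_eq_span_singleton hd hdJ, Ideal.span_singleton_eq_span_singleton]
      exact hpk k hk0 hk d hd
  have key := Polynomial.matEquiv_of_minorIdeal_eq_span_pow n hlm (F.map e.toRingHom) pk hpk0
    fun k hk => by
      rw [minorIdeal_map, hF k hk, Ideal.map_span, Set.image_singleton, map_pow]
      exact congrArg (fun x => Ideal.span {x ^ pk k}) he
  have he' : e.symm Polynomial.X = X 0 - f1 := by rw [← he, e.symm_apply_apply]
  convert key.map e.symm.toRingHom using 1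
  · ext1 i j
    exact (e.symm_apply_apply _).symm
  · ext1 i j
    rw [map_apply, of_apply, of_apply, apply_ite e.symm.toRingHom, map_zero, map_pow]
    exact congrArg (fun x => if (i : ℕ) = j then x ^ _ else 0) he'.symm
end

section
/- Let F, D, C ∈ R^{l×l} with F = D · C, where D = diag(x_1^{r_1}x_2^{s_1},..., x_1^{r_m}x_2^{s_m}, x_1^{r_{m+1}}x_2^{s_{m+1}} I_{l−m}) with r_1 ≤ ... ≤ r_m ≤ r_{m+1} and s_1 ≤ ... ≤ s_m ≤ s_{m+1}, and suppose d_i(F) is associated to x_1^{p_i}x_2^{q_i} for i = 1,...,m+1, where p_i = r_1+...+r_i and q_i = s_1+...+s_i for i ≤ m. Assume J_m(F) = R. Then: if p_{m+1} > r_1+...+r_m+r_{m+1}, it follows that d_m(C) is a unit, J_m(C) = R, and x_1 divides d_{m+1}(C); and if q_{m+1} > s_1+...+s_m+s_{m+1}, it follows that d_m(C) is a unit, J_m(C) = R, and x_2 divides d_{m+1}(C). -/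
open Matrix MvPolynomial

theorem det_submatrix_eq_zero_of_cons_minors {A : Type*} [CommRing A] [IsDomain A] {l m : ℕ}
    (C : Matrix (Fin l) (Fin l) A) (ri ci : Fin m → Fin l)
    (hne : (C.submatrix ri ci).det ≠ 0)
    (h : ∀ k j, (C.submatrix (Fin.cons k ri : Fin (m + 1) → Fin l)
      (Fin.cons j ci : Fin (m + 1) → Fin l)).det = 0)
    (ri' ci' : Fin (m + 1) → Fin l) : (C.submatrix ri' ci').det = 0 := by
  set c := (C.submatrix ri ci).det with hc
  let a : Fin (m + 1) → Fin m → A := fun t i =>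
    -((-1) ^ ((i.succ : Fin (m + 1)) : ℕ) *
      (C.submatrix ((Fin.cons (ri' t) ri : Fin (m + 1) → Fin l) ∘ i.succ.succAbove) ci).det)
  have key : ∀ t j, c * C (ri' t) j = ∑ i, a t i * C (ri i) j := by
    intro t j
    have := h (ri' t) j
    rw [det_succ_column_zero, Fin.sum_univ_succ] at this
    simp only [submatrix_apply, Fin.cons_zero, Fin.cons_succ, submatrix_submatrix] at this
    have e1 : ((Fin.cons (ri' t) ri : Fin (m + 1) → Fin l) ∘ (Fin.succAbove 0)) = ri := by
      ext i; simp
    have e2 : ((Fin.cons j ci : Fin (m + 1) → Fin l) ∘ Fin.succ) = ci := by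
      ext i; simp
    rw [e1, e2, ← hc] at this
    simp only [Fin.val_zero, pow_zero, one_mul] at this
    rw [mul_comm, eq_neg_of_add_eq_zero_left this, ← Finset.sum_neg_distrib]
    refine Finset.sum_congr rfl fun i _ => ?_
    simp only [a]
    ring
  let P : Matrix (Fin (m + 1)) (Fin (m + 1)) A := of fun t => Fin.cons 0 (a t)
  let Q : Matrix (Fin (m + 1)) (Fin (m + 1)) A :=
    of (Fin.cons (fun _ => 0) fun i j => C (ri i) (ci' j))
  have hPQ : c • C.submatrix ri' ci' = P * Q := by
    ext t j
    simp [P, Q, mul_apply, Fin.sum_univ_succ, key]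
  have hP : P.det = 0 := det_eq_zero_of_column_eq_zero 0 fun t => by simp [P]
  have := congrArg det hPQ
  rw [det_smul, det_mul, hP, zero_mul] at this
  exact (mul_eq_zero.mp this).resolve_left (pow_ne_zero _ hne)

theorem sum_range_le_sum_of_injective {f : ℕ → ℕ} (hf : Monotone f) {l m : ℕ}
    (ri : Fin m → Fin l) (hri : Function.Injective ri) :
    ∑ j ∈ Finset.range m, f j ≤ ∑ i, f (ri i) := by
  have hinj : Function.Injective fun i => (ri i : ℕ) := Fin.val_injective.comp hri
  let T : Finset ℕ := Finset.univ.image fun i => (ri i : ℕ)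
  have hT : T.card = m := by simp [T, Finset.card_image_of_injective _ hinj]
  have h1 : ∑ i, f (ri i) = ∑ t ∈ T, f t := by
    rw [Finset.sum_image (hinj.injOn)]
  have h2 : ∑ t ∈ T, f t = ∑ i : Fin m, f (T.orderEmbOfFin hT i) := by
    conv_lhs => rw [← Finset.image_orderEmbOfFin_univ T hT]
    rw [Finset.sum_image ((T.orderEmbOfFin hT).injective.injOn)]
  rw [h1, h2, Finset.sum_range]
  have hle : ∀ (k : ℕ) (hk : k < m), k ≤ T.orderEmbOfFin hT ⟨k, hk⟩ := by
    intro k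
    induction k with
    | zero => exact fun _ => Nat.zero_le _
    | succ k ih =>
      exact fun hk => (ih (by omega)).trans_lt
        ((T.orderEmbOfFin hT).strictMono (Fin.mk_lt_mk.mpr k.lt_succ_self))
  exact Finset.sum_le_sum fun i _ => hf (hle i i.isLt)

theorem det_diagonal_mul_submatrix {R : Type*} [CommRing R] {l k : ℕ} (w : Fin l → R)
    (C : Matrix (Fin l) (Fin l) R) (ri ci : Fin k → Fin l) :
    ((diagonal w * C).submatrix ri ci).det = (∏ i, w (ri i)) * (C.submatrix ri ci).det := by
  rw [← det_mul_column]
  congr 1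
  ext i j
  simp [diagonal_mul]

theorem prod_pow_mul_pow {R ι : Type*} [CommRing R] [Fintype ι] (x y : R) (f g : ι → ℕ) :
    ∏ i, (x ^ f i * y ^ g i) = x ^ (∑ i, f i) * y ^ (∑ i, g i) := by
  rw [Finset.prod_mul_distrib, Finset.prod_pow_eq_pow_sum, Finset.prod_pow_eq_pow_sum]

theorem exists_isGcdMinors {R : Type*} [CommRing R] [IsDomain R] [UniqueFactorizationMonoid R]
    {l k : ℕ} (F : Matrix (Fin l) (Fin l) R) : ∃ d, IsGcdMinors k F d := by
  classical
  let _ : NormalizedGCDMonoid R := Classical.choice inferInstance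
  have hfin : (minorsSet k F).Finite := by
    refine (Set.finite_range fun z : (Fin k → Fin l) × (Fin k → Fin l) =>
      (F.submatrix z.1 z.2).det).subset ?_
    rintro _ ⟨ri, ci, _, _, rfl⟩
    exact ⟨(ri, ci), rfl⟩
  refine ⟨hfin.toFinset.gcd id, fun a ha => ?_, fun e he => ?_⟩
  · exact Finset.gcd_dvd (f := id) (hfin.mem_toFinset.mpr ha)
  · exact Finset.dvd_gcd fun a ha => he a (hfin.mem_toFinset.mp ha)

theorem isUnit_of_dvd_of_span_eq_top {R : Type*} [CommRing R] {S : Set R}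
    (hS : Ideal.span S = ⊤) {e : R} (he : ∀ a ∈ S, e ∣ a) : IsUnit e := by
  rw [← Ideal.span_singleton_eq_top, eq_top_iff, ← hS, Ideal.span_le]
  exact fun a ha => Ideal.mem_span_singleton.mpr (he a ha)

theorem jEqTop_of_span_minorsSet {R : Type*} [CommRing R] {l k : ℕ}
    {C : Matrix (Fin l) (Fin l) R} (hC : Ideal.span (minorsSet k C) = ⊤) : JEqTop k C :=
  ⟨1, ⟨fun a _ => one_dvd a, fun _ he => (isUnit_of_dvd_of_span_eq_top hC he).dvd⟩, by
    simpa using hC⟩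

theorem span_minorsSet_eq_top {R : Type*} [CommRing R] [IsDomain R] {x y : R} (hx : x ≠ 0)
    (hy : y ≠ 0) {l m : ℕ} {C : Matrix (Fin l) (Fin l) R} {f g : ℕ → ℕ} (hf : Monotone f)
    (hg : Monotone g) {d : R}
    (hd : Associated d (x ^ (∑ j ∈ Finset.range m, f j) * y ^ (∑ j ∈ Finset.range m, g j)))
    (hspan : Ideal.span { b : R | d * b ∈ minorsSet m
      (diagonal (fun j : Fin l => x ^ f j * y ^ g j) * C) } = ⊤) :
    Ideal.span (minorsSet m C) = ⊤ := by
  rw [eq_top_iff, ← hspan, Ideal.span_le]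
  rintro b ⟨ri, ci, hri, hci, hb⟩
  rw [det_diagonal_mul_submatrix, prod_pow_mul_pow] at hb
  have hd0 : d ≠ 0 := hd.symm.ne_zero_iff.mp (mul_ne_zero (pow_ne_zero _ hx) (pow_ne_zero _ hy))
  obtain ⟨e, he⟩ := hd.dvd.trans (mul_dvd_mul
    (pow_dvd_pow x (sum_range_le_sum_of_injective hf ri hri))
    (pow_dvd_pow y (sum_range_le_sum_of_injective hg ri hri)))
  rw [he, mul_assoc] at hb
  rw [mul_left_cancel₀ hd0 hb]
  exact Ideal.mul_mem_left _ _ (Ideal.subset_span ⟨ri, ci, hri, hci, rfl⟩)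

theorem dvd_of_pow_dvd_pow_mul {R : Type*} [CommRing R] [IsDomain R] {x y c : R} (hx : Prime x)
    (hxy : ¬ x ∣ y) {N k t : ℕ} (hNk : k < N) (h : x ^ N ∣ x ^ k * y ^ t * c) : x ∣ c := by
  have h1 : x ^ k * x ∣ x ^ k * (y ^ t * c) := by
    rw [← pow_succ, ← mul_assoc]
    exact (pow_dvd_pow x hNk).trans h
  have h2 := (mul_dvd_mul_iff_left (pow_ne_zero k hx.ne_zero)).mp h1
  exact (hx.dvd_or_dvd h2).resolve_left fun h3 => hxy (hx.dvd_of_dvd_pow h3)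

theorem prime_dvd_minors {R : Type*} [CommRing R] [IsDomain R] {x y : R} (hx : Prime x)
    (hxy : ¬ x ∣ y) {l m : ℕ} {C : Matrix (Fin l) (Fin l) R} {f g : ℕ → ℕ} (hf : Monotone f)
    (hfm : ∀ k, f k ≤ f m) {d : R}
    (hd : Associated d (x ^ (∑ j ∈ Finset.range m, f j) * y ^ (∑ j ∈ Finset.range m, g j)))
    (hspan : Ideal.span { b : R | d * b ∈ minorsSet m
      (diagonal (fun j : Fin l => x ^ f j * y ^ g j) * C) } = ⊤)
    {N : ℕ} (hN : ∑ j ∈ Finset.range (m + 1), f j < N)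
    (hdvd : ∀ a ∈ minorsSet (m + 1) (diagonal (fun j : Fin l => x ^ f j * y ^ g j) * C),
      x ^ N ∣ a) :
    ∀ a ∈ minorsSet (m + 1) C, x ∣ a := by
  obtain ⟨b, ⟨ri, ci, hri, hci, hb⟩, hxb⟩ : ∃ b, d * b ∈ minorsSet m
      (diagonal (fun j : Fin l => x ^ f j * y ^ g j) * C) ∧ ¬ x ∣ b := by
    by_contra! hcon
    exact hx.not_isUnit (isUnit_of_dvd_of_span_eq_top hspan hcon)
  rw [det_diagonal_mul_submatrix, prod_pow_mul_pow] at hb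
  set c := (C.submatrix ri ci).det with hc
  have hdb : Associated (x ^ (∑ j ∈ Finset.range m, f j) *
      y ^ (∑ j ∈ Finset.range m, g j) * b)
      (x ^ (∑ i, f (ri i)) * y ^ (∑ i, g (ri i)) * c) := hb ▸ hd.symm.mul_right b
  have hle : ∑ i, f (ri i) ≤ ∑ j ∈ Finset.range m, f j := by
    by_contra! hlt
    exact hxb (dvd_of_pow_dvd_pow_mul hx hxy hlt
      ((dvd_mul_right _ _).trans ((mul_assoc _ _ _).symm.dvd.trans hdb.symm.dvd)))
  have hxc : ¬ x ∣ c := by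
    rintro ⟨e, he⟩
    refine hxb (dvd_of_pow_dvd_pow_mul hx hxy (Nat.lt_succ_self _) (dvd_trans ?_ hdb.symm.dvd))
    rw [pow_succ, he]
    refine dvd_trans (mul_dvd_mul_right
      (pow_dvd_pow x (sum_range_le_sum_of_injective hf ri hri)) x) ⟨y ^ (∑ i, g (ri i)) * e, ?_⟩
    ring
  have hcons : ∀ k j, x ∣ (C.submatrix (Fin.cons k ri : Fin (m + 1) → Fin l)
      (Fin.cons j ci : Fin (m + 1) → Fin l)).det := by
    intro k j
    by_cases hk : Function.Injective (Fin.cons k ri : Fin (m + 1) → Fin l)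
    swap
    · obtain ⟨i₁, i₂, h, hne⟩ := Function.not_injective_iff.mp hk
      rw [det_zero_of_row_eq hne (by ext t; simp only [submatrix_apply, h])]
      exact dvd_zero x
    by_cases hj : Function.Injective (Fin.cons j ci : Fin (m + 1) → Fin l)
    swap
    · obtain ⟨i₁, i₂, h, hne⟩ := Function.not_injective_iff.mp hj
      rw [det_zero_of_column_eq hne (fun t => by simp only [submatrix_apply, h])]
      exact dvd_zero x
    have := hdvd _ ⟨_, _, hk, hj, rfl⟩
    rw [det_diagonal_mul_submatrix, prod_pow_mul_pow] at this
    refine dvd_of_pow_dvd_pow_mul hx hxy (lt_of_le_of_lt ?_ hN) this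
    rw [Fin.sum_univ_succ, Finset.sum_range_succ, add_comm]
    simp only [Fin.cons_zero, Fin.cons_succ]
    exact add_le_add hle (hfm k)
  rintro _ ⟨ri', ci', _, _, rfl⟩
  have : (Ideal.span {x}).IsPrime := (Ideal.span_singleton_prime hx.ne_zero).mpr hx
  let π := Ideal.Quotient.mk (Ideal.span {x})
  have hπ : ∀ a, π a = 0 ↔ x ∣ a := fun a => by
    rw [Ideal.Quotient.eq_zero_iff_mem, Ideal.mem_span_singleton]
  have hdet : ∀ {k : ℕ} (u v : Fin k → Fin l),
      ((C.map π).submatrix u v).det = π (C.submatrix u v).det := fun u v => by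
    rw [RingHom.map_det]
    rfl
  rw [← hπ, ← hdet]
  refine det_submatrix_eq_zero_of_cons_minors (C.map π) ri ci ?_ (fun k j => ?_) ri' ci'
  · rw [hdet, Ne, hπ]
    exact hxc
  · rw [hdet, hπ]
    exact hcons k j

/-- Let `F = D * C` with
`D = diag(x₁^{r₁}x₂^{s₁},…,x₁^{rₘ}x₂^{sₘ}, x₁^{r_{m+1}}x₂^{s_{m+1}} I_{l-m})`
(indices `r 0,…,r m` below stand for `r₁,…,r_{m+1}`), `d_i(F)` associated to
`x₁^{p_i}x₂^{q_i}` for `i = 1,…,m+1`, `p_i = r₁+⋯+r_i`, `q_i = s₁+⋯+s_i` for `i ≤ m`, and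
`J_m(F) = R`.  If `p_{m+1} > r₁+⋯+r_{m+1}` then `d_m(C)` is a unit, `J_m(C) = R` and
`x₁ ∣ d_{m+1}(C)`; if `q_{m+1} > s₁+⋯+s_{m+1}` then `d_m(C)` is a unit, `J_m(C) = R` and
`x₂ ∣ d_{m+1}(C)`. -/
theorem statement8 {K : Type*} [Field K] {n l : ℕ}
    (v1 v2 : Fin n) (hv1 : (v1 : ℕ) = 0) (hv2 : (v2 : ℕ) = 1)
    (m : ℕ) (hm : m < l)
    (F D C : Matrix (Fin l) (Fin l) (MvPolynomial (Fin n) K))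
    (r s : ℕ → ℕ)
    (hrmono : ∀ i j, i ≤ j → j ≤ m → r i ≤ r j)
    (hsmono : ∀ i j, i ≤ j → j ≤ m → s i ≤ s j)
    (hD : D = Matrix.diagonal (fun jj : Fin l =>
      X v1 ^ r (min (jj : ℕ) m) * X v2 ^ s (min (jj : ℕ) m)))
    (hF : F = D * C)
    (p q : ℕ → ℕ)
    (hd : ∀ i, 1 ≤ i → i ≤ m + 1 → ∀ d, IsGcdMinors i F d →
      Associated d (X v1 ^ p i * X v2 ^ q i))
    (hpi : ∀ i ≤ m, p i = ∑ j ∈ Finset.range i, r j)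
    (hqi : ∀ i ≤ m, q i = ∑ j ∈ Finset.range i, s j)
    (hJ : JEqTop m F) :
    (p (m + 1) > ∑ j ∈ Finset.range (m + 1), r j →
      (∀ d, IsGcdMinors m C d → IsUnit d) ∧ JEqTop m C ∧
        (∀ d, IsGcdMinors (m + 1) C d → X v1 ∣ d)) ∧
    (q (m + 1) > ∑ j ∈ Finset.range (m + 1), s j →
      (∀ d, IsGcdMinors m C d → IsUnit d) ∧ JEqTop m C ∧
        (∀ d, IsGcdMinors (m + 1) C d → X v2 ∣ d)) := by
  have hne : v1 ≠ v2 := fun h => by rw [h] at hv1; omega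
  have hx : Prime (X v1 : MvPolynomial (Fin n) K) := X_prime
  have hy : Prime (X v2 : MvPolynomial (Fin n) K) := X_prime
  have hxy : ¬ (X v1 : MvPolynomial (Fin n) K) ∣ X v2 := by
    simpa [MvPolynomial.X_dvd_X] using hne
  have hyx : ¬ (X v2 : MvPolynomial (Fin n) K) ∣ X v1 := by
    simpa [MvPolynomial.X_dvd_X] using hne.symm
  have hf : Monotone fun j => r (min j m) := fun a b hab =>
    hrmono _ _ (min_le_min_right m hab) (min_le_right _ _)
  have hg : Monotone fun j => s (min j m) := fun a b hab =>
    hsmono _ _ (min_le_min_right m hab) (min_le_right _ _)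
  have hsum : ∀ (t : ℕ → ℕ) (k : ℕ), k ≤ m + 1 →
      ∑ j ∈ Finset.range k, t (min j m) = ∑ j ∈ Finset.range k, t j := fun t k hk =>
    Finset.sum_congr rfl fun j hj => by
      rw [min_eq_left]
      have := Finset.mem_range.mp hj
      omega
  subst hD hF
  obtain ⟨d, hdm, hspan⟩ := hJ
  have hassoc : Associated d (X v1 ^ (∑ j ∈ Finset.range m, r (min j m)) *
      X v2 ^ (∑ j ∈ Finset.range m, s (min j m))) := by
    rw [hsum r m m.le_succ, hsum s m m.le_succ]
    rcases Nat.eq_zero_or_pos m with rfl | hm0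
    · simp only [Finset.range_zero, Finset.sum_empty, pow_zero, mul_one]
      exact associated_one_iff_isUnit.mpr (isUnit_of_dvd_one (hdm.1 1
        ⟨Fin.elim0, Fin.elim0, fun i => i.elim0, fun i => i.elim0, by simp⟩))
    · rw [← hpi m le_rfl, ← hqi m le_rfl]
      exact hd m hm0 m.le_succ d hdm
  have hC := span_minorsSet_eq_top hx.ne_zero hy.ne_zero hf hg hassoc hspan
  obtain ⟨d', hd'⟩ := exists_isGcdMinors (k := m + 1) (Matrix.diagonal (fun jj : Fin l =>
      (X v1 ^ r (min (jj : ℕ) m) * X v2 ^ s (min (jj : ℕ) m) : MvPolynomial (Fin n) K)) * C)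
  have hd'dvd := (hd (m + 1) (Nat.le_add_left 1 m) le_rfl d' hd').symm.dvd
  have hunit : ∀ d, IsGcdMinors m C d → IsUnit d := fun d hd =>
    isUnit_of_dvd_of_span_eq_top hC hd.1
  refine ⟨fun hp => ⟨hunit, jEqTop_of_span_minorsSet hC, fun e he => he.2 _ ?_⟩,
    fun hq => ⟨hunit, jEqTop_of_span_minorsSet hC, fun e he => he.2 _ ?_⟩⟩
  · rw [gt_iff_lt, ← hsum r (m + 1) le_rfl] at hp
    exact prime_dvd_minors hx hxy hf (fun k => hrmono _ _ (by simp) (min_le_right _ _)) hassoc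
      hspan hp fun a ha => ((dvd_mul_right _ _).trans hd'dvd).trans (hd'.1 a ha)
  · rw [gt_iff_lt, ← hsum s (m + 1) le_rfl] at hq
    simp only [mul_comm (X v1 ^ _) (X v2 ^ _)] at hassoc hspan hd'
    exact prime_dvd_minors hy hyx hg (fun k => hsmono _ _ (by simp) (min_le_right _ _)) hassoc
      hspan hq fun a ha => ((dvd_mul_left _ _).trans hd'dvd).trans (hd'.1 a ha)
end
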